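/- Let f ∈ ℤ[X] be a nonconstant polynomial, let K be the splitting field of f over ℚ, let G = Gal(K/ℚ), let R be the set of roots of f in K, and set δ_f = #{σ ∈ G : σ(α) = α for some α ∈ R} / #G. Let 𝒫_f be the set of primes p dividing f(n) for some positive integer n, and for x ≥ 1 let 𝒫_f(x) = 𝒫_f ∩ [1, x]. Then there exist constants C_f > 0 and D_f > 0 such that for all x ≥ 2, | #𝒫_f(x) − δ_f · ∫₂ˣ dt/log t | ≤ D_f · x / exp(C_f √(log x)). -/

import Mathlib

open Polynomial

open Complex Metric in
/-- Local bound for the logarithmic derivative of a nonvanishing holomorphic function. -/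
theorem norm_logDeriv_le_of_ne_zero {f : ℂ → ℂ} {c : ℂ} {R M : ℝ} (hR : 0 < R) (hM : 0 < M)
    (hf : DifferentiableOn ℂ f (ball c R)) (h0 : ∀ z ∈ ball c R, f z ≠ 0)
    (hb : ∀ z ∈ ball c R, ‖f z‖ ≤ Real.exp M * ‖f c‖) {z : ℂ} (hz : dist z c ≤ R / 2) :
    ‖logDeriv f z‖ ≤ 24 * M / R := by
  have hlog : DifferentiableOn ℂ (logDeriv f) (ball c R) :=
    (hf.deriv isOpen_ball).div hf h0
  obtain ⟨h₀, hh₀⟩ := hlog.isExactOn_ball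
  set h : ℂ → ℂ := fun z ↦ h₀ z - h₀ c with hdef
  have hh : ∀ z ∈ ball c R, HasDerivAt h (logDeriv f z) z := fun z hz ↦
    (hh₀ z hz).sub_const _
  have hc : c ∈ ball c R := mem_ball_self hR
  have hconst : ∀ z ∈ ball c R, f z * exp (-h z) = f c := by
    intro z hz
    have hd : ∀ w ∈ ball c R, HasDerivAt (fun w ↦ f w * exp (-h w)) 0 w := by
      intro w hw
      have h1 := (hf.differentiableAt (isOpen_ball.mem_nhds hw)).hasDerivAt
      refine (h1.mul ((hh w hw).neg.cexp)).congr_deriv ?_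
      rw [logDeriv_apply, Pi.neg_apply]
      field_simp [h0 w hw]
      ring
    have := IsOpen.is_const_of_deriv_eq_zero isOpen_ball (convex_ball c R).isPreconnected
      (f := fun w ↦ f w * exp (-h w))
      (fun w hw ↦ (hd w hw).differentiableAt.differentiableWithinAt)
      (fun w hw ↦ (hd w hw).deriv) hz hc
    simpa [hdef] using this
  have hre : ∀ z ∈ ball c R, (h z).re ≤ M := by
    intro z hz
    have h1 := hconst z hz
    have h2 : f z = f c * exp (h z) := by
      rw [← h1, mul_assoc, ← exp_add]; simp
    have h3 := hb z hz
    rw [h2, norm_mul, norm_exp, mul_comm] at h3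
    have h4 := le_of_mul_le_mul_right h3 (norm_pos_iff.2 (h0 c hc))
    exact Real.exp_le_exp.1 h4
  have hbound : ∀ w, dist w c ≤ 3 * R / 4 → ‖h w‖ ≤ 6 * M := by
    intro w hw
    have hmem : ∀ u, u ∈ ball (0 : ℂ) R → c + u ∈ ball c R := by
      intro u hu
      simpa [mem_ball, dist_eq_norm] using hu
    have hw' : w - c ∈ ball (0 : ℂ) R := by
      rw [mem_ball_zero_iff, ← dist_eq_norm]; linarith
    have := borelCaratheodory_zero (f := fun u ↦ h (c + u)) (R := R) (z := w - c) hM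
      (fun u hu ↦ ((hh _ (hmem u hu)).comp_const_add c u).differentiableAt.differentiableWithinAt)
      (fun u hu ↦ hre _ (hmem u hu)) hR hw' (by simp [hdef])
    simp only [add_sub_cancel, ← dist_eq_norm w c] at this
    refine this.trans ?_
    rw [div_le_iff₀ (by linarith)]
    nlinarith
  have hsub : ∀ w ∈ closedBall z (R / 4), dist w c ≤ 3 * R / 4 := fun w hw ↦ by
    have := dist_triangle w z c
    rw [mem_closedBall] at hw
    linarith
  have hcl : DiffContOnCl ℂ h (ball z (R / 4)) := by
    apply DifferentiableOn.diffContOnCl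
    rw [closure_ball z (by linarith : R / 4 ≠ 0)]
    intro w hw
    exact (hh w (by rw [mem_ball]; linarith [hsub w hw])).differentiableAt.differentiableWithinAt
  have := norm_deriv_le_of_forall_mem_sphere_norm_le (by linarith : 0 < R / 4) hcl
    (C := 6 * M) (fun w hw ↦ hbound w (hsub w (sphere_subset_closedBall hw)))
  rw [(hh z (by rw [mem_ball]; linarith)).deriv] at this
  refine this.trans (le_of_eq ?_)
  field_simp
  norm_num

open Complex Metric ComplexConjugate in
/-- Division of a holomorphic function by the Blaschke factor of one of its zeros. -/
theorem exists_eq_blaschke_mul {f : ℂ → ℂ} {r A : ℝ} (hr : 0 < r) {ρ : ℂ}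
    (hf : DifferentiableOn ℂ f (closedBall 0 r)) (hb : ∀ z ∈ closedBall 0 r, ‖f z‖ ≤ A)
    (hρ : ‖ρ‖ < r) (hρ0 : ρ ≠ 0) (hfρ : f ρ = 0) (hf0 : f 0 ≠ 0) :
    ∃ g : ℂ → ℂ, DifferentiableOn ℂ g (closedBall 0 r) ∧ (∀ z ∈ closedBall 0 r, ‖g z‖ ≤ A) ∧
      g 0 ≠ 0 ∧ ‖g 0‖ = ‖f 0‖ * (r / ‖ρ‖) ∧
      (∀ z ∈ closedBall 0 r, g z = 0 → f z = 0) ∧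
      (logDeriv f 0).re = (logDeriv g 0).re + (-ρ).re * (1 / ‖ρ‖ ^ 2 - 1 / r ^ 2) := by
  have hnhds : closedBall (0 : ℂ) r ∈ nhds ρ :=
    Filter.mem_of_superset (isOpen_ball.mem_nhds (mem_ball_zero_iff.2 hρ)) ball_subset_closedBall
  set q := dslope f ρ with hq
  have hqd : DifferentiableOn ℂ q (closedBall 0 r) := (differentiableOn_dslope hnhds).2 hf
  have hfq : ∀ z, f z = (z - ρ) * q z := fun z ↦ by
    have := sub_smul_dslope f ρ z
    rw [hfρ, sub_zero, smul_eq_mul] at this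
    exact this.symm
  set g : ℂ → ℂ := fun z ↦ q z * ((r ^ 2 - conj ρ * z) / r) with hg
  have hrC : (r : ℂ) ≠ 0 := by exact_mod_cast hr.ne'
  have hfac : ∀ z : ℂ, ‖z‖ ≤ r → (r : ℂ) ^ 2 - conj ρ * z ≠ 0 := by
    intro z hz h
    have h1 : (r : ℂ) ^ 2 = conj ρ * z := sub_eq_zero.1 h
    have h2 : r ^ 2 = ‖ρ‖ * ‖z‖ := by
      have := congrArg norm h1
      simpa [abs_of_pos hr] using this
    nlinarith [norm_nonneg ρ, norm_nonneg z]
  have hgd : DifferentiableOn ℂ g (closedBall 0 r) := by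
    refine hqd.mul ?_
    fun_prop
  have hg0 : ‖g 0‖ = ‖f 0‖ * (r / ‖ρ‖) := by
    have hρn : ‖ρ‖ ≠ 0 := norm_ne_zero_iff.2 hρ0
    rw [hfq 0, hg]
    simp [abs_of_pos hr]
    field_simp
  have hq0 : q 0 ≠ 0 := fun h ↦ hf0 (by rw [hfq, h, mul_zero])
  refine ⟨g, hgd, ?_, ?_, hg0, ?_, ?_⟩
  · intro z hz
    have hcl : DiffContOnCl ℂ g (ball 0 r) := by
      apply DifferentiableOn.diffContOnCl
      rwa [closure_ball _ hr.ne']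
    refine norm_le_of_forall_mem_frontier_norm_le isBounded_ball hcl (C := A) ?_
      (by rwa [closure_ball _ hr.ne'])
    intro w hw
    rw [frontier_ball _ hr.ne'] at hw
    have hwr : ‖w‖ = r := by simpa using hw
    have key : ‖(r : ℂ) ^ 2 - conj ρ * w‖ = r * ‖w - ρ‖ := by
      have h1 : (r : ℂ) ^ 2 = conj w * w := by
        rw [← Complex.normSq_eq_conj_mul_self, Complex.normSq_eq_norm_sq, hwr]; push_cast; rfl
      rw [h1, ← sub_mul, ← map_sub, norm_mul, norm_conj, hwr, mul_comm]
    have h2 : ‖g w‖ = ‖f w‖ := by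
      rw [hg, hfq w]
      simp only [norm_mul, norm_div, key, Complex.norm_real, Real.norm_eq_abs, abs_of_pos hr]
      field_simp
    rw [h2]
    exact hb w (sphere_subset_closedBall hw)
  · exact mul_ne_zero hq0 (div_ne_zero (hfac 0 (by simpa using hr.le)) hrC)
  · intro z hz h
    have hz' : ‖z‖ ≤ r := by simpa using hz
    have : q z = 0 := (mul_eq_zero.1 h).resolve_right (div_ne_zero (hfac z hz') hrC)
    rw [hfq, this, mul_zero]
  · have hqdiff : DifferentiableAt ℂ q 0 :=
      hqd.differentiableAt (Filter.mem_of_superset (isOpen_ball.mem_nhds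
        (mem_ball_self hr)) ball_subset_closedBall)
    have e1 : logDeriv f 0 = logDeriv (fun z ↦ z - ρ) 0 + logDeriv q 0 := by
      rw [← logDeriv_mul 0 (by simpa using hρ0) hq0 (by fun_prop) hqdiff]
      congr 1
      ext z; exact hfq z
    have e2 : logDeriv g 0 = logDeriv q 0 + logDeriv (fun z : ℂ ↦ (r ^ 2 - conj ρ * z) / r) 0 := by
      refine logDeriv_mul (g := fun z : ℂ ↦ (r ^ 2 - conj ρ * z) / r) 0 hq0 ?_ hqdiff
        (by fun_prop)
      exact div_ne_zero (hfac 0 (by simpa using hr.le)) hrC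
    have e3 : logDeriv (fun z ↦ z - ρ) 0 = -ρ⁻¹ := by
      rw [logDeriv_apply]; simp
    have e4 : logDeriv (fun z : ℂ ↦ (r ^ 2 - conj ρ * z) / r) 0 = - conj ρ / r ^ 2 := by
      have : HasDerivAt (fun z : ℂ ↦ (r ^ 2 - conj ρ * z) / r) (-(conj ρ * 1) / r) 0 :=
        (((hasDerivAt_id (0 : ℂ)).const_mul (conj ρ)).const_sub _).div_const _
      rw [logDeriv_apply, this.deriv]
      simp
      field_simp
    rw [e1, e2, e3, e4]
    have h5 : (-ρ⁻¹).re = -ρ.re / ‖ρ‖ ^ 2 := by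
      rw [neg_re, inv_re, ← Complex.normSq_eq_norm_sq]; ring
    have h6 : (-conj ρ / (r : ℂ) ^ 2).re = - ρ.re / r ^ 2 := by
      rw [← ofReal_pow, div_ofReal_re]; simp
    rw [add_re, add_re, h5, h6, neg_re]
    ring

open Complex Metric in
/-- A lower bound for the real part of the logarithmic derivative of a holomorphic function
all of whose zeros lie in a half plane. -/
theorem neg_le_re_logDeriv_zero {r r' A : ℝ} (hr' : 0 < r') (hrr : r' < r) (k : ℕ) :
    ∀ {f : ℂ → ℂ} {M : ℝ}, 0 < M → DifferentiableOn ℂ f (closedBall 0 r) →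
      (∀ z ∈ closedBall 0 r, ‖f z‖ ≤ A) → f 0 ≠ 0 →
      (∀ z ∈ closedBall 0 r, f z = 0 → z.re ≤ 0) → A ≤ Real.exp M * ‖f 0‖ →
      A * (r' / r) ^ k ≤ ‖f 0‖ → -(24 * M / r') ≤ (logDeriv f 0).re := by
  have hr : 0 < r := hr'.trans hrr
  induction k with
  | zero =>
    intro f M hM hf hb hf0 hre hA hk
    by_cases hz : ∀ z ∈ ball 0 r', f z ≠ 0
    · have hsub : ball (0 : ℂ) r' ⊆ closedBall 0 r :=
        (ball_subset_ball hrr.le).trans ball_subset_closedBall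
      have := norm_logDeriv_le_of_ne_zero hr' hM (hf.mono hsub) hz
        (fun z hz ↦ (hb z (hsub hz)).trans hA) (z := 0) (by rw [dist_self]; linarith)
      exact neg_le_of_abs_le ((abs_re_le_norm _).trans this)
    · push Not at hz
      obtain ⟨ρ, hρ, hfρ⟩ := hz
      have hρ0 : ρ ≠ 0 := fun h ↦ hf0 (h ▸ hfρ)
      have hρr : ‖ρ‖ < r' := by simpa using hρ
      obtain ⟨g, -, hgb, -, hg0, -, -⟩ :=
        exists_eq_blaschke_mul hr hf hb (hρr.trans hrr) hρ0 hfρ hf0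
      have h1 := hgb 0 (mem_closedBall_self hr.le)
      have h2 : 1 < r / ‖ρ‖ := by
        rw [one_lt_div (norm_pos_iff.2 hρ0)]; linarith
      have h3 := norm_pos_iff.2 hf0
      rw [hg0] at h1
      simp only [pow_zero, mul_one] at hk
      nlinarith
  | succ k ih =>
    intro f M hM hf hb hf0 hre hA hk
    by_cases hz : ∀ z ∈ ball 0 r', f z ≠ 0
    · have hsub : ball (0 : ℂ) r' ⊆ closedBall 0 r :=
        (ball_subset_ball hrr.le).trans ball_subset_closedBall
      have := norm_logDeriv_le_of_ne_zero hr' hM (hf.mono hsub) hz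
        (fun z hz ↦ (hb z (hsub hz)).trans hA) (z := 0) (by rw [dist_self]; linarith)
      exact neg_le_of_abs_le ((abs_re_le_norm _).trans this)
    · push Not at hz
      obtain ⟨ρ, hρ, hfρ⟩ := hz
      have hρ0 : ρ ≠ 0 := fun h ↦ hf0 (h ▸ hfρ)
      have hρr : ‖ρ‖ < r' := by simpa using hρ
      have hρp := norm_pos_iff.2 hρ0
      obtain ⟨g, hgd, hgb, hg0, hgn, hgz, hgl⟩ :=
        exists_eq_blaschke_mul hr hf hb (hρr.trans hrr) hρ0 hfρ hf0
      have h2 : r / r' ≤ r / ‖ρ‖ := by gcongr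
      have h2' : 1 ≤ r / r' := by rw [one_le_div hr']; exact hrr.le
      have hfp := norm_pos_iff.2 hf0
      have hle : ‖f 0‖ ≤ ‖g 0‖ := by rw [hgn]; nlinarith
      have := ih hM hgd hgb hg0 (fun z hz h ↦ hre z hz (hgz z hz h))
        (hA.trans (by gcongr)) (by
          rw [hgn]
          calc A * (r' / r) ^ k = A * (r' / r) ^ (k + 1) * (r / r') := by
                rw [pow_succ]; field_simp
            _ ≤ ‖f 0‖ * (r / ‖ρ‖) := by gcongr)
      rw [hgl]
      have h5 : 0 ≤ (-ρ).re := by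
        have := hre ρ (mem_closedBall.2 (by simpa using (hρr.trans hrr).le)) hfρ
        simpa using this
      have h6 : 0 ≤ 1 / ‖ρ‖ ^ 2 - 1 / r ^ 2 := by
        rw [sub_nonneg]; gcongr; linarith
      nlinarith [mul_nonneg h5 h6]

open Complex Metric in
/-- Landau's inequality: the contribution of one zero to the real part of the logarithmic
derivative. -/
theorem re_logDeriv_ge {f : ℂ → ℂ} {c : ℂ} {r M : ℝ} (hr : 0 < r) (hM : 0 < M)
    (hf : DifferentiableOn ℂ f (closedBall c r))
    (hb : ∀ z ∈ closedBall c r, ‖f z‖ ≤ Real.exp M * ‖f c‖) (hc : f c ≠ 0)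
    (hre : ∀ z ∈ closedBall c r, f z = 0 → z.re ≤ c.re) :
    -(48 * M / r) ≤ (logDeriv f c).re ∧ ∀ ρ, ‖ρ - c‖ < r → f ρ = 0 →
      (c - ρ).re * (1 / ‖ρ - c‖ ^ 2 - 1 / r ^ 2) - 48 * M / r ≤ (logDeriv f c).re := by
  set F : ℂ → ℂ := fun z ↦ f (c + z) with hF
  have hmem : ∀ z ∈ closedBall (0 : ℂ) r, c + z ∈ closedBall c r := fun z hz ↦ by
    simpa [dist_eq_norm] using hz
  have hFd : DifferentiableOn ℂ F (closedBall 0 r) :=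
    hf.comp (by fun_prop) hmem
  have hF0 : F 0 = f c := by simp [hF]
  have hlog : logDeriv F 0 = logDeriv f c := by
    rw [logDeriv_apply, logDeriv_apply, hF0, hF, deriv_comp_const_add, add_zero]
  have main : ∀ g : ℂ → ℂ, DifferentiableOn ℂ g (closedBall 0 r) →
      (∀ z ∈ closedBall 0 r, ‖g z‖ ≤ Real.exp M * ‖f c‖) → g 0 ≠ 0 →
      (∀ z ∈ closedBall 0 r, g z = 0 → z.re ≤ 0) → ‖f c‖ ≤ ‖g 0‖ →
      -(48 * M / r) ≤ (logDeriv g 0).re := by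
    intro g hg hgb hg0 hgre hgc
    have hlim := (tendsto_pow_atTop_nhds_zero_of_lt_one (r := (r / 2) / r) (by positivity)
      (by rw [div_lt_one hr]; linarith)).const_mul (Real.exp M * ‖f c‖)
    rw [mul_zero] at hlim
    obtain ⟨k, hk⟩ := (hlim.eventually_le_const (norm_pos_iff.2 hg0)).exists
    have := neg_le_re_logDeriv_zero (r' := r / 2) (by linarith) (by linarith) k hM hg hgb hg0 hgre
      (by gcongr) hk
    calc -(48 * M / r) = -(24 * M / (r / 2)) := by field_simp; norm_num
      _ ≤ _ := this
  have hFb : ∀ z ∈ closedBall 0 r, ‖F z‖ ≤ Real.exp M * ‖f c‖ := fun z hz ↦ hb _ (hmem z hz)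
  have hFre : ∀ z ∈ closedBall 0 r, F z = 0 → z.re ≤ 0 := fun z hz h ↦ by
    have := hre _ (hmem z hz) h
    simpa using this
  refine ⟨?_, fun ρ hρ hfρ ↦ ?_⟩
  · rw [← hlog]
    exact main F hFd hFb (hF0 ▸ hc) hFre (by rw [hF0])
  · have hρ0 : ρ - c ≠ 0 := fun h ↦ hc (by rw [← sub_eq_zero.1 h]; exact hfρ)
    obtain ⟨g, hgd, hgb, hg0, hgn, hgz, hgl⟩ :=
      exists_eq_blaschke_mul hr hFd hFb hρ hρ0 (by simp [hF, hfρ]) (hF0 ▸ hc)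
    have := main g hgd hgb hg0 (fun z hz h ↦ hFre z hz (hgz z hz h)) (by
      rw [hgn, hF0]
      refine le_mul_of_one_le_right (norm_nonneg _) ?_
      rw [one_le_div (norm_pos_iff.2 hρ0)]
      exact hρ.le)
    rw [← hlog, hgl, neg_sub]
    linarith

section

/-- Nonnegative coefficients `a` of a Dirichlet series whose summatory function is `κ x` up to a
power saving, together with nonnegative `Λ` satisfying `a log = Λ ⋆ a`. -/
structure IsVonMangoldtPair (a Λ : ℕ → ℝ) (κ θ : ℝ) : Prop where
  zero : a 0 = 0
  one : a 1 = 1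
  nonneg : ∀ n, 0 ≤ a n
  mangoldt_zero : Λ 0 = 0
  mangoldt_nonneg : ∀ n, 0 ≤ Λ n
  conv : ∀ n, n ≠ 0 → a n * Real.log n = ∑ p ∈ n.divisorsAntidiagonal, Λ p.1 * a p.2
  theta_nonneg : 0 ≤ θ
  theta_lt : θ < 1
  residue_pos : 0 < κ
  count : ∃ C, 0 ≤ C ∧ ∀ n : ℕ, |∑ k ∈ Finset.Icc 1 n, a k - κ * n| ≤ C * (n : ℝ) ^ θ

namespace IsVonMangoldtPair

open Filter Asymptotics MeasureTheory Complex LSeries Topology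

variable {a Λ : ℕ → ℝ} {κ θ : ℝ}

theorem isBigO_sum (h : IsVonMangoldtPair a Λ κ θ) :
    (fun n : ℕ ↦ ∑ k ∈ Finset.Icc 1 n, a k) =O[atTop] fun n ↦ (n : ℝ) ^ (1 : ℝ) := by
  obtain ⟨C, hC0, hC⟩ := h.count
  refine IsBigO.of_bound (C + κ) ?_
  filter_upwards [eventually_ge_atTop 1] with n hn
  have hn1 : (1 : ℝ) ≤ n := by exact_mod_cast hn
  have h1 : (n : ℝ) ^ θ ≤ n := by
    calc (n : ℝ) ^ θ ≤ (n : ℝ) ^ (1 : ℝ) := Real.rpow_le_rpow_of_exponent_le hn1 h.theta_lt.le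
      _ = n := Real.rpow_one _
  have h2 := (abs_le.1 (hC n)).2
  rw [Real.norm_of_nonneg (Finset.sum_nonneg fun k _ ↦ h.nonneg k), Real.rpow_one,
    Real.norm_of_nonneg (by linarith)]
  nlinarith

theorem mangoldt_one (h : IsVonMangoldtPair a Λ κ θ) : Λ 1 = 0 := by
  have := h.conv 1 one_ne_zero
  simp [h.one] at this
  exact this.symm

theorem mangoldt_le (h : IsVonMangoldtPair a Λ κ θ) (n : ℕ) : Λ n ≤ a n * Real.log n := by
  rcases eq_or_ne n 0 with rfl | hn
  · simp [h.mangoldt_zero]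
  · rw [h.conv n hn]
    have : Λ n = Λ (n, 1).1 * a (n, 1).2 := by simp [h.one]
    rw [this]
    exact Finset.single_le_sum (f := fun p : ℕ × ℕ ↦ Λ p.1 * a p.2)
      (fun p _ ↦ mul_nonneg (h.mangoldt_nonneg _) (h.nonneg _)) (by simp [hn])

theorem abscissa_le (h : IsVonMangoldtPair a Λ κ θ) :
    abscissaOfAbsConv (fun n ↦ (a n : ℂ)) ≤ ((1 : ℝ) : EReal) :=
  abscissaOfAbsConv_le_of_forall_lt_LSeriesSummable fun y hy ↦
    LSeriesSummable_of_sum_norm_bigO_and_nonneg h.isBigO_sum h.nonneg zero_le_one (by simpa)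

theorem abscissa_lt (h : IsVonMangoldtPair a Λ κ θ) {s : ℂ} (hs : 1 < s.re) :
    abscissaOfAbsConv (fun n ↦ (a n : ℂ)) < s.re :=
  h.abscissa_le.trans_lt (by exact_mod_cast hs)

theorem summable (h : IsVonMangoldtPair a Λ κ θ) {s : ℂ} (hs : 1 < s.re) :
    LSeriesSummable (fun n ↦ (a n : ℂ)) s :=
  LSeriesSummable_of_abscissaOfAbsConv_lt_re (h.abscissa_lt hs)

theorem summable_mangoldt (h : IsVonMangoldtPair a Λ κ θ) {s : ℂ} (hs : 1 < s.re) :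
    LSeriesSummable (fun n ↦ (Λ n : ℂ)) s := by
  refine Summable.of_norm_bounded (LSeriesSummable_logMul_of_lt_re (h.abscissa_lt hs)).norm
    fun n ↦ norm_term_le s ?_
  have h1 := h.mangoldt_le n
  have h2 : Complex.log (n : ℂ) = (Real.log n : ℂ) := (Complex.natCast_log).symm
  rw [logMul, h2, ← ofReal_mul, Complex.norm_real, Complex.norm_real,
    Real.norm_of_nonneg (h.mangoldt_nonneg n), mul_comm]
  exact h1.trans (le_abs_self _)

theorem mangoldt_mul (h : IsVonMangoldtPair a Λ κ θ) {s : ℂ} (hs : 1 < s.re) :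
    HasDerivAt (LSeries fun n ↦ (a n : ℂ))
      (-(LSeries (fun n ↦ (Λ n : ℂ)) s * LSeries (fun n ↦ (a n : ℂ)) s)) s := by
  rw [← LSeries_convolution' (h.summable_mangoldt hs) (h.summable hs)]
  convert LSeries_hasDerivAt (h.abscissa_lt hs) using 2
  refine LSeries_congr (fun {n} hn ↦ ?_) s
  rw [LSeries.convolution_def, logMul, ← Complex.natCast_log, mul_comm, ← ofReal_mul, h.conv n hn]
  push_cast
  rfl

theorem abscissa_log_lt (h : IsVonMangoldtPair a Λ κ θ) {s : ℂ} (hs : 1 < s.re) :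
    abscissaOfAbsConv (fun n ↦ ((Λ n / Real.log n : ℝ) : ℂ)) < s.re := by
  have : abscissaOfAbsConv (fun n ↦ ((Λ n / Real.log n : ℝ) : ℂ)) ≤ ((1 : ℝ) : EReal) := by
    refine abscissaOfAbsConv_le_of_forall_lt_LSeriesSummable fun y hy ↦ ?_
    refine Summable.of_norm_bounded (h.summable (s := y) (by simpa)).norm fun n ↦ norm_term_le _ ?_
    rw [Complex.norm_real, Complex.norm_real, Real.norm_of_nonneg (h.nonneg n),
      Real.norm_of_nonneg (div_nonneg (h.mangoldt_nonneg n) (Real.log_natCast_nonneg n))]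
    refine div_le_of_le_mul₀ (Real.log_natCast_nonneg n) (h.nonneg n) (h.mangoldt_le n)
  exact this.trans_lt (by exact_mod_cast hs)

theorem hasDerivAt_log (h : IsVonMangoldtPair a Λ κ θ) {s : ℂ} (hs : 1 < s.re) :
    HasDerivAt (LSeries fun n ↦ ((Λ n / Real.log n : ℝ) : ℂ))
      (-LSeries (fun n ↦ (Λ n : ℂ)) s) s := by
  convert LSeries_hasDerivAt (h.abscissa_log_lt hs) using 2
  refine LSeries_congr (fun {n} hn ↦ ?_) s
  rw [logMul, ← Complex.natCast_log, ← ofReal_mul]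
  congr 1
  rcases eq_or_ne n 1 with rfl | h1
  · simp [h.mangoldt_one]
  · have : Real.log n ≠ 0 :=
      Real.log_ne_zero_of_pos_of_ne_one (by positivity) (by exact_mod_cast h1)
    field_simp

theorem eq_exp (h : IsVonMangoldtPair a Λ κ θ) {s : ℂ} (hs : 1 < s.re) :
    LSeries (fun n ↦ (a n : ℂ)) s = exp (LSeries (fun n ↦ ((Λ n / Real.log n : ℝ) : ℂ)) s) := by
  set Z := LSeries fun n ↦ (a n : ℂ)
  set l := LSeries fun n ↦ ((Λ n / Real.log n : ℝ) : ℂ)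
  have hopen : IsOpen {s : ℂ | 1 < s.re} := isOpen_lt continuous_const continuous_re
  have hconv : Convex ℝ {s : ℂ | 1 < s.re} := convex_halfSpace_re_gt 1
  have hd : ∀ w ∈ {s : ℂ | 1 < s.re}, HasDerivAt (fun w ↦ Z w * exp (-l w)) 0 w := by
    intro w hw
    refine ((h.mangoldt_mul hw).mul ((h.hasDerivAt_log hw).neg.cexp)).congr_deriv ?_
    simp only [Pi.neg_apply]
    ring
  have hconst : ∀ x : ℝ, 1 < x → Z x * exp (-l x) = Z s * exp (-l s) := by
    intro x hx
    exact IsOpen.is_const_of_deriv_eq_zero hopen hconv.isPreconnected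
      (f := fun w ↦ Z w * exp (-l w))
      (fun w hw ↦ (hd w hw).differentiableAt.differentiableWithinAt)
      (fun w hw ↦ (hd w hw).deriv) (by simpa using hx) hs
  have t1 : Tendsto (fun x : ℝ ↦ Z x) atTop (𝓝 1) := by
    have := LSeries.tendsto_atTop (f := fun n ↦ (a n : ℂ))
      ((h.abscissa_lt (s := 2) (by norm_num)).trans (EReal.coe_lt_top _))
    simpa [h.one] using this
  have t2 : Tendsto (fun x : ℝ ↦ l x) atTop (𝓝 0) := by
    have := LSeries.tendsto_atTop (f := fun n ↦ ((Λ n / Real.log n : ℝ) : ℂ))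
      ((h.abscissa_log_lt (s := 2) (by norm_num)).trans (EReal.coe_lt_top _))
    simpa only [h.mangoldt_one, zero_div, ofReal_zero] using this
  have t3 : Tendsto (fun x : ℝ ↦ Z x * exp (-l x)) atTop (𝓝 (1 * exp (-0))) :=
    t1.mul ((continuous_exp.tendsto _).comp t2.neg)
  have t4 : Tendsto (fun x : ℝ ↦ Z x * exp (-l x)) atTop (𝓝 (Z s * exp (-l s))) :=
    tendsto_const_nhds.congr' (by
      filter_upwards [eventually_gt_atTop 1] with x hx using (hconst x hx).symm)
  have h5 := tendsto_nhds_unique t4 t3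
  rw [neg_zero, exp_zero, mul_one] at h5
  calc Z s = Z s * exp (-l s) * exp (l s) := by rw [mul_assoc, ← exp_add]; simp
    _ = exp (l s) := by rw [h5, one_mul]

theorem ne_zero (h : IsVonMangoldtPair a Λ κ θ) {s : ℂ} (hs : 1 < s.re) :
    LSeries (fun n ↦ (a n : ℂ)) s ≠ 0 := by
  rw [h.eq_exp hs]; exact exp_ne_zero _

/-- A Dirichlet series with nonnegative coefficients is bounded by its value on the real axis. -/
theorem _root_.norm_LSeries_le_of_nonneg {b : ℕ → ℝ} (hb : ∀ n, 0 ≤ b n) (s : ℂ)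
    (hs : LSeriesSummable (fun n ↦ (b n : ℂ)) s.re) :
    ‖LSeries (fun n ↦ (b n : ℂ)) s‖ ≤ (LSeries (fun n ↦ (b n : ℂ)) s.re).re ∧
      LSeries (fun n ↦ (b n : ℂ)) s.re = ((LSeries (fun n ↦ (b n : ℂ)) s.re).re : ℂ) := by
  have hterm : ∀ n, term (fun n ↦ (b n : ℂ)) s.re n = (‖term (fun n ↦ (b n : ℂ)) s n‖ : ℝ) := by
    intro n
    rw [norm_term_eq]
    rcases eq_or_ne n 0 with rfl | hn
    · simp
    · rw [term_of_ne_zero hn, if_neg hn, Complex.norm_real, Real.norm_of_nonneg (hb n)]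
      push_cast
      rw [ofReal_cpow (by positivity)]
      simp
  have hsum : Summable fun n ↦ ‖term (fun n ↦ (b n : ℂ)) s n‖ := by
    have := hs.norm
    refine this.congr fun n ↦ ?_
    rw [hterm n, Complex.norm_real, norm_norm]
  have hval : LSeries (fun n ↦ (b n : ℂ)) s.re =
      ((∑' n, ‖term (fun n ↦ (b n : ℂ)) s n‖ : ℝ) : ℂ) := by
    rw [LSeries, ofReal_tsum]
    exact tsum_congr hterm
  rw [hval, ofReal_re]
  exact ⟨norm_tsum_le_tsum_norm hsum, rfl⟩

theorem one_le_norm_mul (h : IsVonMangoldtPair a Λ κ θ) {s : ℂ} (hs : 1 < s.re) :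
    1 ≤ ‖LSeries (fun n ↦ (a n : ℂ)) s‖ * ‖LSeries (fun n ↦ (a n : ℂ)) s.re‖ := by
  have hnn : ∀ n, 0 ≤ Λ n / Real.log n := fun n ↦
    div_nonneg (h.mangoldt_nonneg n) (Real.log_natCast_nonneg n)
  obtain ⟨h1, h2⟩ := norm_LSeries_le_of_nonneg hnn s
    (LSeriesSummable_of_abscissaOfAbsConv_lt_re (h.abscissa_log_lt (s := s.re) (by simpa)))
  rw [h.eq_exp hs, h.eq_exp (s := s.re) (by simpa), norm_exp, norm_exp, ← Real.exp_add,
    Real.one_le_exp_iff]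
  have h3 := (abs_le.1 (abs_re_le_norm (LSeries (fun n ↦ ((Λ n / Real.log n : ℝ) : ℂ)) s))).1
  linarith

end IsVonMangoldtPair

end

section TailIntegral

open Filter Asymptotics MeasureTheory Complex Topology Set

variable {E : ℝ → ℝ} {C θ : ℝ}

theorem norm_mul_cpow_le_of_le_rpow (hb : ∀ t, 1 < t → |E t| ≤ C * t ^ θ) (s : ℂ) {t : ℝ}
    (ht : 1 < t) : ‖(E t : ℂ) * (t : ℂ) ^ (-(s + 1))‖ ≤ C * t ^ (-(s.re - θ) - 1) := by
  have h0 : 0 < t := zero_lt_one.trans ht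
  rw [norm_mul, Complex.norm_real, norm_cpow_eq_rpow_re_of_pos h0, Real.norm_eq_abs]
  calc |E t| * t ^ (-(s + 1)).re ≤ C * t ^ θ * t ^ (-(s + 1)).re := by
        gcongr; exact hb t ht
    _ = C * t ^ (-(s.re - θ) - 1) := by
        rw [mul_assoc, ← Real.rpow_add h0]
        congr 2
        simp
        ring

theorem integrableOn_const_mul_rpow {σ : ℝ} (C : ℝ) (hσ : 0 < σ) :
    IntegrableOn (fun t : ℝ ↦ C * t ^ (-σ - 1)) (Ioi 1) :=
  (integrableOn_Ioi_rpow_of_lt (by linarith) zero_lt_one).const_mul C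

theorem integrableOn_mul_cpow_of_le_rpow (hE : Measurable E)
    (hb : ∀ t, 1 < t → |E t| ≤ C * t ^ θ) {s : ℂ} (hs : θ < s.re) :
    IntegrableOn (fun t : ℝ ↦ (E t : ℂ) * (t : ℂ) ^ (-(s + 1))) (Ioi 1) := by
  refine Integrable.mono' (integrableOn_const_mul_rpow C (sub_pos.2 hs)) ?_ ?_
  · refine (Measurable.mul (by fun_prop) ?_).aestronglyMeasurable
    exact (Complex.measurable_ofReal).pow_const _
  · exact (ae_restrict_iff' measurableSet_Ioi).2 <| .of_forall fun t ht ↦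
      norm_mul_cpow_le_of_le_rpow hb s ht

theorem norm_integral_mul_cpow_le_of_le_rpow (hb : ∀ t, 1 < t → |E t| ≤ C * t ^ θ) {s : ℂ}
    (hs : θ < s.re) :
    ‖∫ t in Ioi (1 : ℝ), (E t : ℂ) * (t : ℂ) ^ (-(s + 1))‖ ≤ C / (s.re - θ) := by
  refine (norm_integral_le_of_norm_le (integrableOn_const_mul_rpow C (sub_pos.2 hs))
    ((ae_restrict_iff' measurableSet_Ioi).2 <| .of_forall fun t ht ↦
      norm_mul_cpow_le_of_le_rpow hb s ht)).trans_eq ?_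
  rw [integral_const_mul, integral_Ioi_rpow_of_lt (by linarith) zero_lt_one, Real.one_rpow]
  have : s.re - θ ≠ 0 := (sub_pos.2 hs).ne'
  rw [sub_add_cancel, neg_div_neg_eq]
  ring

theorem integral_mul_cpow_eq_mellin (s : ℂ) :
    ∫ t in Ioi (1 : ℝ), (E t : ℂ) * (t : ℂ) ^ (-(s + 1)) =
      mellin (fun t ↦ (((Ioi (1 : ℝ)).indicator E t : ℝ) : ℂ)) (-s) := by
  rw [mellin, ← integral_indicator measurableSet_Ioi, ← integral_indicator measurableSet_Ioi]
  congr 1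
  ext t
  by_cases ht : 1 < t
  · rw [indicator_of_mem (by exact ht), indicator_of_mem (show t ∈ Ioi 0 from zero_lt_one.trans ht),
      indicator_of_mem (by exact ht), smul_eq_mul, mul_comm, neg_add']
  · rw [indicator_of_notMem (by exact ht)]
    by_cases h0 : 0 < t
    · rw [indicator_of_mem (by exact h0), indicator_of_notMem (by exact ht)]
      simp
    · rw [indicator_of_notMem (by exact h0)]

theorem differentiableAt_integral_mul_cpow_of_le_rpow (hE : Measurable E)
    (hb : ∀ t, 1 < t → |E t| ≤ C * t ^ θ) {s : ℂ} (hs : θ < s.re) :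
    DifferentiableAt ℂ (fun s : ℂ ↦ ∫ t in Ioi (1 : ℝ), (E t : ℂ) * (t : ℂ) ^ (-(s + 1))) s := by
  simp_rw [integral_mul_cpow_eq_mellin]
  refine DifferentiableAt.fun_comp' (f := fun s : ℂ ↦ -s) s
    (mellin_differentiableAt_of_isBigO_rpow (a := -θ) (b := -s.re - 1) ?_ ?_ ?_ ?_ ?_)
    differentiableAt_id.neg
  · rw [locallyIntegrableOn_iff isOpen_Ioi.isLocallyClosed]
    intro k hk hk'
    obtain ⟨R, hR⟩ := hk'.isBounded.exists_norm_le
    refine Measure.integrableOn_of_bounded (M := |C| * ((1 + R) ^ |θ|)) hk'.measure_lt_top.ne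
      (Complex.measurable_ofReal.comp (hE.indicator measurableSet_Ioi)).aestronglyMeasurable
      ((ae_restrict_iff' hk'.measurableSet).2 <| .of_forall fun t ht ↦ ?_)
    have htR : t ≤ R := (le_abs_self t).trans (hR t ht)
    have hR0 : 0 ≤ R := (norm_nonneg _).trans (hR t ht)
    rw [Complex.norm_real]
    by_cases h1 : 1 < t
    · rw [indicator_of_mem (by exact h1), Real.norm_eq_abs]
      refine (hb t h1).trans ?_
      have : t ^ θ ≤ (1 + R) ^ |θ| :=
        (Real.rpow_le_rpow_of_exponent_le h1.le (le_abs_self θ)).trans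
          (Real.rpow_le_rpow (by linarith) (by linarith) (abs_nonneg _))
      calc C * t ^ θ ≤ |C| * t ^ θ := by gcongr; exact le_abs_self C
        _ ≤ _ := by gcongr
    · rw [indicator_of_notMem (by exact h1), norm_zero]
      positivity
  · refine IsBigO.of_bound C ?_
    filter_upwards [eventually_gt_atTop 1] with t ht
    rw [indicator_of_mem (by exact ht), Complex.norm_real, neg_neg,
      Real.norm_of_nonneg (Real.rpow_nonneg (by linarith) _)]
    exact hb t ht
  · simpa using hs
  · refine (IsBigO.of_bound 0 ?_)
    filter_upwards [Ioo_mem_nhdsGT zero_lt_one] with t ht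
    rw [indicator_of_notMem (by simpa using ht.2.le)]
    simp
  · simp

theorem integral_Ioi_one_cpow {s : ℂ} (hs : 1 < s.re) :
    IntegrableOn (fun t : ℝ ↦ (t : ℂ) * (t : ℂ) ^ (-(s + 1))) (Ioi 1) ∧
      ∫ t in Ioi (1 : ℝ), (t : ℂ) * (t : ℂ) ^ (-(s + 1)) = 1 / (s - 1) := by
  have he : EqOn (fun t : ℝ ↦ (t : ℂ) ^ (-s)) (fun t : ℝ ↦ (t : ℂ) * (t : ℂ) ^ (-(s + 1)))
      (Ioi 1) := by
    intro t ht
    have h0 : (t : ℂ) ≠ 0 := ofReal_ne_zero.2 (zero_lt_one.trans ht).ne'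
    simp only
    rw [neg_add', cpow_sub _ _ h0, cpow_one, mul_div_cancel₀ _ h0]
  have hre : (-s).re < -1 := by simpa using hs
  refine ⟨(integrableOn_Ioi_cpow_of_lt hre zero_lt_one).congr_fun he measurableSet_Ioi, ?_⟩
  rw [← setIntegral_congr_fun measurableSet_Ioi he, integral_Ioi_cpow_of_lt hre zero_lt_one,
    ofReal_one, one_cpow, ← neg_div_neg_eq]
  ring_nf

end TailIntegral

namespace IsVonMangoldtPair

open Filter Asymptotics MeasureTheory Complex LSeries Topology Set

variable {a Λ : ℕ → ℝ} {κ θ : ℝ}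

theorem exists_continuation (h : IsVonMangoldtPair a Λ κ θ) :
    ∃ (F : ℂ → ℂ) (B : ℝ), 1 ≤ B ∧ DifferentiableOn ℂ F {s | θ < s.re} ∧ F 1 = κ ∧
      (∀ s : ℂ, 1 < s.re → F s = (s - 1) * LSeries (fun n ↦ (a n : ℂ)) s) ∧
      ∀ s : ℂ, (1 + θ) / 2 ≤ s.re → s.re ≤ 3 → ‖F s‖ ≤ B * (|s.im| + 3) ^ 2 := by
  obtain ⟨C, hC0, hC⟩ := h.count
  have hκ := h.residue_pos
  have hθ := h.theta_lt
  set E : ℝ → ℝ := fun t ↦ ∑ k ∈ Finset.Icc 1 ⌊t⌋₊, a k - κ * t with hE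
  have hEm : Measurable E :=
    (((measurable_from_nat (f := fun n : ℕ ↦ ∑ k ∈ Finset.Icc 1 n, a k))).comp
      Nat.measurable_floor).sub (measurable_const.mul measurable_id)
  have hb : ∀ t, 1 < t → |E t| ≤ (C + κ) * t ^ θ := by
    intro t ht
    have h1 : (⌊t⌋₊ : ℝ) ≤ t := Nat.floor_le (by linarith)
    have h2 : t < ⌊t⌋₊ + 1 := Nat.lt_floor_add_one t
    have h3 : (⌊t⌋₊ : ℝ) ^ θ ≤ t ^ θ := Real.rpow_le_rpow (by positivity) h1 h.theta_nonneg
    have h4 : 1 ≤ t ^ θ := Real.one_le_rpow ht.le h.theta_nonneg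
    have h5 := abs_le.1 (hC ⌊t⌋₊)
    rw [abs_le]
    constructor <;> simp only [hE] <;> nlinarith
  set J : ℂ → ℂ := fun s ↦ ∫ t in Ioi (1 : ℝ), (E t : ℂ) * (t : ℂ) ^ (-(s + 1)) with hJ
  set η := (1 - θ) / 2 with hη
  have hη0 : 0 < η := by rw [hη]; linarith
  refine ⟨fun s ↦ κ * s + s * (s - 1) * J s, 1 + κ + (C + κ) / η, ?_, ?_, ?_, ?_, ?_⟩
  · have : 0 ≤ (C + κ) / η := by positivity
    linarith
  · intro s hs
    have hJd := differentiableAt_integral_mul_cpow_of_le_rpow hEm hb hs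
    exact (((differentiableAt_id.const_mul (κ : ℂ))).add
      ((differentiableAt_id.mul (differentiableAt_id.sub_const 1)).mul hJd)).differentiableWithinAt
  · simp
  · intro s hs
    have hs1 : s - 1 ≠ 0 := fun h0 ↦ by
      rw [sub_eq_zero.1 h0] at hs; simp at hs
    have key := LSeries_eq_mul_integral_of_nonneg a zero_le_one (s := s) hs h.isBigO_sum h.nonneg
    have hi := integral_Ioi_one_cpow hs
    have hJi := integrableOn_mul_cpow_of_le_rpow hEm hb (s := s) (hθ.trans hs)
    have : ∫ t in Ioi (1 : ℝ), (∑ k ∈ Finset.Icc 1 ⌊t⌋₊, (a k : ℂ)) * (t : ℂ) ^ (-(s + 1)) =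
        κ * (1 / (s - 1)) + J s := by
      rw [← hi.2, ← integral_const_mul, ← integral_add (hi.1.const_mul _) hJi]
      refine setIntegral_congr_fun measurableSet_Ioi fun t _ ↦ ?_
      simp only [hE]
      push_cast
      ring
    rw [key, this]
    field_simp
  · intro s hs1 hs3
    have h1 : η ≤ s.re - θ := by rw [hη]; linarith
    have hJb : ‖J s‖ ≤ (C + κ) / η :=
      (norm_integral_mul_cpow_le_of_le_rpow hb (by linarith)).trans (by gcongr)
    have hre : |s.re| ≤ 3 := abs_le.2 ⟨by linarith [h.theta_nonneg], hs3⟩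
    have hre' : |(s - 1).re| ≤ 3 := by
      rw [sub_re, one_re]
      exact abs_le.2 ⟨by linarith [h.theta_nonneg], by linarith⟩
    have hn1 : ‖s‖ ≤ |s.im| + 3 := by linarith [norm_le_abs_re_add_abs_im s]
    have hn2 : ‖s - 1‖ ≤ |s.im| + 3 := by
      have := norm_le_abs_re_add_abs_im (s - 1)
      rw [sub_im, one_im, sub_zero] at this
      linarith
    set L := |s.im| + 3
    have hL : 1 ≤ L := by have := abs_nonneg s.im; simp only [L]; linarith
    calc ‖κ * s + s * (s - 1) * J s‖ ≤ ‖(κ : ℂ)‖ * ‖s‖ + ‖s‖ * ‖s - 1‖ * ‖J s‖ := by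
          refine (norm_add_le _ _).trans ?_
          simp only [norm_mul, le_refl]
      _ ≤ κ * L + L * L * ((C + κ) / η) := by
          rw [Complex.norm_real, Real.norm_of_nonneg hκ.le]
          gcongr
      _ ≤ (1 + κ + (C + κ) / η) * L ^ 2 := by
          nlinarith [mul_nonneg hκ.le (mul_nonneg (by linarith : (0 : ℝ) ≤ L)
            (by linarith : (0 : ℝ) ≤ L - 1)), sq_nonneg L]

end IsVonMangoldtPair

section

open Filter Asymptotics MeasureTheory Complex LSeries Topology Set

/-- `F` continues `(s - 1) ∑ aₙ n⁻ˢ` to `θ < re s`, with polynomial growth. -/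
structure IsContinuation (a : ℕ → ℝ) (κ θ : ℝ) (F : ℂ → ℂ) (B : ℝ) : Prop where
  one_le : 1 ≤ B
  differentiableOn : DifferentiableOn ℂ F {s | θ < s.re}
  map_one : F 1 = κ
  eq_mul : ∀ s : ℂ, 1 < s.re → F s = (s - 1) * LSeries (fun n ↦ (a n : ℂ)) s
  norm_le : ∀ s : ℂ, (1 + θ) / 2 ≤ s.re → s.re ≤ 3 → ‖F s‖ ≤ B * (|s.im| + 3) ^ 2

namespace IsVonMangoldtPair

variable {a Λ : ℕ → ℝ} {κ θ : ℝ}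

theorem three_four_one (h : IsVonMangoldtPair a Λ κ θ) {σ : ℝ} (hσ : 1 < σ) (t : ℝ) :
    0 ≤ 3 * (LSeries (fun n ↦ (Λ n : ℂ)) σ).re +
      4 * (LSeries (fun n ↦ (Λ n : ℂ)) (σ + t * I)).re +
      (LSeries (fun n ↦ (Λ n : ℂ)) (σ + 2 * t * I)).re := by
  have s0 := h.summable_mangoldt (s := σ) (by simpa)
  have s1 := h.summable_mangoldt (s := σ + t * I) (by simpa)
  have s2 := h.summable_mangoldt (s := σ + 2 * t * I) (by simpa)
  have r0 := (hasSum_re s0.hasSum).summable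
  have r1 := (hasSum_re s1.hasSum).summable
  have r2 := (hasSum_re s2.hasSum).summable
  simp only [LSeries]
  rw [re_tsum s0, re_tsum s1, re_tsum s2, ← tsum_mul_left, ← tsum_mul_left,
    ← (r0.mul_left 3).tsum_add (r1.mul_left 4),
    ← ((r0.mul_left 3).add (r1.mul_left 4)).tsum_add r2]
  refine tsum_nonneg fun n ↦ ?_
  rcases eq_or_ne n 0 with rfl | hn
  · simp
  have hn0 : (n : ℂ) ≠ 0 := Nat.cast_ne_zero.2 hn
  set w : ℂ := (n : ℂ) ^ (-(t * I)) with hw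
  set q : ℝ := Λ n * (n : ℝ) ^ (-σ) with hq
  have hq0 : 0 ≤ q := mul_nonneg (h.mangoldt_nonneg n) (by positivity)
  have e0 : (q : ℂ) = term (fun n ↦ (Λ n : ℂ)) σ n := by
    rw [term_of_ne_zero hn, hq, div_eq_mul_inv, ← cpow_neg]
    push_cast
    rw [ofReal_cpow (by positivity)]
    push_cast
    rfl
  have e1 : term (fun n ↦ (Λ n : ℂ)) (σ + t * I) n = q * w := by
    rw [e0, term_of_ne_zero hn, term_of_ne_zero hn, hw, cpow_add _ _ hn0, cpow_neg]
    field_simp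
  have e2 : term (fun n ↦ (Λ n : ℂ)) (σ + 2 * t * I) n = q * (w * w) := by
    rw [e0, term_of_ne_zero hn, term_of_ne_zero hn, hw, cpow_add _ _ hn0, cpow_neg,
      mul_assoc, two_mul, cpow_add _ _ hn0]
    field_simp
  have hnorm : ‖w‖ = 1 := by
    rw [hw, norm_natCast_cpow_of_pos (Nat.pos_of_ne_zero hn)]
    simp
  have hsq : w.re * w.re + w.im * w.im = 1 := by
    rw [← normSq_apply, normSq_eq_norm_sq, hnorm, one_pow]
  rw [e1, e2, ← e0, re_ofReal_mul, re_ofReal_mul, ofReal_re, mul_re]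
  nlinarith [mul_nonneg hq0 (sq_nonneg (1 + w.re))]

end IsVonMangoldtPair

namespace IsContinuation

variable {a Λ : ℕ → ℝ} {κ θ : ℝ} {F : ℂ → ℂ} {B : ℝ}

theorem ne_zero_of_one_lt (hF : IsContinuation a κ θ F B) (h : IsVonMangoldtPair a Λ κ θ) {s : ℂ}
    (hs : 1 < s.re) : F s ≠ 0 := by
  rw [hF.eq_mul s hs]
  refine mul_ne_zero (fun h0 ↦ ?_) (h.ne_zero hs)
  rw [sub_eq_zero.1 h0] at hs
  simp at hs

theorem logDeriv_eq (hF : IsContinuation a κ θ F B) (h : IsVonMangoldtPair a Λ κ θ) {s : ℂ}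
    (hs : 1 < s.re) : logDeriv F s = 1 / (s - 1) - LSeries (fun n ↦ (Λ n : ℂ)) s := by
  have hopen : IsOpen {s : ℂ | 1 < s.re} := isOpen_lt continuous_const continuous_re
  have he : F =ᶠ[𝓝 s] fun s ↦ (s - 1) * LSeries (fun n ↦ (a n : ℂ)) s :=
    Filter.eventually_of_mem (hopen.mem_nhds hs) fun z hz ↦ hF.eq_mul z hz
  have hs1 : s - 1 ≠ 0 := fun h0 ↦ by
    rw [sub_eq_zero.1 h0] at hs; simp at hs
  have hz := h.ne_zero hs
  rw [logDeriv_apply, he.deriv_eq, he.eq_of_nhds]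
  have := (((hasDerivAt_id s).sub_const 1).mul (h.mangoldt_mul hs)).deriv
  simp only [Pi.mul_def, id] at this
  rw [this]
  field_simp
  ring

theorem norm_ge (hF : IsContinuation a κ θ F B) (h : IsVonMangoldtPair a Λ κ θ) {s : ℂ}
    (hs : 1 < s.re) (hs3 : s.re ≤ 3) : (s.re - 1) ^ 2 / (9 * B) ≤ ‖F s‖ := by
  have hB : 0 < B := zero_lt_one.trans_le hF.one_le
  have h1 := h.one_le_norm_mul hs
  have h2 : ‖F s.re‖ ≤ B * 9 := by
    have := hF.norm_le s.re (by simp only [ofReal_re]; linarith [h.theta_lt]) (by simpa)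
    simp at this
    linarith
  have e1 : ‖F s‖ = ‖s - 1‖ * ‖LSeries (fun n ↦ (a n : ℂ)) s‖ := by rw [hF.eq_mul s hs, norm_mul]
  have e2 : ‖F s.re‖ = (s.re - 1) * ‖LSeries (fun n ↦ (a n : ℂ)) s.re‖ := by
    rw [hF.eq_mul _ (by simpa), norm_mul]
    congr 1
    rw [← ofReal_one, ← ofReal_sub, Complex.norm_real, Real.norm_of_nonneg (by linarith)]
  have h3 : s.re - 1 ≤ ‖s - 1‖ := by
    have := re_le_norm (s - 1)
    simpa using this
  have h4 : 0 < s.re - 1 := by linarith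
  rw [div_le_iff₀ (by positivity), e1]
  rw [e2] at h2
  set x := ‖LSeries (fun n ↦ (a n : ℂ)) s‖
  set y := ‖LSeries (fun n ↦ (a n : ℂ)) s.re‖
  have hx : 0 ≤ x := norm_nonneg _
  calc (s.re - 1) ^ 2 ≤ (s.re - 1) ^ 2 * (x * y) := le_mul_of_one_le_right (by positivity) h1
    _ = (s.re - 1) * x * ((s.re - 1) * y) := by ring
    _ ≤ ‖s - 1‖ * x * (B * 9) := by gcongr
    _ = _ := by ring

theorem norm_le_exp_mul (hF : IsContinuation a κ θ F B) (h : IsVonMangoldtPair a Λ κ θ)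
    {r v L : ℝ} {s z : ℂ} (hr : 4 * r ≤ 1 - θ) (hv : 0 < v) (hvr : v ≤ 1) (hL : 1 ≤ L)
    (hs : s.re = 1 + v / L) (him : |s.im| + 4 ≤ Real.exp (2 * L))
    (hz : z ∈ Metric.closedBall s r) :
    ‖F z‖ ≤ Real.exp ((Real.log (9 * B ^ 2) + 6 + 2 * Real.log (1 / v)) * L) * ‖F s‖ := by
  have hB : 0 < B := zero_lt_one.trans_le hF.one_le
  have hθ := h.theta_nonneg
  have hθ' := h.theta_lt
  have hL0 : 0 < L := by linarith
  have hvL : 0 < v / L := by positivity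
  have hvL1 : v / L ≤ 1 := by rw [div_le_one hL0]; linarith
  have hz' : ‖z - s‖ ≤ r := by simpa [dist_eq_norm] using hz
  have hre := abs_le.1 ((abs_re_le_norm (z - s)).trans hz')
  have him' := abs_le.1 ((abs_im_le_norm (z - s)).trans hz')
  rw [sub_re] at hre
  rw [sub_im] at him'
  have him2 : |z.im| ≤ |s.im| + 1 := by
    rw [abs_le]
    constructor <;> linarith [neg_abs_le s.im, le_abs_self s.im]
  have h1 := hF.norm_le z (by linarith) (by linarith)
  have h2 := hF.norm_ge h (s := s) (by linarith) (by linarith)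
  have h3 : ‖F z‖ ≤ B * Real.exp (4 * L) := by
    refine h1.trans ?_
    gcongr
    calc (|z.im| + 3) ^ 2 ≤ (Real.exp (2 * L)) ^ 2 := by gcongr; linarith
      _ = Real.exp (4 * L) := by rw [← Real.exp_nat_mul]; congr 1; push_cast; ring
  have h4 : 0 ≤ Real.log (9 * B ^ 2) := Real.log_nonneg (by nlinarith [hF.one_le])
  have h5 : 0 ≤ Real.log (1 / v) := Real.log_nonneg (by rw [le_div_iff₀ hv]; linarith)
  have h6 : 9 * B ^ 2 * (L / v) ^ 2 * Real.exp (4 * L) ≤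
      Real.exp ((Real.log (9 * B ^ 2) + 6 + 2 * Real.log (1 / v)) * L) := by
    have e1 : 9 * B ^ 2 = Real.exp (Real.log (9 * B ^ 2)) := (Real.exp_log (by positivity)).symm
    have e2 : (L / v) ^ 2 = Real.exp (2 * Real.log L + 2 * Real.log (1 / v)) := by
      rw [← mul_add, ← Real.log_mul hL0.ne' (by positivity), mul_comm 2, Real.exp_mul,
        Real.exp_log (by positivity), mul_one_div, Real.rpow_two]
    rw [e2]
    nth_rw 1 [e1]
    rw [← Real.exp_add, ← Real.exp_add]
    gcongr
    have := Real.log_le_sub_one_of_pos hL0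
    nlinarith
  calc ‖F z‖ ≤ B * Real.exp (4 * L) := h3
    _ = (9 * B ^ 2 * (L / v) ^ 2 * Real.exp (4 * L)) * ((s.re - 1) ^ 2 / (9 * B)) := by
        rw [hs]
        field_simp
        ring
    _ ≤ _ := by gcongr

theorem exists_ball_ne_zero (hF : IsContinuation a κ θ F B) (h : IsVonMangoldtPair a Λ κ θ) :
    ∃ ε, 0 < ε ∧ ∀ s ∈ Metric.ball (1 : ℂ) ε, F s ≠ 0 := by
  have hopen : IsOpen {s : ℂ | θ < s.re} := isOpen_lt continuous_const continuous_re
  have hc : ContinuousAt F 1 := (hF.differentiableOn.differentiableAt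
    (hopen.mem_nhds (by simpa using h.theta_lt))).continuousAt
  have : F 1 ≠ 0 := by rw [hF.map_one]; exact_mod_cast h.residue_pos.ne'
  exact Metric.eventually_nhds_iff_ball.1 (hc.eventually_ne this)

end IsContinuation

end

section

open Filter Asymptotics MeasureTheory Complex LSeries Topology Set

theorem one_le_log_abs_add_three (t : ℝ) : 1 ≤ Real.log (|t| + 3) := by
  rw [Real.le_log_iff_exp_le (by positivity)]
  linarith [Real.exp_one_lt_three, abs_nonneg t]

theorem re_one_div_le {x t t₀ : ℝ} (hx1 : x ≤ 1) (ht₀ : 0 < t₀) (ht : t₀ ≤ |t|) :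
    (1 / (x + t * I : ℂ)).re ≤ 1 / t₀ ^ 2 := by
  have h1 : (x + t * I : ℂ).re = x := by simp
  have h2 : normSq (x + t * I : ℂ) = x ^ 2 + t ^ 2 := normSq_add_mul_I x t
  have h3 : t₀ ^ 2 ≤ t ^ 2 := by rw [← sq_abs t]; gcongr
  rw [one_div, inv_re, h1, h2]
  gcongr
  nlinarith [sq_nonneg x]

theorem exists_small_mul_log (A K₁ K₂ : ℝ) {δ : ℝ} (hδ : 0 < δ) :
    ∃ v, 0 < v ∧ v < δ ∧ v * (K₁ * (A + 2 * Real.log (1 / v)) + K₂) < 1 / 2 := by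
  have t1 : Tendsto (fun v : ℝ ↦ v * (K₁ * (A + 2 * Real.log (1 / v)) + K₂)) (𝓝[>] 0) (𝓝 0) := by
    have e0 : Tendsto (fun v : ℝ ↦ v * Real.log v) (𝓝[>] 0) (𝓝 0) := by
      simpa using (Real.continuous_mul_log.tendsto 0).mono_left nhdsWithin_le_nhds
    have e1 := e0.const_mul (-2 * K₁)
    have e2 : Tendsto (fun v : ℝ ↦ v * (K₁ * A + K₂)) (𝓝[>] 0) (𝓝 (0 * (K₁ * A + K₂))) :=
      (tendsto_id.mono_left nhdsWithin_le_nhds).mul_const _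
    have := e2.add e1
    simp only [zero_mul, mul_zero, add_zero] at this
    refine this.congr fun v ↦ ?_
    rw [one_div, Real.log_inv]
    ring
  obtain ⟨v, hv, hv'⟩ := ((t1.eventually_lt_const (by norm_num : (0 : ℝ) < 1 / 2)).and
    (Ioo_mem_nhdsGT hδ)).exists
  exact ⟨v, hv'.1, hv'.2, hv⟩

theorem false_of_zeroFree_bounds {L v r t₀ M : ℝ} (hL : 1 ≤ L) (hv0 : 0 < v) (hr0 : 0 < r)
    (ht₀ : 0 < t₀)
    (main : 7 / 11 * (L / v) ≤ 8 * (48 * (M * L) / r) + 5 * (1 / t₀ ^ 2) + 4 * (1 / r))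
    (hv : v * (384 / r * M + (5 / t₀ ^ 2 + 4 / r)) < 1 / 2) : False := by
  have hL0 : 0 < L := by linarith
  have hLv : 0 < L / v := by positivity
  have hv2 : L / v * (v * (384 / r * M + (5 / t₀ ^ 2 + 4 / r))) ≤ L / v * (1 / 2) := by gcongr
  have e3 : L / v * (v * (384 / r * M + (5 / t₀ ^ 2 + 4 / r))) =
      8 * (48 * (M * L) / r) + (5 * (1 / t₀ ^ 2) + 4 * (1 / r)) * L := by
    field_simp; ring
  have hpos : 0 ≤ 5 * (1 / t₀ ^ 2) + 4 * (1 / r) := by positivity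
  nlinarith

namespace IsContinuation

variable {a Λ : ℕ → ℝ} {κ θ : ℝ} {F : ℂ → ℂ} {B : ℝ}

theorem re_logDeriv_ge (hF : IsContinuation a κ θ F B) (h : IsVonMangoldtPair a Λ κ θ)
    {v L : ℝ} {s : ℂ} (hv : 0 < v) (hvr : v ≤ 1) (hL : 1 ≤ L)
    (hs : s.re = 1 + v / L) (him : |s.im| + 4 ≤ Real.exp (2 * L)) :
    -(48 * ((Real.log (9 * B ^ 2) + 6 + 2 * Real.log (1 / v)) * L) / ((1 - θ) / 4)) ≤
      (logDeriv F s).re ∧ ∀ ρ, ‖ρ - s‖ < (1 - θ) / 4 → F ρ = 0 →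
        (s - ρ).re * (1 / ‖ρ - s‖ ^ 2 - 1 / ((1 - θ) / 4) ^ 2) -
          48 * ((Real.log (9 * B ^ 2) + 6 + 2 * Real.log (1 / v)) * L) / ((1 - θ) / 4) ≤
            (logDeriv F s).re := by
  have hB := hF.one_le
  have hθ := h.theta_nonneg
  have hθ' := h.theta_lt
  have hvL : 0 < v / L := by positivity
  have h4 : 0 ≤ Real.log (9 * B ^ 2) := Real.log_nonneg (by nlinarith)
  have h5 : 0 ≤ Real.log (1 / v) := Real.log_nonneg (by rw [le_div_iff₀ hv]; linarith)
  have hre : ∀ z ∈ Metric.closedBall s ((1 - θ) / 4), θ < z.re := by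
    intro z hz
    have hz' : ‖z - s‖ ≤ (1 - θ) / 4 := by simpa [dist_eq_norm] using hz
    have := abs_le.1 ((abs_re_le_norm (z - s)).trans hz')
    rw [sub_re] at this
    linarith
  refine _root_.re_logDeriv_ge (by linarith) (by positivity)
    (hF.differentiableOn.mono hre) (fun z hz ↦
      hF.norm_le_exp_mul h (by linarith) hv hvr hL hs him hz)
    (hF.ne_zero_of_one_lt h (by linarith)) (fun z _ hz ↦ ?_)
  by_contra! hlt
  exact hF.ne_zero_of_one_lt h (by linarith) hz

theorem exists_zeroFree (hF : IsContinuation a κ θ F B) (h : IsVonMangoldtPair a Λ κ θ) :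
    ∃ c, 0 < c ∧ c ≤ (1 - θ) / 4 ∧
      ∀ s : ℂ, 1 - c / Real.log (|s.im| + 3) ≤ s.re → F s ≠ 0 := by
  obtain ⟨ε, hε, hball⟩ := hF.exists_ball_ne_zero h
  have hB := hF.one_le
  have hθ := h.theta_nonneg
  have hθ' := h.theta_lt
  set r := (1 - θ) / 4 with hr
  have hr0 : 0 < r := by rw [hr]; linarith
  have hr1 : r ≤ 1 / 4 := by rw [hr]; linarith
  set t₀ := ε / 2 with ht₀
  have ht₀' : 0 < t₀ := by positivity
  obtain ⟨v, hv0, hvr, hv⟩ := exists_small_mul_log (Real.log (9 * B ^ 2) + 6) (384 / r)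
    (5 / t₀ ^ 2 + 4 / r) (half_pos hr0)
  set M := Real.log (9 * B ^ 2) + 6 + 2 * Real.log (1 / v) with hM
  have hM0 : 0 ≤ M := by
    have h4 : 0 ≤ Real.log (9 * B ^ 2) := Real.log_nonneg (by nlinarith)
    have h5 : 0 ≤ Real.log (1 / v) := Real.log_nonneg (by rw [le_div_iff₀ hv0]; linarith)
    positivity
  refine ⟨min (v / 10) (ε / 4), by positivity, (min_le_left _ _).trans (by linarith), ?_⟩
  intro s hs h0
  have hs1 : s.re ≤ 1 := by
    by_contra! hlt
    exact hF.ne_zero_of_one_lt h hlt h0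
  set t := s.im with ht
  set L := Real.log (|t| + 3) with hLdef
  have hL : 1 ≤ L := one_le_log_abs_add_three t
  have hL0 : 0 < L := by linarith
  have hexp : Real.exp L = |t| + 3 := Real.exp_log (by positivity)
  have hexp2 : Real.exp (2 * L) = (|t| + 3) ^ 2 := by
    rw [two_mul, Real.exp_add, hexp]; ring
  by_cases hsmall : |t| < t₀
  · refine hball s ?_ h0
    have h1 : min (v / 10) (ε / 4) / L ≤ ε / 4 := by
      rw [div_le_iff₀ hL0]
      calc min (v / 10) (ε / 4) ≤ ε / 4 := min_le_right _ _
        _ ≤ ε / 4 * L := le_mul_of_one_le_right (by positivity) hL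
    have h2 : |s.re - 1| ≤ ε / 4 := abs_le.2 ⟨by linarith, by linarith⟩
    rw [Metric.mem_ball, dist_eq_norm]
    refine (norm_le_abs_re_add_abs_im _).trans_lt ?_
    rw [sub_re, sub_im, one_re, one_im, sub_zero, ← ht]
    linarith
  · push Not at hsmall
    set d := 1 + v / L - s.re with hd
    have hvL : 0 < v / L := by positivity
    have hvL1 : v / L ≤ v := div_le_self hv0.le hL
    have hd0 : 0 < d := by linarith
    have hd1 : d ≤ 11 / 10 * (v / L) := by
      have : min (v / 10) (ε / 4) / L ≤ v / 10 / L := by gcongr; exact min_le_left _ _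
      have e : v / 10 / L = v / L / 10 := by ring
      rw [hd]; linarith
    have hdr : d < r := by linarith
    have hσ : (1 : ℝ) < 1 + v / L := by linarith
    -- the three centres
    have hc0 : (((1 + v / L : ℝ) : ℂ)).re = 1 + v / L := by simp
    have hc1 : ((((1 + v / L : ℝ) : ℂ)) + t * I).re = 1 + v / L := by simp
    have hc2 : ((((1 + v / L : ℝ) : ℂ)) + 2 * t * I).re = 1 + v / L := by simp
    have hi1 : ((((1 + v / L : ℝ) : ℂ)) + t * I).im = t := by simp
    have hi2 : ((((1 + v / L : ℝ) : ℂ)) + 2 * t * I).im = 2 * t := by simp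
    have habs := abs_nonneg t
    have hq : 2 * |t| + 4 ≤ (|t| + 3) ^ 2 := by linarith only [habs, sq_nonneg (|t| + 2)]
    have g0 := (hF.re_logDeriv_ge h hv0 (by linarith) hL hc0
      (by rw [ofReal_im, abs_zero, hexp2]
          exact (by linarith : (0 : ℝ) + 4 ≤ 2 * |t| + 4).trans hq)).1
    have g1 := (hF.re_logDeriv_ge h hv0 (by linarith) hL hc1
      (by rw [hi1, hexp2]; exact (by linarith : |t| + 4 ≤ 2 * |t| + 4).trans hq)).2 s
    have g2 := (hF.re_logDeriv_ge h hv0 (by linarith) hL hc2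
      (by rw [hi2, hexp2, abs_mul, abs_two]; exact hq)).1
    have hsub : s - (((1 + v / L : ℝ) : ℂ) + t * I) = ((-d : ℝ) : ℂ) := by
      apply Complex.ext
      · rw [sub_re, hc1, ofReal_re]; ring
      · rw [sub_im, hi1, ofReal_im, ht, sub_self]
    have hsub' : (((1 + v / L : ℝ) : ℂ) + t * I) - s = (d : ℂ) := by
      rw [← neg_sub, hsub]; push_cast; ring
    rw [hsub, hsub', Complex.norm_real, norm_neg, Real.norm_of_nonneg hd0.le, ofReal_re] at g1
    replace g1 := g1 hdr h0
    have e0 := hF.logDeriv_eq h (s := ((1 + v / L : ℝ) : ℂ)) (by rw [hc0]; exact hσ)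
    have e1 := hF.logDeriv_eq h (s := ((1 + v / L : ℝ) : ℂ) + t * I) (by rw [hc1]; exact hσ)
    have e2 := hF.logDeriv_eq h (s := ((1 + v / L : ℝ) : ℂ) + 2 * t * I) (by rw [hc2]; exact hσ)
    rw [e0, sub_re] at g0
    rw [e1, sub_re] at g1
    rw [e2, sub_re] at g2
    have p0 : (1 / (((1 + v / L : ℝ) : ℂ) - 1)).re = L / v := by
      rw [← ofReal_one, ← ofReal_sub, ← ofReal_div, ofReal_re, add_sub_cancel_left, one_div_div]
    have p1 : (1 / (((1 + v / L : ℝ) : ℂ) + t * I - 1)).re ≤ 1 / t₀ ^ 2 := by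
      have := re_one_div_le (x := v / L) (by linarith) ht₀' hsmall
      convert this using 3
      push_cast; ring
    have p2 : (1 / (((1 + v / L : ℝ) : ℂ) + 2 * t * I - 1)).re ≤ 1 / t₀ ^ 2 := by
      have := re_one_div_le (x := v / L) (t := 2 * t) (by linarith) ht₀'
        (by rw [abs_mul, abs_two]; linarith)
      convert this using 3
      push_cast; ring
    rw [p0] at g0
    have h341 := h.three_four_one hσ t
    set W := 48 * (M * L) / r with hW
    have hd2 : d * (1 / d ^ 2 - 1 / r ^ 2) = 1 / d - d / r ^ 2 := by field_simp
    have hd3 : d / r ^ 2 ≤ 1 / r := by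
      rw [div_le_div_iff₀ (by positivity) hr0, one_mul, sq]
      exact mul_le_mul_of_nonneg_right hdr.le hr0.le
    have hd4 : 10 / 11 * (L / v) ≤ 1 / d := by
      rw [le_div_iff₀ hd0]
      calc 10 / 11 * (L / v) * d ≤ 10 / 11 * (L / v) * (11 / 10 * (v / L)) := by gcongr
        _ = 1 := by field_simp
    rw [hd2] at g1
    have main : 7 / 11 * (L / v) ≤ 8 * W + 5 * (1 / t₀ ^ 2) + 4 * (1 / r) := by
      linarith only [g0, g1, g2, p1, p2, h341, hd3, hd4]
    exact false_of_zeroFree_bounds hL hv0 hr0 ht₀' main hv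

end IsContinuation

end

section

open Filter Asymptotics MeasureTheory Complex LSeries Topology Set

namespace IsContinuation

variable {a Λ : ℕ → ℝ} {κ θ : ℝ} {F : ℂ → ℂ} {B : ℝ}

theorem exists_LSeries_mangoldt_le (hF : IsContinuation a κ θ F B)
    (h : IsVonMangoldtPair a Λ κ θ) :
    ∃ K, 0 ≤ K ∧ ∀ σ : ℝ, 1 < σ → σ ≤ 2 →
      (LSeries (fun n ↦ (Λ n : ℂ)) σ).re ≤ 1 / (σ - 1) + K := by
  have hopen : IsOpen {s : ℂ | θ < s.re} := isOpen_lt continuous_const continuous_re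
  have hsub : MapsTo (fun x : ℝ ↦ (x : ℂ)) (Icc 1 2) {s : ℂ | θ < s.re} := fun x hx ↦ by
    simpa using h.theta_lt.trans_le hx.1
  have h0 : ∀ x ∈ Icc (1 : ℝ) 2, F x ≠ 0 := by
    intro x hx
    rcases hx.1.eq_or_lt with rfl | h1
    · rw [ofReal_one, hF.map_one]; exact_mod_cast h.residue_pos.ne'
    · exact hF.ne_zero_of_one_lt h (by simpa)
  have hc : ContinuousOn (fun x : ℝ ↦ logDeriv F x) (Icc 1 2) := by
    refine ContinuousOn.div ?_ ?_ h0
    · exact (hF.differentiableOn.deriv hopen).continuousOn.comp continuous_ofReal.continuousOn hsub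
    · exact hF.differentiableOn.continuousOn.comp continuous_ofReal.continuousOn hsub
  obtain ⟨K, hK⟩ := isCompact_Icc.exists_bound_of_continuousOn hc
  refine ⟨K, (norm_nonneg _).trans (hK 1 (by norm_num)), fun σ h1 h2 ↦ ?_⟩
  have e := hF.logDeriv_eq h (s := σ) (by simpa)
  have hb := hK σ ⟨h1.le, h2⟩
  have hr := (abs_le.1 ((abs_re_le_norm _).trans hb)).1
  rw [e, sub_re, ← ofReal_one, ← ofReal_sub, ← ofReal_div, ofReal_re] at hr
  linarith

theorem exists_logDeriv_bound (hF : IsContinuation a κ θ F B) (h : IsVonMangoldtPair a Λ κ θ) :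
    ∃ c K, 0 < c ∧ c ≤ (1 - θ) / 4 ∧ 0 < K ∧
      ∀ s : ℂ, 1 - c / Real.log (|s.im| + 3) ≤ s.re → s.re ≤ 2 →
        F s ≠ 0 ∧ ‖logDeriv F s‖ ≤ K * Real.log (|s.im| + 3) ^ 2 := by
  obtain ⟨c, hc0, hc, hz⟩ := hF.exists_zeroFree h
  obtain ⟨K₁, hK₁, hb₁⟩ := hF.exists_LSeries_mangoldt_le h
  have hB := hF.one_le
  have hθ := h.theta_nonneg
  have hθ' := h.theta_lt
  have hc8 : 1 ≤ 1 / (c / 8) := by rw [le_div_iff₀ (by positivity)]; linarith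
  set M := Real.log (9 * B ^ 2) + 6 + 2 * Real.log (1 / (c / 8)) with hM
  have hM0 : 0 < M := by
    have h4 : 0 ≤ Real.log (9 * B ^ 2) := Real.log_nonneg (by nlinarith)
    have h5 : 0 ≤ Real.log (1 / (c / 8)) := Real.log_nonneg hc8
    positivity
  refine ⟨c / 8, 24 * M / (5 * c / 8) + (16 / c + K₁), by positivity, by linarith,
    by positivity, fun s hs hs2 ↦ ?_⟩
  set t := s.im with ht
  set L := Real.log (|t| + 3) with hLdef
  have hL : 1 ≤ L := one_le_log_abs_add_three t
  have hL0 : 0 < L := by linarith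
  have habs := abs_nonneg t
  have hexp : Real.exp L = |t| + 3 := Real.exp_log (by positivity)
  have hexp2 : Real.exp (2 * L) = (|t| + 3) ^ 2 := by
    rw [two_mul, Real.exp_add, hexp]; ring
  have hq : |t| + 4 ≤ (|t| + 3) ^ 2 := by nlinarith only [habs]
  have hcL : 0 < c / 8 / L := by positivity
  have hcL1 : c / 8 / L ≤ c / 8 := div_le_self (by positivity) hL
  have hsz : F s ≠ 0 := by
    refine hz s (le_trans ?_ hs)
    have : c / 8 / L ≤ c / L := by gcongr; linarith
    linarith
  refine ⟨hsz, ?_⟩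
  have hLL : L ≤ L ^ 2 := by nlinarith only [hL]
  rcases le_or_gt s.re (1 + c / 8 / L) with hle | hgt
  · set p : ℂ := ((1 + c / 8 / L : ℝ) : ℂ) + t * I with hp
    have hpre : p.re = 1 + c / 8 / L := by simp [hp]
    have hpim : p.im = t := by simp [hp]
    have hR : 0 < 5 * c / 8 / L := by positivity
    have hRe : 5 * c / 8 / L = 5 * (c / 8 / L) := by ring
    have hball : ∀ z ∈ Metric.ball p (5 * c / 8 / L),
        1 - c / Real.log (|z.im| + 3) ≤ z.re ∧ 1 - (1 - θ) / 4 ≤ z.re := by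
      intro z hz
      have hz' : ‖z - p‖ < 5 * (c / 8 / L) := by rw [← hRe]; simpa [dist_eq_norm] using hz
      have hre := abs_lt.1 ((abs_re_le_norm (z - p)).trans_lt hz')
      have him := abs_lt.1 ((abs_im_le_norm (z - p)).trans_lt hz')
      rw [sub_re, hpre] at hre
      rw [sub_im, hpim] at him
      have him2 : |z.im| ≤ |t| + 1 := by
        rw [abs_le]
        constructor <;> linarith [neg_abs_le t, le_abs_self t]
      have hlog : Real.log (|z.im| + 3) ≤ 2 * L := by
        rw [Real.log_le_iff_le_exp (by positivity), hexp2]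
        linarith
      have hlog1 := one_le_log_abs_add_three z.im
      have : c / (2 * L) ≤ c / Real.log (|z.im| + 3) := by gcongr
      have e : c / (2 * L) = 4 * (c / 8 / L) := by field_simp; norm_num
      constructor <;> linarith
    have hdist : dist s p ≤ 5 * c / 8 / L / 2 := by
      have : s - p = ((s.re - (1 + c / 8 / L) : ℝ) : ℂ) := by
        apply Complex.ext
        · rw [sub_re, hpre, ofReal_re]
        · rw [sub_im, hpim, ofReal_im, ht, sub_self]
      rw [dist_eq_norm, this, Complex.norm_real, Real.norm_eq_abs, abs_le]
      constructor <;> linarith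
    have hmain := norm_logDeriv_le_of_ne_zero (f := F) (M := M * L) hR (by positivity)
      (hF.differentiableOn.mono fun z hz ↦ show θ < z.re by linarith [(hball z hz).2])
      (fun z hz' ↦ hz z (hball z hz').1)
      (fun z hz' ↦ hF.norm_le_exp_mul h (r := (1 - θ) / 4) (v := c / 8) (by linarith)
        (by positivity) (by linarith) hL hpre (by rw [hpim, hexp2]; exact hq)
        (Metric.closedBall_subset_closedBall (by linarith) (Metric.ball_subset_closedBall hz')))
      hdist
    refine hmain.trans ?_
    have e : 24 * (M * L) / (5 * c / 8 / L) = 24 * M / (5 * c / 8) * L ^ 2 := by field_simp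
    rw [e, add_mul]
    have : 0 ≤ (16 / c + K₁) * L ^ 2 := by positivity
    linarith
  · have h1 : 1 < s.re := by linarith
    rw [hF.logDeriv_eq h h1]
    obtain ⟨n1, _⟩ := norm_LSeries_le_of_nonneg h.mangoldt_nonneg s
      (h.summable_mangoldt (by simpa))
    have n2 := hb₁ s.re h1 hs2
    have n3 : 1 / (s.re - 1) ≤ 8 / c * L := by
      rw [div_le_iff₀ (by linarith)]
      calc (1 : ℝ) = 8 / c * L * (c / 8 / L) := by field_simp
        _ ≤ 8 / c * L * (s.re - 1) := by gcongr; linarith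
    have n4 : ‖1 / (s - 1)‖ ≤ 1 / (s.re - 1) := by
      rw [norm_div, norm_one]
      have := re_le_norm (s - 1)
      rw [sub_re, one_re] at this
      have : 0 < s.re - 1 := by linarith
      gcongr
    have n5 : 0 ≤ 24 * M / (5 * c / 8) * L ^ 2 := by positivity
    calc ‖1 / (s - 1) - LSeries (fun n ↦ (Λ n : ℂ)) s‖ ≤ 8 / c * L + (8 / c * L + K₁) := by
          refine (norm_sub_le _ _).trans ?_
          linarith
      _ ≤ (16 / c + K₁) * L ^ 2 := by
          have : 16 / c * L ≤ 16 / c * L ^ 2 := by gcongr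
          have h2 : K₁ * 1 ≤ K₁ * L ^ 2 := by gcongr; linarith
          have e : 8 / c * L + 8 / c * L = 16 / c * L := by ring
          linarith
      _ ≤ _ := by rw [add_mul]; linarith

end IsContinuation

end

section PerronKernel

open Filter Asymptotics MeasureTheory Complex Topology Set

theorem one_add_sq_le_norm_mul {s : ℂ} (hs : 0 ≤ s.re) :
    s.re ^ 2 + s.im ^ 2 ≤ ‖s * (s + 1)‖ := by
  have h1 : ‖s‖ ^ 2 = s.re ^ 2 + s.im ^ 2 := by rw [← normSq_eq_norm_sq, normSq_apply]; ring
  have h2 : ‖s‖ ≤ ‖s + 1‖ := by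
    rw [← sq_le_sq₀ (norm_nonneg _) (norm_nonneg _), ← normSq_eq_norm_sq, ← normSq_eq_norm_sq,
      normSq_apply, normSq_apply, add_re, add_im, one_re, one_im]
    nlinarith
  rw [norm_mul, ← h1, sq]
  gcongr

theorem norm_one_div_mul_le {σ t : ℝ} (hσ : 1 ≤ σ) :
    ‖1 / (((σ : ℂ) + t * I) * ((σ : ℂ) + t * I + 1))‖ ≤ (1 + t ^ 2)⁻¹ := by
  have := one_add_sq_le_norm_mul (s := (σ : ℂ) + t * I) (by simp; linarith)
  simp only [add_re, ofReal_re, mul_re, I_re, mul_zero, ofReal_im, I_im, mul_one, sub_self,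
    add_zero, add_im, mul_im, zero_add] at this
  rw [norm_div, norm_one, one_div]
  gcongr
  nlinarith

theorem vertical_ne_zero {σ t b : ℝ} (h : σ ≠ b) : (σ : ℂ) + t * I - b ≠ 0 := by
  intro h0
  have := congrArg re h0
  simp at this
  exact h (by linarith)

theorem integrable_one_div_mul {σ : ℝ} (hσ : 1 ≤ σ) :
    Integrable fun t : ℝ ↦ 1 / (((σ : ℂ) + t * I) * ((σ : ℂ) + t * I + 1)) := by
  refine Integrable.mono' integrable_inv_one_add_sq (Continuous.aestronglyMeasurable ?_)
    (.of_forall fun t ↦ norm_one_div_mul_le hσ)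
  refine Continuous.div (by fun_prop) (by fun_prop) fun t ↦ mul_ne_zero ?_ ?_
  · simpa using vertical_ne_zero (t := t) (b := 0) (show σ ≠ 0 by linarith)
  · simpa using vertical_ne_zero (t := t) (b := -1) (show σ ≠ -1 by linarith)

theorem mellinInv_kernel {f : ℝ → ℂ} {G : ℂ → ℂ} {σ y : ℝ} (hy : 0 < y)
    (hf : ∀ t : ℝ, HasMellin f (σ + t * I) (G (σ + t * I)))
    (hG : Integrable fun t : ℝ ↦ G (σ + t * I)) (hc : ContinuousAt f (1 / y)) :
    ∫ t : ℝ, (y : ℂ) ^ ((σ : ℂ) + t * I) * G (σ + t * I) = 2 * Real.pi * f (1 / y) := by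
  have hm : ∀ t : ℝ, mellin f (σ + t * I) = G (σ + t * I) := fun t ↦ (hf t).2
  have hconv : MellinConvergent f σ := by simpa using (hf 0).1
  have key := mellinInv_mellin_eq σ f (one_div_pos.2 hy) hconv
    (by simpa only [VerticalIntegrable, hm] using hG) hc
  rw [← key, mellinInv]
  simp only [hm, smul_eq_mul]
  have hpi : (Real.pi : ℂ) ≠ 0 := ofReal_ne_zero.2 Real.pi_ne_zero
  have e : ∀ t : ℝ, ((1 / y : ℝ) : ℂ) ^ (-((σ : ℂ) + t * I)) = (y : ℂ) ^ ((σ : ℂ) + t * I) := by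
    intro t
    rw [one_div, ofReal_inv, inv_cpow _ _ (by
      rw [arg_ofReal_of_nonneg hy.le]; exact Real.pi_ne_zero.symm), cpow_neg, inv_inv]
  simp only [e, real_smul]
  push_cast
  rw [← mul_assoc, mul_one_div_cancel (mul_ne_zero two_ne_zero hpi), one_mul]

theorem continuousAt_indicator_Ioc {g : ℝ → ℂ} {x : ℝ} (hx : 0 < x) (hg : ContinuousOn g (Ioi 0))
    (h1 : g 1 = 0) : ContinuousAt ((Ioc (0 : ℝ) 1).indicator g) x := by
  have h : ∀ᶠ t in 𝓝 x, g (min t 1) = (Ioc (0 : ℝ) 1).indicator g t := by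
    filter_upwards [lt_mem_nhds hx] with t ht
    rcases le_or_gt t 1 with h | h
    · rw [min_eq_left h, indicator_of_mem (show t ∈ Ioc (0 : ℝ) 1 from ⟨ht, h⟩)]
    · rw [min_eq_right h.le, indicator_of_notMem (fun h' ↦ absurd h'.2 h.not_ge), h1]
  refine ContinuousAt.congr ?_ h
  exact ContinuousAt.comp' (g := g) (hg.continuousAt (Ioi_mem_nhds (by positivity)))
    (by fun_prop)

theorem integral_cpow_div_mul {σ y : ℝ} (hσ : 1 < σ) (hy : 0 < y) :
    ∫ t : ℝ, (y : ℂ) ^ ((σ : ℂ) + t * I) * (1 / (((σ : ℂ) + t * I) * ((σ : ℂ) + t * I + 1))) =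
      2 * Real.pi * (max (1 - 1 / y) 0 : ℝ) := by
  have hre : ∀ t : ℝ, ((σ : ℂ) + t * I).re = σ := fun t ↦ by simp
  set g : ℝ → ℂ := (Ioc (0 : ℝ) 1).indicator (fun t : ℝ ↦ (1 : ℂ) - t) with hg
  rw [mellinInv_kernel (f := g) (G := fun s ↦ 1 / (s * (s + 1))) hy ?_
    (integrable_one_div_mul hσ.le) ?_]
  · congr 1
    have h1 : 0 < 1 / y := by positivity
    rcases le_or_gt (1 / y) 1 with h | h
    · rw [hg, indicator_of_mem (show 1 / y ∈ Ioc (0 : ℝ) 1 from ⟨h1, h⟩),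
        max_eq_left (by linarith)]
      push_cast
      ring
    · rw [hg, indicator_of_notMem (fun h' ↦ absurd h'.2 h.not_ge), max_eq_right (by linarith)]
      simp
  · intro t
    have n0 : (σ : ℂ) + t * I ≠ 0 := by
      simpa using vertical_ne_zero (t := t) (b := 0) (show σ ≠ 0 by linarith)
    have n1 : (σ : ℂ) + t * I + 1 ≠ 0 := by
      simpa using vertical_ne_zero (t := t) (b := -1) (show σ ≠ -1 by linarith)
    have m1 := hasMellin_one_Ioc (s := σ + t * I) (by rw [hre]; linarith)
    have m2 := hasMellin_cpow_Ioc 1 (s := σ + t * I) (by rw [hre, one_re]; linarith)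
    have := hasMellin_sub m1.1 m2.1
    rw [m1.2, m2.2] at this
    have hgeq : g = fun t ↦ (Ioc (0 : ℝ) 1).indicator (fun _ ↦ (1 : ℂ)) t -
        (Ioc (0 : ℝ) 1).indicator (fun t : ℝ ↦ (t : ℂ) ^ (1 : ℂ)) t := by
      ext u
      by_cases hu : u ∈ Ioc (0 : ℝ) 1
      · simp only [hg, indicator_of_mem hu, cpow_one]
      · simp only [hg, indicator_of_notMem hu, sub_zero]
    rw [hgeq]
    refine ⟨this.1, this.2.trans ?_⟩
    · rw [div_sub_div _ _ n0 n1]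
      ring_nf
  · exact continuousAt_indicator_Ioc (by positivity) (by fun_prop) (by simp)

theorem integral_cpow_div_mul_mul {σ y : ℝ} (hσ : 1 < σ) (hy : 1 ≤ y) :
    (Integrable fun t : ℝ ↦ 1 / (((σ : ℂ) + t * I - 1) *
        (((σ : ℂ) + t * I) * ((σ : ℂ) + t * I + 1)))) ∧
    ∫ t : ℝ, (y : ℂ) ^ ((σ : ℂ) + t * I) *
      (1 / (((σ : ℂ) + t * I - 1) * (((σ : ℂ) + t * I) * ((σ : ℂ) + t * I + 1)))) =
      2 * Real.pi * ((1 - 1 / y) ^ 2 * y / 2 : ℝ) := by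
  have hy0 : 0 < y := by linarith
  have hre : ∀ t : ℝ, ((σ : ℂ) + t * I).re = σ := fun t ↦ by simp
  have n2 : ∀ t : ℝ, (σ : ℂ) + t * I - 1 ≠ 0 := fun t ↦ by
    simpa using vertical_ne_zero (t := t) (b := 1) (show σ ≠ 1 by linarith)
  have hinteg : Integrable fun t : ℝ ↦ 1 / (((σ : ℂ) + t * I - 1) *
      (((σ : ℂ) + t * I) * ((σ : ℂ) + t * I + 1))) := by
    have : Integrable fun t : ℝ ↦ (1 / ((σ : ℂ) + t * I - 1)) *
        (1 / (((σ : ℂ) + t * I) * ((σ : ℂ) + t * I + 1))) := by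
      refine (integrable_one_div_mul hσ.le).bdd_mul (c := 1 / (σ - 1))
        (Continuous.aestronglyMeasurable ?_) (.of_forall fun t ↦ ?_)
      · exact Continuous.div (by fun_prop) (by fun_prop) n2
      · rw [norm_div, norm_one]
        have := re_le_norm ((σ : ℂ) + t * I - 1)
        rw [sub_re, hre, one_re] at this
        have : 0 < σ - 1 := by linarith
        gcongr
    refine this.congr (.of_forall fun t ↦ ?_)
    simp only [one_div, mul_inv]
  refine ⟨hinteg, ?_⟩
  set g : ℝ → ℂ := (Ioc (0 : ℝ) 1).indicator (fun t : ℝ ↦ (1 / 2 : ℂ) * ((t : ℂ)⁻¹ - 2 + t)) with hg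
  rw [mellinInv_kernel (f := g) (G := fun s ↦ 1 / ((s - 1) * (s * (s + 1)))) hy0 ?_ hinteg ?_]
  · congr 1
    have h1 : 0 < 1 / y := by positivity
    have h : 1 / y ≤ 1 := by rw [div_le_one hy0]; exact hy
    rw [hg, indicator_of_mem (show 1 / y ∈ Ioc (0 : ℝ) 1 from ⟨h1, h⟩)]
    have : (y : ℂ) ≠ 0 := ofReal_ne_zero.2 hy0.ne'
    push_cast
    field_simp
    ring
  · intro t
    have n0 : (σ : ℂ) + t * I ≠ 0 := by
      simpa using vertical_ne_zero (t := t) (b := 0) (show σ ≠ 0 by linarith)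
    have n1 : (σ : ℂ) + t * I + 1 ≠ 0 := by
      simpa using vertical_ne_zero (t := t) (b := -1) (show σ ≠ -1 by linarith)
    have m0 := hasMellin_cpow_Ioc (-1) (s := σ + t * I)
      (by rw [hre, neg_re, one_re]; linarith)
    have m1 := hasMellin_one_Ioc (s := σ + t * I) (by rw [hre]; linarith)
    have m2 := hasMellin_cpow_Ioc 1 (s := σ + t * I) (by rw [hre, one_re]; linarith)
    have n2' : (σ : ℂ) + t * I + -1 ≠ 0 := by rw [← sub_eq_add_neg]; exact n2 t
    have h12 := hasMellin_sub m0.1 m1.1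
    have h12' := hasMellin_sub m2.1 m1.1
    have := hasMellin_add h12.1 h12'.1
    have := hasMellin_const_smul this.1 (1 / 2 : ℂ)
    rw [(hasMellin_add h12.1 h12'.1).2, h12.2, h12'.2] at this
    have hgeq : g = fun t ↦ (1 / 2 : ℂ) • ((Ioc (0 : ℝ) 1).indicator
        (fun t : ℝ ↦ (t : ℂ) ^ (-1 : ℂ)) t - (Ioc (0 : ℝ) 1).indicator (fun _ ↦ (1 : ℂ)) t +
        ((Ioc (0 : ℝ) 1).indicator (fun t : ℝ ↦ (t : ℂ) ^ (1 : ℂ)) t -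
          (Ioc (0 : ℝ) 1).indicator (fun _ ↦ (1 : ℂ)) t)) := by
      ext u
      by_cases hu : u ∈ Ioc (0 : ℝ) 1
      · simp only [hg, indicator_of_mem hu, cpow_one, cpow_neg_one, smul_eq_mul]
        ring
      · simp only [hg, indicator_of_notMem hu, sub_zero, add_zero, smul_zero]
    rw [hgeq]
    refine ⟨this.1, this.2.trans ?_⟩
    · have n2'' := n2 t
      rw [m0.2, m1.2, m2.2, ← sub_eq_add_neg, smul_eq_mul, div_sub_div _ _ n2'' n0,
        div_sub_div _ _ n1 n0,
        div_add_div _ _ (mul_ne_zero n2'' n0) (mul_ne_zero n1 n0), ← mul_div_assoc,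
        div_eq_div_iff (by positivity) (by positivity)]
      ring
  · refine continuousAt_indicator_Ioc (by positivity) ?_ (by norm_num)
    refine ContinuousOn.mul (by fun_prop) (ContinuousOn.add (ContinuousOn.sub ?_ (by fun_prop))
      (by fun_prop))
    exact ContinuousOn.inv₀ (by fun_prop) fun t ht ↦ ofReal_ne_zero.2 (ne_of_gt ht)

end PerronKernel

section ContourShift

open Filter Asymptotics MeasureTheory Complex Topology Set

theorem integrable_one_add_sq_rpow {q : ℝ} (hq : q < -1 / 2) :
    Integrable fun t : ℝ ↦ (1 + t ^ 2) ^ q := by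
  have := integrable_rpow_neg_one_add_norm_sq (E := ℝ) (μ := volume) (r := -2 * q)
    (by simp; linarith)
  refine this.congr (.of_forall fun t ↦ ?_)
  simp only [Real.norm_eq_abs, sq_abs]
  congr 1
  ring

theorem one_add_sq_rpow_le {T t : ℝ} (hT : 0 < T) (ht : T ≤ |t|) :
    (1 + t ^ 2) ^ (-3 / 4 : ℝ) ≤ T ^ (-1 / 4 : ℝ) * (1 + t ^ 2) ^ (-5 / 8 : ℝ) := by
  have h1 : T ^ 2 ≤ 1 + t ^ 2 := by rw [← sq_abs t]; nlinarith
  have h0 : 0 < 1 + t ^ 2 := by positivity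
  have e : (1 + t ^ 2) ^ (-3 / 4 : ℝ) =
      (1 + t ^ 2) ^ (-1 / 8 : ℝ) * (1 + t ^ 2) ^ (-5 / 8 : ℝ) := by
    rw [← Real.rpow_add h0]; norm_num
  have e2 : T ^ (-1 / 4 : ℝ) = (T ^ 2) ^ (-1 / 8 : ℝ) := by
    rw [← Real.rpow_natCast, ← Real.rpow_mul hT.le]; norm_num
  rw [e, e2]
  exact mul_le_mul_of_nonneg_right
    (Real.rpow_le_rpow_of_nonpos (by positivity) h1 (by norm_num)) (by positivity)

theorem norm_cpow_mul_le {x σ t K : ℝ} {Φ : ℂ → ℂ} (hx : 0 < x)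
    (hb : ‖Φ (σ + t * I)‖ ≤ K * (1 + t ^ 2) ^ (-3 / 4 : ℝ)) :
    ‖(x : ℂ) ^ ((σ : ℂ) + t * I) * Φ (σ + t * I)‖ ≤ x ^ σ * K * (1 + t ^ 2) ^ (-3 / 4 : ℝ) := by
  rw [norm_mul, norm_cpow_eq_rpow_re_of_pos hx, mul_assoc]
  have : ((σ : ℂ) + t * I).re = σ := by simp
  rw [this]
  gcongr

theorem exists_norm_integral_cpow_mul_le {Φ : ℂ → ℂ} {c K : ℝ} (hc : 0 < c) (hc1 : c ≤ 1 / 4)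
    (hd : ∀ s : ℂ, 1 - c / Real.log (|s.im| + 3) ≤ s.re → s.re ≤ 2 → DifferentiableAt ℂ Φ s)
    (hb : ∀ s : ℂ, 1 - c / Real.log (|s.im| + 3) ≤ s.re → s.re ≤ 2 →
      ‖Φ s‖ ≤ K * (1 + s.im ^ 2) ^ (-3 / 4 : ℝ)) :
    ∃ C, 0 ≤ C ∧ ∀ x : ℝ, Real.exp 4 ≤ x →
      ‖∫ t : ℝ, (x : ℂ) ^ (((1 + 1 / Real.log x : ℝ) : ℂ) + t * I) *
        Φ (((1 + 1 / Real.log x : ℝ) : ℂ) + t * I)‖ ≤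
          C * (x * Real.exp (-(c / 2) * √(Real.log x))) := by
  have hK : 0 ≤ K := by
    have h1 := (norm_nonneg _).trans (hb 1 (by simp; positivity) (by norm_num))
    simpa using h1
  set I₁ := ∫ t : ℝ, (1 + t ^ 2) ^ (-3 / 4 : ℝ) with hI₁
  set I₂ := ∫ t : ℝ, (1 + t ^ 2) ^ (-5 / 8 : ℝ) with hI₂
  have hi₁ : Integrable fun t : ℝ ↦ (1 + t ^ 2) ^ (-3 / 4 : ℝ) :=
    integrable_one_add_sq_rpow (by norm_num)
  have hi₂ : Integrable fun t : ℝ ↦ (1 + t ^ 2) ^ (-5 / 8 : ℝ) :=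
    integrable_one_add_sq_rpow (by norm_num)
  have hI₁0 : 0 ≤ I₁ := integral_nonneg fun t ↦ by positivity
  have hI₂0 : 0 ≤ I₂ := integral_nonneg fun t ↦ by positivity
  refine ⟨K * (I₁ + 2 * Real.exp 1 + Real.exp 1 * I₂), by positivity, fun x hx ↦ ?_⟩
  have hx0 : 0 < x := (Real.exp_pos 4).trans_le hx
  have hlog : 4 ≤ Real.log x := (Real.le_log_iff_exp_le hx0).2 hx
  set l := √(Real.log x) with hl
  have hl2 : l ^ 2 = Real.log x := Real.sq_sqrt (by linarith)
  have hl0 : 2 ≤ l := by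
    rw [hl, Real.le_sqrt (by norm_num) (by linarith)]; linarith
  set σ : ℝ := 1 + 1 / Real.log x with hσ
  set T := Real.exp l with hT
  have hT0 : 0 < T := Real.exp_pos _
  have hT3 : 3 ≤ T := by have := Real.add_one_le_exp l; linarith
  have hlT : Real.log (T + 3) ≤ 2 * l := by
    rw [Real.log_le_iff_le_exp (by positivity), two_mul, Real.exp_add]
    nlinarith only [hT3]
  have hlT0 : 1 ≤ Real.log (T + 3) := by
    have := one_le_log_abs_add_three T
    rwa [abs_of_pos hT0] at this
  set σ' : ℝ := 1 - c / Real.log (T + 3) with hσ'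
  have hcl : 0 < c / Real.log (T + 3) := by positivity
  have hcl1 : c / Real.log (T + 3) ≤ c := div_le_self hc.le hlT0
  have hil : 0 < 1 / Real.log x := by positivity
  have hil1 : 1 / Real.log x ≤ 1 / 4 := by gcongr
  have hxσ : x ^ σ = x * Real.exp 1 := by
    rw [hσ, Real.rpow_add hx0, Real.rpow_one, Real.rpow_def_of_pos hx0, mul_one_div_cancel]
    linarith
  have hxσ' : x ^ σ' ≤ x * Real.exp (-(c / 2) * l) := by
    have e : x * Real.exp (-(c / 2) * l) = Real.exp (l ^ 2 + -(c / 2) * l) := by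
      rw [Real.exp_add, hl2, Real.exp_log hx0]
    rw [e, Real.rpow_def_of_pos hx0, ← hl2, Real.exp_le_exp, hσ']
    have : c / (2 * l) ≤ c / Real.log (T + 3) := by gcongr
    have h2 : l ^ 2 * (c / (2 * l)) = c / 2 * l := by field_simp
    nlinarith [mul_le_mul_of_nonneg_left this (sq_nonneg l)]
  have hTle : T ^ (-1 / 4 : ℝ) ≤ Real.exp (-(c / 2) * l) := by
    rw [hT, ← Real.exp_mul, Real.exp_le_exp]
    nlinarith
  set H : ℂ → ℂ := fun s ↦ (x : ℂ) ^ s * Φ s with hH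
  have hreg : ∀ y t : ℝ, σ' ≤ y → y ≤ σ → |t| ≤ T →
      1 - c / Real.log (|((y : ℂ) + t * I).im| + 3) ≤ ((y : ℂ) + t * I).re ∧
        ((y : ℂ) + t * I).re ≤ 2 := by
    intro y t hy hy' ht
    have e1 : ((y : ℂ) + t * I).re = y := by simp
    have e2 : ((y : ℂ) + t * I).im = t := by simp
    rw [e1, e2]
    have h1 := one_le_log_abs_add_three t
    have : c / Real.log (T + 3) ≤ c / Real.log (|t| + 3) := by gcongr
    constructor <;> linarith
  have hregσ : ∀ t : ℝ, 1 - c / Real.log (|((σ : ℂ) + t * I).im| + 3) ≤ ((σ : ℂ) + t * I).re ∧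
        ((σ : ℂ) + t * I).re ≤ 2 := by
    intro t
    have e1 : ((σ : ℂ) + t * I).re = σ := by simp
    have e2 : ((σ : ℂ) + t * I).im = t := by simp
    rw [e1, e2]
    have h1 := one_le_log_abs_add_three t
    have : 0 < c / Real.log (|t| + 3) := by positivity
    constructor <;> linarith
  have him : ∀ y t : ℝ, ((y : ℂ) + t * I).im = t := fun y t ↦ by simp
  have hHσ : ∀ t : ℝ, ‖H (σ + t * I)‖ ≤ x ^ σ * K * (1 + t ^ 2) ^ (-3 / 4 : ℝ) := by
    intro t
    have := hb _ (hregσ t).1 (hregσ t).2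
    rw [him] at this
    exact norm_cpow_mul_le hx0 this
  have hHy : ∀ y t : ℝ, σ' ≤ y → y ≤ σ → |t| ≤ T →
      ‖H (y + t * I)‖ ≤ x ^ y * K * (1 + t ^ 2) ^ (-3 / 4 : ℝ) := by
    intro y t h1 h2 h3
    have := hb _ (hreg y t h1 h2 h3).1 (hreg y t h1 h2 h3).2
    rw [him] at this
    exact norm_cpow_mul_le hx0 this
  have hxne : (x : ℂ) ≠ 0 := ofReal_ne_zero.2 hx0.ne'
  have hHd : ∀ s : ℂ, DifferentiableAt ℂ Φ s → DifferentiableAt ℂ H s := fun s hs ↦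
    (differentiableAt_id.const_cpow (Or.inl hxne)).mul hs
  have hcont : Continuous fun t : ℝ ↦ H (σ + t * I) := by
    rw [continuous_iff_continuousAt]
    intro t
    exact ContinuousAt.comp' (g := H)
      (hHd _ (hd _ (hregσ t).1 (hregσ t).2)).continuousAt (by fun_prop)
  have hinteg : Integrable fun t : ℝ ↦ H (σ + t * I) :=
    Integrable.mono' (hi₁.const_mul (x ^ σ * K)) hcont.aestronglyMeasurable (.of_forall hHσ)
  -- the rectangle
  have hrect := integral_boundary_rect_eq_zero_of_differentiableOn H (⟨σ', -T⟩ : ℂ) ⟨σ, T⟩ (by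
    intro z hz
    rw [mem_reProdIm] at hz
    simp only at hz
    rw [uIcc_of_le (by linarith), uIcc_of_le (by linarith)] at hz
    have := hreg z.re z.im hz.1.1 hz.1.2 (abs_le.2 hz.2)
    rw [re_add_im] at this
    exact (hHd _ (hd _ this.1 this.2)).differentiableWithinAt)
  simp only at hrect
  have hhor : ∀ t : ℝ, |t| = T → ‖∫ y in σ'..σ, H (y + t * I)‖ ≤
      x * Real.exp 1 * K * Real.exp (-(c / 2) * l) := by
    intro t ht
    have h1 : ∀ y ∈ uIoc σ' σ, ‖H (y + t * I)‖ ≤ x * Real.exp 1 * K * Real.exp (-(c / 2) * l) := by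
      intro y hy
      rw [uIoc_of_le (by linarith)] at hy
      refine (hHy y t hy.1.le hy.2 ht.le).trans ?_
      have a1 : x ^ y ≤ x * Real.exp 1 := by
        rw [← hxσ]
        exact Real.rpow_le_rpow_of_exponent_le (by linarith [Real.add_one_le_exp 4]) hy.2
      have a2 : (1 + t ^ 2) ^ (-3 / 4 : ℝ) ≤ Real.exp (-(c / 2) * l) := by
        refine (one_add_sq_rpow_le hT0 ht.ge).trans ?_
        calc T ^ (-1 / 4 : ℝ) * (1 + t ^ 2) ^ (-5 / 8 : ℝ) ≤ Real.exp (-(c / 2) * l) * 1 := by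
              gcongr
              exact Real.rpow_le_one_of_one_le_of_nonpos (by nlinarith [sq_nonneg t]) (by norm_num)
          _ = _ := mul_one _
      gcongr
    refine (intervalIntegral.norm_integral_le_of_norm_le_const h1).trans ?_
    refine mul_le_of_le_one_right (by positivity) ?_
    rw [abs_le]
    constructor <;> linarith
  have hver : ‖∫ t in (-T)..T, H (σ' + t * I)‖ ≤ x * Real.exp (-(c / 2) * l) * K * I₁ := by
    rw [intervalIntegral.integral_of_le (by linarith)]
    calc ‖∫ t in Ioc (-T) T, H (σ' + t * I)‖
        ≤ ∫ t in Ioc (-T) T, x ^ σ' * K * (1 + t ^ 2) ^ (-3 / 4 : ℝ) := by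
          refine norm_integral_le_of_norm_le (hi₁.const_mul _).integrableOn
            ((ae_restrict_iff' measurableSet_Ioc).2 <| .of_forall fun t ht ↦
              hHy σ' t le_rfl (by linarith) (abs_le.2 ⟨ht.1.le, ht.2⟩))
      _ ≤ ∫ t, x ^ σ' * K * (1 + t ^ 2) ^ (-3 / 4 : ℝ) :=
          setIntegral_le_integral (hi₁.const_mul _) (.of_forall fun t ↦ by positivity)
      _ = x ^ σ' * K * I₁ := by rw [integral_const_mul]
      _ ≤ _ := by gcongr
  have htail : ‖∫ t in (Ioc (-T) T)ᶜ, H (σ + t * I)‖ ≤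
      x * Real.exp 1 * K * (Real.exp (-(c / 2) * l) * I₂) := by
    have hbd : ∀ t ∈ (Ioc (-T) T)ᶜ, ‖H (σ + t * I)‖ ≤
        x * Real.exp 1 * K * (Real.exp (-(c / 2) * l) * (1 + t ^ 2) ^ (-5 / 8 : ℝ)) := by
      intro t ht
      have hTt : T ≤ |t| := by
        by_contra! hlt
        have := abs_lt.1 hlt
        exact ht ⟨this.1, this.2.le⟩
      refine (hHσ t).trans ?_
      rw [hxσ]
      gcongr
      exact (one_add_sq_rpow_le hT0 hTt).trans (by gcongr)
    calc ‖∫ t in (Ioc (-T) T)ᶜ, H (σ + t * I)‖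
        ≤ ∫ t in (Ioc (-T) T)ᶜ,
            x * Real.exp 1 * K * (Real.exp (-(c / 2) * l) * (1 + t ^ 2) ^ (-5 / 8 : ℝ)) :=
          norm_integral_le_of_norm_le ((hi₂.const_mul _).const_mul _).integrableOn
            ((ae_restrict_iff' measurableSet_Ioc.compl).2 <| .of_forall hbd)
      _ ≤ ∫ t, x * Real.exp 1 * K * (Real.exp (-(c / 2) * l) * (1 + t ^ 2) ^ (-5 / 8 : ℝ)) :=
          setIntegral_le_integral ((hi₂.const_mul _).const_mul _)
            (.of_forall fun t ↦ by positivity)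
      _ = _ := by rw [integral_const_mul, integral_const_mul]
  have hsplit : ∫ t : ℝ, H (σ + t * I) = (∫ t in (-T)..T, H (σ + t * I)) +
      ∫ t in (Ioc (-T) T)ᶜ, H (σ + t * I) := by
    rw [intervalIntegral.integral_of_le (by linarith), integral_add_compl measurableSet_Ioc hinteg]
  have hmain : ‖∫ t in (-T)..T, H (σ + t * I)‖ ≤
      2 * (x * Real.exp 1 * K * Real.exp (-(c / 2) * l)) +
      x * Real.exp (-(c / 2) * l) * K * I₁ := by
    set P := ∫ t in (-T)..T, H (σ + t * I)
    set Q := ∫ t in (-T)..T, H (σ' + t * I)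
    have b1 := hhor (-T) (by rw [abs_neg, abs_of_pos hT0])
    have b2 := hhor T (abs_of_pos hT0)
    set U := ∫ y in σ'..σ, H (y + (-T : ℝ) * I)
    set V := ∫ y in σ'..σ, H (y + T * I)
    have e : I * P = V - U + I * Q := by
      simp only [smul_eq_mul] at hrect
      linear_combination hrect
    calc ‖P‖ = ‖I * P‖ := by rw [norm_mul, norm_I, one_mul]
      _ ≤ ‖V‖ + ‖U‖ + ‖I * Q‖ := by
          rw [e]
          exact (norm_add_le _ _).trans (by gcongr; exact norm_sub_le _ _)
      _ ≤ _ := by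
          rw [norm_mul, norm_I, one_mul]
          linarith
  calc ‖∫ t : ℝ, H (σ + t * I)‖ ≤ _ := by rw [hsplit]; exact norm_add_le _ _
    _ ≤ _ := add_le_add hmain htail
    _ = _ := by ring

end ContourShift

section

open Filter Asymptotics MeasureTheory Complex LSeries Topology Set

theorem integrable_cpow_mul {x σ : ℝ} {g : ℝ → ℂ} (hx : 0 < x) (hg : Integrable g) :
    Integrable fun t : ℝ ↦ (x : ℂ) ^ ((σ : ℂ) + t * I) * g t := by
  have hxne : (x : ℂ) ≠ 0 := ofReal_ne_zero.2 hx.ne'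
  refine hg.bdd_mul (c := x ^ σ) (Continuous.aestronglyMeasurable ?_) (.of_forall fun t ↦ ?_)
  · exact Continuous.const_cpow (by fun_prop) (Or.inl hxne)
  · rw [norm_cpow_eq_rpow_re_of_pos hx]
    simp

namespace IsVonMangoldtPair

variable {a Λ : ℕ → ℝ} {κ θ : ℝ}

theorem continuous_LSeries_mangoldt (h : IsVonMangoldtPair a Λ κ θ) {σ : ℝ} (hσ : 1 < σ) :
    Continuous fun t : ℝ ↦ LSeries (fun n ↦ (Λ n : ℂ)) (σ + t * I) := by
  have habs : abscissaOfAbsConv (fun n ↦ (Λ n : ℂ)) ≤ ((1 : ℝ) : EReal) :=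
    abscissaOfAbsConv_le_of_forall_lt_LSeriesSummable fun y hy ↦
      h.summable_mangoldt (s := y) (by simpa)
  rw [continuous_iff_continuousAt]
  intro t
  refine ContinuousAt.comp' (g := LSeries fun n ↦ (Λ n : ℂ)) ?_ (by fun_prop)
  refine (LSeries_hasDerivAt (habs.trans_lt ?_)).continuousAt
  have e1 : ((σ : ℂ) + t * I).re = σ := by simp
  rw [e1]
  exact_mod_cast hσ

theorem norm_LSeries_mangoldt_le (h : IsVonMangoldtPair a Λ κ θ) {σ : ℝ} (hσ : 1 < σ) (t : ℝ) :
    ‖LSeries (fun n ↦ (Λ n : ℂ)) (σ + t * I)‖ ≤ (LSeries (fun n ↦ (Λ n : ℂ)) σ).re := by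
  have e1 : ((σ : ℂ) + t * I).re = σ := by simp
  have := (norm_LSeries_le_of_nonneg h.mangoldt_nonneg (σ + t * I)
    (h.summable_mangoldt (by rw [e1]; simpa))).1
  rwa [e1] at this

theorem integrable_LSeries_mul (h : IsVonMangoldtPair a Λ κ θ) {σ : ℝ} (hσ : 1 < σ) :
    Integrable fun t : ℝ ↦ LSeries (fun n ↦ (Λ n : ℂ)) (σ + t * I) *
      (1 / (((σ : ℂ) + t * I) * ((σ : ℂ) + t * I + 1))) :=
  (integrable_one_div_mul hσ.le).bdd_mul (h.continuous_LSeries_mangoldt hσ).aestronglyMeasurable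
    (.of_forall fun t ↦ h.norm_LSeries_mangoldt_le hσ t)

theorem sum_mangoldt_mul_eq_integral (h : IsVonMangoldtPair a Λ κ θ) {σ x : ℝ} (hσ : 1 < σ)
    (hx : 1 ≤ x) :
    ((2 * Real.pi * ∑ n ∈ Finset.Icc 1 ⌊x⌋₊, Λ n * (1 - n / x) : ℝ) : ℂ) =
      ∫ t : ℝ, (x : ℂ) ^ ((σ : ℂ) + t * I) * (LSeries (fun n ↦ (Λ n : ℂ)) (σ + t * I) *
        (1 / (((σ : ℂ) + t * I) * ((σ : ℂ) + t * I + 1)))) := by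
  have hx0 : 0 < x := by linarith
  have hxne : (x : ℂ) ≠ 0 := ofReal_ne_zero.2 hx0.ne'
  set k : ℝ → ℂ := fun t ↦ 1 / (((σ : ℂ) + t * I) * ((σ : ℂ) + t * I + 1)) with hk
  have hkint : Integrable k := integrable_one_div_mul hσ.le
  set f : ℕ → ℝ → ℂ := fun n t ↦ Λ n * (((x / n : ℝ) : ℂ) ^ ((σ : ℂ) + t * I) * k t) with hf
  have hpow : ∀ n : ℕ, n ≠ 0 → ∀ s : ℂ, ((x / n : ℝ) : ℂ) ^ s = (x : ℂ) ^ s / (n : ℂ) ^ s := by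
    intro n hn s
    have := Complex.mul_cpow_ofReal_nonneg (div_nonneg hx0.le n.cast_nonneg)
      (n.cast_nonneg : (0 : ℝ) ≤ n) s
    have hn0 : (n : ℝ) ≠ 0 := Nat.cast_ne_zero.2 hn
    rw [← ofReal_mul, div_mul_cancel₀ _ hn0, ofReal_natCast] at this
    rw [this, mul_div_cancel_right₀ _ (by rw [Ne, cpow_eq_zero_iff]; simp [hn])]
  have hfterm : ∀ n t, f n t = term (fun n ↦ (Λ n : ℂ)) (σ + t * I) n *
      ((x : ℂ) ^ ((σ : ℂ) + t * I) * k t) := by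
    intro n t
    rcases eq_or_ne n 0 with rfl | hn
    · simp [hf, h.mangoldt_zero]
    · rw [hf, term_of_ne_zero hn]
      simp only
      rw [hpow n hn]
      ring
  have hfint : ∀ n, Integrable (f n) := by
    intro n
    rcases eq_or_ne n 0 with rfl | hn
    · simp [hf, h.mangoldt_zero]
    · exact (integrable_cpow_mul (by positivity) hkint).const_mul _
  have hnorm : ∀ n t, ‖f n t‖ = ‖term (fun n ↦ (Λ n : ℂ)) σ n‖ * x ^ σ * ‖k t‖ := by
    intro n t
    have e1 : ((σ : ℂ) + t * I).re = σ := by simp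
    rw [hfterm, norm_mul, norm_mul, norm_cpow_eq_rpow_re_of_pos hx0, e1, norm_term_eq,
      norm_term_eq, e1, ofReal_re, mul_assoc]
  have hsum : Summable fun n ↦ ∫ t, ‖f n t‖ := by
    simp_rw [hnorm, integral_const_mul]
    exact ((h.summable_mangoldt (s := σ) (by simpa)).norm.mul_right _).mul_right _
  have key := hasSum_integral_of_summable_integral_norm hfint hsum
  have hval : ∀ n, ∫ t, f n t = ((2 * Real.pi * (Λ n * max (1 - n / x) 0) : ℝ) : ℂ) := by
    intro n
    rcases eq_or_ne n 0 with rfl | hn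
    · simp [hf, h.mangoldt_zero]
    · simp only [hf]
      rw [integral_const_mul, integral_cpow_div_mul hσ (by positivity), one_div_div]
      push_cast
      ring
  have hfin : HasSum (fun n ↦ ∫ t, f n t)
      (∑ n ∈ Finset.Icc 1 ⌊x⌋₊, ∫ t, f n t) := by
    refine hasSum_sum_of_ne_finset_zero fun n hn ↦ ?_
    rw [hval]
    rcases eq_or_ne n 0 with rfl | hn0
    · simp [h.mangoldt_zero]
    · have : ⌊x⌋₊ < n := by
        by_contra! hle
        exact hn (Finset.mem_Icc.2 ⟨Nat.one_le_iff_ne_zero.2 hn0, hle⟩)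
      have hlt : x < n := (Nat.floor_lt hx0.le).1 this
      have : 1 - n / x ≤ 0 := by
        rw [sub_nonpos, le_div_iff₀ hx0]; linarith
      rw [max_eq_right this]
      simp
  have heq := hfin.unique key
  have hL : ∀ t, ∑' n, f n t = (x : ℂ) ^ ((σ : ℂ) + t * I) *
      (LSeries (fun n ↦ (Λ n : ℂ)) (σ + t * I) * k t) := by
    intro t
    simp_rw [hfterm]
    rw [tsum_mul_right, LSeries]
    ring
  simp_rw [hL] at heq
  rw [← heq, Finset.mul_sum, ofReal_sum]
  refine Finset.sum_congr rfl fun n hn ↦ ?_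
  rw [hval, max_eq_left]
  rw [sub_nonneg, div_le_one hx0]
  exact (Nat.le_floor_iff hx0.le).1 (Finset.mem_Icc.1 hn).2

theorem exists_abs_sum_mangoldt_mul_sub_le (h : IsVonMangoldtPair a Λ κ θ) :
    ∃ C c, 0 ≤ C ∧ 0 < c ∧ ∀ x : ℝ, Real.exp 4 ≤ x →
      |∑ n ∈ Finset.Icc 1 ⌊x⌋₊, Λ n * (x - n) - (x - 1) ^ 2 / 2| ≤
        C * (x ^ 2 * Real.exp (-c * √(Real.log x))) := by
  obtain ⟨F, B, hB, hF1, hF2, hF3, hF4⟩ := h.exists_continuation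
  have hF : IsContinuation a κ θ F B := ⟨hB, hF1, hF2, hF3, hF4⟩
  obtain ⟨c, K, hc, hcθ, hK, hbound⟩ := hF.exists_logDeriv_bound h
  have hθ := h.theta_nonneg
  have hopen : IsOpen {s : ℂ | θ < s.re} := isOpen_lt continuous_const continuous_re
  set Φ : ℂ → ℂ := fun s ↦ logDeriv F s * (1 / (s * (s + 1))) with hΦ
  have hre : ∀ s : ℂ, 1 - c / Real.log (|s.im| + 3) ≤ s.re → 3 / 4 ≤ s.re ∧ θ < s.re := by
    intro s hs
    have h1 : c / Real.log (|s.im| + 3) ≤ c := div_le_self hc.le (one_le_log_abs_add_three _)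
    constructor <;> linarith [h.theta_lt]
  obtain ⟨C, hC, hC'⟩ := exists_norm_integral_cpow_mul_le (Φ := Φ) (K := K * 576) hc
    (by linarith) (by
      intro s h1 h2
      have h3 := hre s h1
      have hs0 : s ≠ 0 := fun h0 ↦ by rw [h0, zero_re] at h3; linarith
      have hs1 : s + 1 ≠ 0 := fun h0 ↦ by
        rw [eq_neg_of_add_eq_zero_left h0, neg_re, one_re] at h3; linarith
      refine DifferentiableAt.mul ?_ ?_
      · exact ((hF1.deriv hopen).differentiableAt (hopen.mem_nhds h3.2)).div
          (hF1.differentiableAt (hopen.mem_nhds h3.2)) (hbound s h1 h2).1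
      · exact (differentiableAt_const _).div (by fun_prop) (mul_ne_zero hs0 hs1)) (by
      intro s h1 h2
      have h3 := (hre s h1).1
      have h4 := (hbound s h1 h2).2
      have h5 := one_add_sq_le_norm_mul (s := s) (by linarith)
      have h6 : (1 + s.im ^ 2) / 2 ≤ ‖s * (s + 1)‖ := by nlinarith
      have hy : 0 < 1 + s.im ^ 2 := by positivity
      have h7 : Real.log (|s.im| + 3) ^ 2 ≤ 16 * (18 * (1 + s.im ^ 2) ^ (1 / 4 : ℝ)) := by
        have hlog := Real.log_le_rpow_div (x := |s.im| + 3) (ε := 1 / 4) (by positivity)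
          (by norm_num)
        have hl0 := one_le_log_abs_add_three s.im
        calc Real.log (|s.im| + 3) ^ 2 ≤ ((|s.im| + 3) ^ (1 / 4 : ℝ) / (1 / 4)) ^ 2 := by gcongr
          _ = 16 * ((|s.im| + 3) ^ 2) ^ (1 / 4 : ℝ) := by
              rw [div_pow, ← Real.rpow_natCast (|s.im| + 3) 2,
                ← Real.rpow_natCast ((|s.im| + 3) ^ (1 / 4 : ℝ)) 2,
                ← Real.rpow_mul (by positivity), ← Real.rpow_mul (by positivity),
                mul_comm (1 / 4 : ℝ)]
              norm_num
              ring
          _ ≤ 16 * (18 * (1 + s.im ^ 2)) ^ (1 / 4 : ℝ) := by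
              gcongr
              rw [← sq_abs s.im]
              nlinarith [sq_nonneg (|s.im| - 3), sq_nonneg (|s.im|)]
          _ ≤ _ := by
              rw [Real.mul_rpow (by norm_num) hy.le]
              gcongr
              calc (18 : ℝ) ^ (1 / 4 : ℝ) ≤ 18 ^ (1 : ℝ) :=
                    Real.rpow_le_rpow_of_exponent_le (by norm_num) (by norm_num)
                _ = 18 := Real.rpow_one _
      have h8 : (1 + s.im ^ 2) ^ (-3 / 4 : ℝ) = (1 + s.im ^ 2) ^ (1 / 4 : ℝ) / (1 + s.im ^ 2) := by
        rw [← Real.rpow_sub_one hy.ne']; norm_num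
      rw [hΦ]
      simp only
      rw [norm_mul, norm_div, norm_one, h8]
      calc ‖logDeriv F s‖ * (1 / ‖s * (s + 1)‖) ≤
          K * (16 * (18 * (1 + s.im ^ 2) ^ (1 / 4 : ℝ))) * (1 / ((1 + s.im ^ 2) / 2)) := by
            gcongr
            exact h4.trans (by gcongr)
        _ = _ := by field_simp; norm_num)
  refine ⟨C, c / 2, hC, by positivity, fun x hx ↦ ?_⟩
  have hx0 : 0 < x := (Real.exp_pos 4).trans_le hx
  have hx1 : 1 ≤ x := by linarith [Real.add_one_le_exp 4]
  have hlog : 4 ≤ Real.log x := (Real.le_log_iff_exp_le hx0).2 hx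
  have hmain := hC' x hx
  set σ : ℝ := 1 + 1 / Real.log x with hσdef
  have hσ : 1 < σ := by
    have : 0 < 1 / Real.log x := by positivity
    linarith
  have hp := integral_cpow_div_mul_mul hσ hx1
  have hi1 := integrable_cpow_mul (σ := σ) hx0 hp.1
  have hi2 := integrable_cpow_mul (σ := σ) hx0 (h.integrable_LSeries_mul hσ)
  have hs := h.sum_mangoldt_mul_eq_integral hσ hx1
  have hre1 : ∀ t : ℝ, ((σ : ℂ) + t * I).re = σ := fun t ↦ by simp
  have heq : ∫ t : ℝ, (x : ℂ) ^ ((σ : ℂ) + t * I) * Φ (σ + t * I) =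
      ((2 * Real.pi * ((1 - 1 / x) ^ 2 * x / 2) -
        2 * Real.pi * ∑ n ∈ Finset.Icc 1 ⌊x⌋₊, Λ n * (1 - n / x) : ℝ) : ℂ) := by
    rw [ofReal_sub, hs, ofReal_mul, ofReal_mul, ofReal_ofNat, ← hp.2, ← integral_sub hi1 hi2]
    refine integral_congr_ae (.of_forall fun t ↦ ?_)
    simp only [hΦ]
    rw [hF.logDeriv_eq h (by rw [hre1]; exact hσ)]
    simp only [one_div, mul_inv]
    ring
  rw [heq, Complex.norm_real, ← mul_sub, norm_mul, Real.norm_of_nonneg (by positivity),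
    Real.norm_eq_abs] at hmain
  have hpi : 1 ≤ 2 * Real.pi := by linarith [Real.pi_gt_three]
  have e : ∑ n ∈ Finset.Icc 1 ⌊x⌋₊, Λ n * (x - n) - (x - 1) ^ 2 / 2 =
      -(x * ((1 - 1 / x) ^ 2 * x / 2 - ∑ n ∈ Finset.Icc 1 ⌊x⌋₊, Λ n * (1 - n / x))) := by
    rw [mul_sub, Finset.mul_sum, neg_sub]
    congr 1
    · refine Finset.sum_congr rfl fun n _ ↦ ?_
      field_simp
    · field_simp
  rw [e, abs_neg, abs_mul, abs_of_pos hx0]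
  set D := |(1 - 1 / x) ^ 2 * x / 2 - ∑ n ∈ Finset.Icc 1 ⌊x⌋₊, Λ n * (1 - n / x)|
  have hD : 0 ≤ D := abs_nonneg _
  have hD2 : D ≤ 2 * Real.pi * D := le_mul_of_one_le_left hD hpi
  calc x * D ≤ x * (C * (x * Real.exp (-(c / 2) * √(Real.log x)))) := by
        gcongr; exact hD2.trans hmain
    _ = _ := by ring

end IsVonMangoldtPair

end

/-- `E` is of size `O(x exp (-c √(log x)))` on `[2, ∞)` for some `c > 0`. -/
def IsVallePoussinSmall (E : ℝ → ℝ) : Prop :=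
  ∃ C c : ℝ, 0 ≤ C ∧ 0 < c ∧ ∀ x : ℝ, 2 ≤ x → |E x| ≤ C * (x * Real.exp (-c * √(Real.log x)))

namespace IsVallePoussinSmall

variable {E E' : ℝ → ℝ}

theorem mono (h : IsVallePoussinSmall E) (h' : ∀ x, 2 ≤ x → |E' x| ≤ |E x|) :
    IsVallePoussinSmall E' := by
  obtain ⟨C, c, hC, hc, h⟩ := h
  exact ⟨C, c, hC, hc, fun x hx ↦ (h' x hx).trans (h x hx)⟩

theorem congr (h : IsVallePoussinSmall E) (h' : ∀ x, 2 ≤ x → E' x = E x) :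
    IsVallePoussinSmall E' :=
  h.mono fun x hx ↦ by rw [h' x hx]

theorem add (h : IsVallePoussinSmall E) (h' : IsVallePoussinSmall E') :
    IsVallePoussinSmall fun x ↦ E x + E' x := by
  obtain ⟨C, c, hC, hc, h⟩ := h
  obtain ⟨C', c', hC', hc', h'⟩ := h'
  refine ⟨C + C', min c c', by positivity, lt_min hc hc', fun x hx ↦ ?_⟩
  rw [add_mul]
  refine (abs_add_le _ _).trans (add_le_add ((h x hx).trans ?_) ((h' x hx).trans ?_))
  · gcongr
    exact min_le_left _ _
  · gcongr
    exact min_le_right _ _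

theorem const_mul (h : IsVallePoussinSmall E) (k : ℝ) :
    IsVallePoussinSmall fun x ↦ k * E x := by
  obtain ⟨C, c, hC, hc, h⟩ := h
  refine ⟨|k| * C, c, by positivity, hc, fun x hx ↦ ?_⟩
  rw [abs_mul, mul_assoc]
  gcongr
  exact h x hx

theorem sub (h : IsVallePoussinSmall E) (h' : IsVallePoussinSmall E') :
    IsVallePoussinSmall fun x ↦ E x - E' x :=
  (h.add (h'.const_mul (-1))).congr fun x _ ↦ by ring

theorem zero : IsVallePoussinSmall fun _ ↦ 0 :=
  ⟨0, 1, le_rfl, one_pos, fun x _ ↦ by simp⟩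

theorem of_le_of_ge {C c x₀ M : ℝ} (hc : 0 < c)
    (h : ∀ x, x₀ ≤ x → 2 ≤ x → |E x| ≤ C * (x * Real.exp (-c * √(Real.log x))))
    (hM : ∀ x, 2 ≤ x → x ≤ x₀ → |E x| ≤ M) : IsVallePoussinSmall E := by
  refine ⟨|C| + |M| * Real.exp (c * √(Real.log x₀)), c, by positivity, hc, fun x hx ↦ ?_⟩
  have hx0 : 0 < x := by linarith
  rw [add_mul]
  rcases le_total x₀ x with hle | hle
  · refine (h x hle hx).trans (le_add_of_le_of_nonneg ?_ (by positivity))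
    gcongr
    exact le_abs_self C
  · refine (hM x hx hle).trans (le_add_of_nonneg_of_le (by positivity) ?_)
    have h1 : 1 ≤ Real.exp (c * √(Real.log x₀)) * Real.exp (-c * √(Real.log x)) := by
      rw [← Real.exp_add, Real.one_le_exp_iff]
      have : √(Real.log x) ≤ √(Real.log x₀) := Real.sqrt_le_sqrt (Real.log_le_log hx0 hle)
      nlinarith
    calc M ≤ |M| * 1 * 1 := by rw [mul_one, mul_one]; exact le_abs_self M
      _ ≤ |M| * (Real.exp (c * √(Real.log x₀)) * Real.exp (-c * √(Real.log x))) * x := by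
          gcongr; linarith
      _ = _ := by ring

theorem of_le_rpow {M : ℝ} (h : ∀ x, 2 ≤ x → |E x| ≤ M * x ^ (3 / 4 : ℝ)) :
    IsVallePoussinSmall E := by
  refine ⟨|M| * Real.exp 1, 1, by positivity, one_pos, fun x hx ↦ (h x hx).trans ?_⟩
  have hx0 : 0 < x := by linarith
  have hL : 0 ≤ Real.log x := Real.log_nonneg (by linarith)
  calc M * x ^ (3 / 4 : ℝ) ≤ |M| * x ^ (3 / 4 : ℝ) := by gcongr; exact le_abs_self M
    _ ≤ |M| * (Real.exp 1 * (x * Real.exp (-1 * √(Real.log x)))) := by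
        gcongr
        rw [Real.rpow_def_of_pos hx0]
        nth_rewrite 2 [← Real.exp_log hx0]
        rw [← Real.exp_add, ← Real.exp_add, Real.exp_le_exp]
        nlinarith [sq_nonneg (√(Real.log x) - 2), Real.sq_sqrt hL]
    _ = _ := by ring

theorem of_bounded {M : ℝ} (h : ∀ x, 2 ≤ x → |E x| ≤ M) : IsVallePoussinSmall E := by
  refine of_le_rpow (M := |M|) fun x hx ↦ (h x hx).trans ((le_abs_self M).trans ?_)
  exact le_mul_of_one_le_right (abs_nonneg _) (Real.one_le_rpow (by linarith) (by norm_num))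

end IsVallePoussinSmall

open Finset in
theorem sum_mul_sub_mono {Λ : ℕ → ℝ} (hΛ : ∀ n, 0 ≤ Λ n) {x h : ℝ} (hx : 0 ≤ x) (hh : 0 ≤ h) :
    (∑ n ∈ Icc 1 ⌊x⌋₊, Λ n) * h ≤
        ∑ n ∈ Icc 1 ⌊x + h⌋₊, Λ n * (x + h - n) - ∑ n ∈ Icc 1 ⌊x⌋₊, Λ n * (x - n) ∧
      ∑ n ∈ Icc 1 ⌊x + h⌋₊, Λ n * (x + h - n) - ∑ n ∈ Icc 1 ⌊x⌋₊, Λ n * (x - n) ≤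
        (∑ n ∈ Icc 1 ⌊x + h⌋₊, Λ n) * h := by
  have hsub : Icc 1 ⌊x⌋₊ ⊆ Icc 1 ⌊x + h⌋₊ := Icc_subset_Icc_right (Nat.floor_mono (by linarith))
  have hsd := sum_sdiff (f := fun n ↦ Λ n * (x + h - n)) hsub
  have hsd' := sum_sdiff (f := fun n ↦ Λ n) hsub
  have hb : ∀ n ∈ Icc 1 ⌊x + h⌋₊ \ Icc 1 ⌊x⌋₊, x ≤ n ∧ (n : ℝ) ≤ x + h := by
    intro n hn
    simp only [mem_sdiff, mem_Icc, not_and, not_le] at hn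
    exact ⟨((Nat.floor_lt hx).1 (hn.2 hn.1.1)).le, (Nat.le_floor_iff (by linarith)).1 hn.1.2⟩
  have e : ∑ n ∈ Icc 1 ⌊x⌋₊, Λ n * (x + h - n) =
      ∑ n ∈ Icc 1 ⌊x⌋₊, Λ n * (x - n) + (∑ n ∈ Icc 1 ⌊x⌋₊, Λ n) * h := by
    rw [sum_mul, ← sum_add_distrib]
    exact sum_congr rfl fun n _ ↦ by ring
  have h1 : 0 ≤ ∑ n ∈ Icc 1 ⌊x + h⌋₊ \ Icc 1 ⌊x⌋₊, Λ n * (x + h - n) :=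
    sum_nonneg fun n hn ↦ mul_nonneg (hΛ n) (by linarith [(hb n hn).2])
  have h2 : ∑ n ∈ Icc 1 ⌊x + h⌋₊ \ Icc 1 ⌊x⌋₊, Λ n * (x + h - n) ≤
      (∑ n ∈ Icc 1 ⌊x + h⌋₊ \ Icc 1 ⌊x⌋₊, Λ n) * h := by
    rw [sum_mul]
    exact sum_le_sum fun n hn ↦ mul_le_mul_of_nonneg_left (by linarith [(hb n hn).1]) (hΛ n)
  constructor
  · linarith
  · rw [← hsd', add_mul]
    linarith

theorem IsVonMangoldtPair.isVallePoussinSmall {a Λ : ℕ → ℝ} {κ θ : ℝ}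
    (h : IsVonMangoldtPair a Λ κ θ) :
    IsVallePoussinSmall fun x ↦ ∑ n ∈ Finset.Icc 1 ⌊x⌋₊, Λ n - x := by
  obtain ⟨C, c, hC, hc, hS⟩ := h.exists_abs_sum_mangoldt_mul_sub_le
  have hmono : Monotone fun x : ℝ ↦ ∑ n ∈ Finset.Icc 1 ⌊x⌋₊, Λ n := fun x y hxy ↦
    Finset.sum_le_sum_of_subset_of_nonneg (Finset.Icc_subset_Icc_right (Nat.floor_mono hxy))
      fun n _ _ ↦ h.mangoldt_nonneg n
  have h2e : (1 : ℝ) ≤ Real.exp 4 := Real.one_le_exp (by norm_num)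
  have hexp4 : 16 ≤ Real.exp 4 := by
    have h1 := Real.add_one_le_exp (1 : ℝ)
    have h2 : Real.exp 4 = Real.exp 1 ^ 4 := by rw [← Real.exp_nat_mul]; norm_num
    rw [h2]
    have : (2 : ℝ) ^ 4 ≤ Real.exp 1 ^ 4 := by gcongr; linarith
    linarith
  set S : ℝ → ℝ := fun x ↦ ∑ n ∈ Finset.Icc 1 ⌊x⌋₊, Λ n * (x - n) with hSdef
  set ψ : ℝ → ℝ := fun x ↦ ∑ n ∈ Finset.Icc 1 ⌊x⌋₊, Λ n with hψ
  set b : ℝ := min c 1 / 4 with hb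
  have hm : 0 < min c 1 := lt_min hc one_pos
  have hb0 : 0 < b := by positivity
  refine IsVallePoussinSmall.of_le_of_ge (C := 2 + 16 * C) (c := b) (x₀ := 2 * Real.exp 4)
    (M := ψ (2 * Real.exp 4) + 2 * Real.exp 4) hb0 ?_ ?_
  · intro x hx _
    have hx1 : 1 ≤ x := by linarith
    have hx0 : 0 < x := by linarith
    set s := √(Real.log x) with hs
    have hs0 : 0 ≤ s := Real.sqrt_nonneg _
    have hlog : 4 ≤ Real.log x := (Real.le_log_iff_exp_le hx0).2 (by linarith)
    have hs2 : s ^ 2 = Real.log x := Real.sq_sqrt (by linarith)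
    have hs1 : 2 ≤ s := by nlinarith
    set g := x * Real.exp (-b * s) with hg
    have hg0 : 0 < g := by positivity
    have hgx : g ≤ x := mul_le_of_le_one_right hx0.le
      (Real.exp_le_one_iff.2 (by nlinarith))
    have hg1 : 1 ≤ g := by
      rw [hg]
      nth_rewrite 1 [← Real.exp_log hx0]
      rw [← Real.exp_add, Real.one_le_exp_iff, ← hs2]
      have : b ≤ 1 := by
        have := min_le_right c 1
        rw [hb]; linarith
      nlinarith
    have hR : ∀ y, x / 2 ≤ y → y ≤ 2 * x → |S y - (y - 1) ^ 2 / 2| ≤ 4 * C * (g * g) := by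
      intro y hy1 hy2
      have hy0 : 0 < y := by linarith
      refine (hS y (by linarith)).trans ?_
      have hly : Real.log x / 4 ≤ Real.log y := by
        have : Real.log (x / 2) ≤ Real.log y := Real.log_le_log (by positivity) hy1
        rw [Real.log_div hx0.ne' (by norm_num)] at this
        linarith [Real.log_two_lt_d9]
      have hsy : s / 2 ≤ √(Real.log y) := by
        apply Real.le_sqrt_of_sq_le
        rw [div_pow, hs2]
        linarith
      have he : Real.exp (-c * √(Real.log y)) ≤ Real.exp (-b * s) * Real.exp (-b * s) := by
        rw [← Real.exp_add, Real.exp_le_exp]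
        have : min c 1 ≤ c := min_le_left _ _
        rw [hb]
        nlinarith
      calc C * (y ^ 2 * Real.exp (-c * √(Real.log y))) ≤
          C * ((2 * x) ^ 2 * (Real.exp (-b * s) * Real.exp (-b * s))) := by gcongr
        _ = _ := by
          rw [hg]; ring
    have hR0 := abs_le.1 (hR x (by linarith) (by linarith))
    have hRp := abs_le.1 (hR (x + g / 2) (by linarith) (by linarith))
    have hRm := abs_le.1 (hR (x - g / 2) (by linarith) (by linarith))
    have hup := (sum_mul_sub_mono h.mangoldt_nonneg hx0.le (h := g / 2) (by linarith)).1
    have hlo := (sum_mul_sub_mono h.mangoldt_nonneg (x := x - g / 2) (h := g / 2)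
      (by linarith) (by linarith)).2
    rw [sub_add_cancel] at hlo
    change ψ x * (g / 2) ≤ S (x + g / 2) - S x at hup
    change S x - S (x - g / 2) ≤ ψ x * (g / 2) at hlo
    rw [abs_le]
    constructor
    · have : (x - 1 - g / 4 - 16 * C * g) * (g / 2) ≤ ψ x * (g / 2) := by
        refine le_trans ?_ hlo
        nlinarith only [hR0.1, hRm.2]
      have := le_of_mul_le_mul_right this (by positivity)
      linarith only [this, hg1]
    · have : ψ x * (g / 2) ≤ (x + g / 4 + 16 * C * g) * (g / 2) := by
        refine hup.trans ?_
        nlinarith only [hR0.1, hRp.2, hg0]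
      have := le_of_mul_le_mul_right this (by positivity)
      linarith only [this, hg1]
  · intro x hx2 hx
    have h0 : 0 ≤ ψ x := Finset.sum_nonneg fun n _ ↦ h.mangoldt_nonneg n
    have h1 : ψ x ≤ ψ (2 * Real.exp 4) := hmono hx
    rw [abs_le]
    constructor <;> linarith

section LatticeSum

open MeasureTheory Module
open scoped Pointwise

variable {E : Type*} [NormedAddCommGroup E] [NormedSpace ℝ E] [FiniteDimensional ℝ E]
  [MeasurableSpace E] [BorelSpace E]

/-- Riemann sums of a compactly supported Lipschitz function along a lattice approximate its
integral with a power saving. -/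
theorem exists_abs_tsum_inv_smul_sub_le (μ : Measure E) [μ.IsAddHaarMeasure]
    (L : Submodule ℤ E) [Countable L] {P : Set E} (hP : IsAddFundamentalDomain L P μ)
    (hPb : Bornology.IsBounded P) {F : E → ℝ} {K : NNReal} (hF : LipschitzWith K F)
    {R : ℝ} (hR : ∀ y, R < ‖y‖ → F y = 0) :
    ∃ I C : ℝ, 0 ≤ C ∧ ∀ t : ℝ, 1 ≤ t → Summable (fun v : L ↦ F (t⁻¹ • (v : E))) ∧
      |∑' v : L, F (t⁻¹ • (v : E)) - I * t ^ finrank ℝ E| ≤ C * (t ^ finrank ℝ E / t) := by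
  have : VAddInvariantMeasure L E μ := inferInstanceAs (VAddInvariantMeasure L.toAddSubgroup E μ)
  obtain ⟨d₀, hd₀⟩ := hPb.exists_norm_le
  set d := |d₀| with hd
  have hdP : ∀ y ∈ P, ‖y‖ ≤ d := fun y hy ↦ (hd₀ y hy).trans (le_abs_self _)
  have hd0 : 0 ≤ d := abs_nonneg _
  set V := μ.real P with hV
  have hVfin : μ P ≠ ⊤ := hPb.measure_lt_top.ne
  have hV0 : 0 < V := ENNReal.toReal_pos
    (hP.measure_ne_zero (NeZero.ne μ)) hVfin
  set R' := |R| + d with hR'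
  have hR'0 : 0 ≤ R' := by positivity
  set n := finrank ℝ E with hn
  set B := μ.real (Metric.closedBall (0 : E) R') with hB
  have hsupp : ∀ t : ℝ, 1 ≤ t → HasCompactSupport fun y ↦ F (t⁻¹ • y) := by
    intro t ht
    have ht0 : 0 < t := by linarith
    refine HasCompactSupport.of_support_subset_isCompact (isCompact_closedBall (0 : E) (R * t)) ?_
    intro y hy
    rw [Function.mem_support] at hy
    rw [mem_closedBall_zero_iff]
    by_contra! hlt
    refine hy (hR _ ?_)
    rw [norm_smul, Real.norm_of_nonneg (by positivity), inv_mul_eq_div, lt_div_iff₀ ht0]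
    exact hlt
  have hinteg : ∀ t : ℝ, 1 ≤ t → Integrable (fun y ↦ F (t⁻¹ • y)) μ := fun t ht ↦
    (hF.continuous.comp (continuous_const_smul t⁻¹)).integrable_of_hasCompactSupport (hsupp t ht)
  have hsum : ∀ f : E → ℝ, Integrable f μ →
      HasSum (fun v : L ↦ ∫ y in v +ᵥ P, f y ∂μ) (∫ y, f y ∂μ) := by
    intro f hf
    have h1 := hP.sum_restrict
    have h2 := hasSum_integral_measure (μ := fun v : L ↦ μ.restrict (v +ᵥ P)) (f := f)
      (by rw [h1]; exact hf)
    rwa [h1] at h2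
  refine ⟨(∫ y, F y ∂μ) / V, K * d * B / V, by positivity, fun t ht ↦ ?_⟩
  have ht0 : 0 < t := by linarith
  have hscale : ∫ y, F (t⁻¹ • y) ∂μ = t ^ n * ∫ y, F y ∂μ := by
    rw [Measure.integral_comp_inv_smul_of_nonneg μ F ht0.le, smul_eq_mul]
  set S := Metric.closedBall (0 : E) (t * R') with hS
  have hSmeas : MeasurableSet S := Metric.isClosed_closedBall.measurableSet
  have hSfin : μ S ≠ ⊤ := Metric.isBounded_closedBall.measure_lt_top.ne
  have hSvol : μ.real S = t ^ n * B := by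
    rw [hS, hB, measureReal_def, Measure.addHaar_closedBall_mul μ 0 ht0.le hR'0,
      ENNReal.toReal_mul, ENNReal.toReal_ofReal (by positivity), measureReal_def]
  have hb := hsum (S.indicator fun _ ↦ K * d / t)
    ((integrable_indicator_iff hSmeas).2 (integrableOn_const hSfin))
  rw [integral_indicator hSmeas, setIntegral_const, smul_eq_mul, hSvol] at hb
  have hvol : ∀ v : L, μ (v +ᵥ P) = μ P := fun v ↦ measure_vadd μ v P
  have hle : ∀ v : L, ‖V * F (t⁻¹ • (v : E)) - ∫ y in v +ᵥ P, F (t⁻¹ • y) ∂μ‖ ≤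
      ∫ y in v +ᵥ P, S.indicator (fun _ ↦ K * d / t) y ∂μ := by
    intro v
    have hc : ∫ y in v +ᵥ P, F (t⁻¹ • (v : E)) ∂μ = V * F (t⁻¹ • (v : E)) := by
      rw [setIntegral_const, smul_eq_mul, measureReal_def, hvol, hV, measureReal_def]
    have hci : IntegrableOn (fun _ ↦ F (t⁻¹ • (v : E))) (v +ᵥ P) μ :=
      integrableOn_const (by rw [hvol]; exact hVfin)
    rw [← hc, ← integral_sub hci (hinteg t ht).integrableOn]
    refine norm_integral_le_of_norm_le
      ((integrable_indicator_iff hSmeas).2 (integrableOn_const hSfin)).integrableOn ?_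
    have hmeas : NullMeasurableSet (v +ᵥ P) μ := hP.nullMeasurableSet_vadd v
    rw [ae_restrict_iff'₀ hmeas]
    refine .of_forall fun y hy ↦ ?_
    obtain ⟨z, hz, rfl⟩ := Set.mem_vadd_set.1 hy
    have hvz : v +ᵥ z = (v : E) + z := rfl
    rw [hvz]
    have hzd := hdP z hz
    by_cases hyS : (v : E) + z ∈ S
    · rw [Set.indicator_of_mem hyS, ← dist_eq_norm]
      refine (hF.dist_le_mul _ _).trans ?_
      rw [dist_eq_norm, ← smul_sub, norm_smul, sub_add_cancel_left, norm_neg,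
        Real.norm_of_nonneg (by positivity), mul_div_assoc, inv_mul_eq_div]
      gcongr
    · rw [Set.indicator_of_notMem hyS]
      rw [hS, mem_closedBall_zero_iff, not_le] at hyS
      have h3 : t * |R| < ‖(v : E)‖ := by
        have := norm_add_le (v : E) z
        nlinarith
      have h4 : t * |R| < ‖(v : E) + z‖ := by
        nlinarith
      have h5 : ∀ y : E, t * |R| < ‖y‖ → F (t⁻¹ • y) = 0 := by
        intro y hy
        refine hR _ ?_
        rw [norm_smul, Real.norm_of_nonneg (by positivity), inv_mul_eq_div, lt_div_iff₀ ht0,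
          mul_comm]
        exact lt_of_le_of_lt (by gcongr; exact le_abs_self R) hy
      rw [h5 _ h3, h5 _ h4, sub_self, norm_zero]
  have hsd : Summable fun v : L ↦ V * F (t⁻¹ • (v : E)) - ∫ y in v +ᵥ P, F (t⁻¹ • y) ∂μ :=
    .of_norm_bounded hb.summable hle
  have hsf := hsum _ (hinteg t ht)
  have hsV : Summable fun v : L ↦ V * F (t⁻¹ • (v : E)) := by
    simpa using hsd.add hsf.summable
  have hs : Summable fun v : L ↦ F (t⁻¹ • (v : E)) := (summable_mul_left_iff hV0.ne').1 hsV
  refine ⟨hs, ?_⟩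
  have hkey := tsum_of_norm_bounded hb hle
  rw [hsV.tsum_sub hsf.summable, hsf.tsum_eq, hscale, tsum_mul_left, Real.norm_eq_abs] at hkey
  have e : ∑' v : L, F (t⁻¹ • (v : E)) - (∫ y, F y ∂μ) / V * t ^ n =
      (V * ∑' v : L, F (t⁻¹ • (v : E)) - t ^ n * ∫ y, F y ∂μ) / V := by field_simp
  rw [e, abs_div, abs_of_pos hV0, div_le_iff₀ hV0]
  refine hkey.trans (le_of_eq ?_)
  field_simp

end LatticeSum

section BoundedLipschitz

variable {E : Type*} [PseudoMetricSpace E]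

/-- A bounded Lipschitz real function. -/
def IsBoundedLipschitz (f : E → ℝ) : Prop :=
  ∃ C B : ℝ, 0 ≤ C ∧ 0 ≤ B ∧ (∀ x, |f x| ≤ B) ∧ ∀ x y, |f x - f y| ≤ C * dist x y

namespace IsBoundedLipschitz

variable {f g : E → ℝ}

theorem mul (hf : IsBoundedLipschitz f) (hg : IsBoundedLipschitz g) :
    IsBoundedLipschitz fun x ↦ f x * g x := by
  obtain ⟨C, B, hC, hB, h1, h2⟩ := hf
  obtain ⟨C', B', hC', hB', h1', h2'⟩ := hg
  refine ⟨C * B' + B * C', B * B', by positivity, by positivity, fun x ↦ ?_, fun x y ↦ ?_⟩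
  · rw [abs_mul]
    exact mul_le_mul (h1 x) (h1' x) (abs_nonneg _) hB
  · have e : f x * g x - f y * g y = (f x - f y) * g x + f y * (g x - g y) := by ring
    rw [e]
    refine (abs_add_le _ _).trans ?_
    rw [abs_mul, abs_mul]
    have := mul_le_mul (h2 x y) (h1' x) (abs_nonneg _) (by positivity)
    have := mul_le_mul (h1 y) (h2' x y) (abs_nonneg _) hB
    linarith

theorem prod {ι : Type*} {s : Finset ι} {f : ι → E → ℝ} (h : ∀ i ∈ s, IsBoundedLipschitz (f i)) :
    IsBoundedLipschitz fun x ↦ ∏ i ∈ s, f i x := by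
  classical
  induction s using Finset.induction_on with
  | empty => exact ⟨0, 1, le_rfl, zero_le_one, fun x ↦ by simp, fun x y ↦ by simp⟩
  | insert i s hi ih =>
    simp only [Finset.prod_insert hi]
    exact (h i (Finset.mem_insert_self _ _)).mul
      (ih fun j hj ↦ h j (Finset.mem_insert_of_mem hj))

theorem comp {F : Type*} [PseudoMetricSpace F] {φ : F → E} (hf : IsBoundedLipschitz f) {K : ℝ}
    (hK : 0 ≤ K) (hφ : ∀ x y, dist (φ x) (φ y) ≤ K * dist x y) :
    IsBoundedLipschitz fun x ↦ f (φ x) := by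
  obtain ⟨C, B, hC, hB, h1, h2⟩ := hf
  refine ⟨C * K, B, by positivity, hB, fun x ↦ h1 _, fun x y ↦ (h2 _ _).trans ?_⟩
  rw [mul_assoc]
  gcongr
  exact hφ x y

theorem lipschitzWith (hf : IsBoundedLipschitz f) : ∃ K, LipschitzWith K f := by
  obtain ⟨C, B, hC, hB, h1, h2⟩ := hf
  exact ⟨⟨C, hC⟩, LipschitzWith.of_dist_le_mul fun x y ↦ h2 x y⟩

end IsBoundedLipschitz

end BoundedLipschitz

/-- The hat function. -/
noncomputable def hat (s : ℝ) : ℝ := max 0 (1 - |s|)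

/-- The piecewise linear cut-off equal to `1` on `(-∞, 1]` and to `0` on `[2, ∞)`. -/
noncomputable def ramp (u : ℝ) : ℝ := max 0 (min 1 (2 - u))

theorem hat_eq_zero {s : ℝ} (h : 1 ≤ |s|) : hat s = 0 := max_eq_left (by linarith)

theorem abs_le_one_of_hat_ne_zero {s : ℝ} (h : hat s ≠ 0) : |s| ≤ 1 := by
  by_contra! h'
  exact h (hat_eq_zero h'.le)

theorem isBoundedLipschitz_hat : IsBoundedLipschitz hat := by
  refine ⟨1, 1, zero_le_one, zero_le_one, fun x ↦ ?_, fun x y ↦ ?_⟩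
  · rw [hat, abs_of_nonneg (le_max_left _ _)]
    exact max_le zero_le_one (by linarith [abs_nonneg x])
  · rw [hat, hat, one_mul, Real.dist_eq]
    refine (abs_max_sub_max_le_max _ _ _ _).trans (max_le (by simp) ?_)
    rw [sub_sub_sub_cancel_left, abs_sub_comm x y]
    exact abs_abs_sub_abs_le _ _

theorem sum_hat (c : ℝ) {N : ℤ} (hN : |c| + 1 ≤ N) :
    ∑ k ∈ Finset.Icc (-N) N, hat (c + k) = 1 := by
  have h1 := neg_abs_le c
  have h2 := le_abs_self c
  have hfl := Int.floor_le (-c)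
  have hfl2 := Int.lt_floor_add_one (-c)
  have hsub : ({⌊-c⌋, ⌊-c⌋ + 1} : Finset ℤ) ⊆ Finset.Icc (-N) N := by
    intro k hk
    rw [Finset.mem_insert, Finset.mem_singleton] at hk
    rw [Finset.mem_Icc]
    have h3 : (-N : ℝ) - 1 < ⌊-c⌋ := by linarith
    have h4 : (⌊-c⌋ : ℝ) + 1 ≤ N := by linarith
    have h3' : -N - 1 < ⌊-c⌋ := by exact_mod_cast h3
    have h4' : ⌊-c⌋ + 1 ≤ N := by exact_mod_cast h4
    omega
  rw [← Finset.sum_subset hsub, Finset.sum_pair (by omega)]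
  · rw [hat, hat, abs_of_nonpos (by linarith), abs_of_nonneg (by push_cast; linarith),
      max_eq_right (by linarith), max_eq_right (by push_cast; linarith)]
    push_cast
    ring
  · intro k _ hk
    rw [Finset.mem_insert, Finset.mem_singleton, not_or] at hk
    apply hat_eq_zero
    rcases lt_or_gt_of_ne hk.1 with h | h
    · have h5 : (k : ℝ) + 1 ≤ ⌊-c⌋ := by exact_mod_cast h
      rw [abs_of_nonpos (by linarith)]
      linarith
    · have h5 : ⌊-c⌋ + 1 < k := lt_of_le_of_ne h (Ne.symm hk.2)
      have h5 : (⌊-c⌋ : ℝ) + 1 + 1 ≤ k := by exact_mod_cast h5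
      rw [abs_of_nonneg (by linarith)]
      linarith

theorem ramp_eq_zero {u : ℝ} (h : 2 ≤ u) : ramp u = 0 := by
  rw [ramp, max_eq_left ((min_le_right _ _).trans (by linarith))]

theorem ramp_eq_one {u : ℝ} (h : u ≤ 1) : ramp u = 1 := by
  rw [ramp, min_eq_left (by linarith), max_eq_right zero_le_one]

theorem abs_le_one_of_ramp_sub_ne_zero {s : ℝ}
    (h : ramp (Real.exp s) - ramp (2 * Real.exp s) ≠ 0) : |s| ≤ 1 := by
  rw [abs_le]
  by_contra! h'
  by_cases hs : s < -1
  · refine h ?_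
    have h2 : Real.exp s * 2 ≤ 1 := by
      have h3 : Real.exp s ≤ Real.exp (-1) := Real.exp_le_exp.2 hs.le
      have h4 : Real.exp (-1) * Real.exp 1 = 1 := by rw [← Real.exp_add]; simp
      have h5 := Real.add_one_le_exp (1 : ℝ)
      nlinarith [Real.exp_pos (-1)]
    rw [ramp_eq_one (by linarith [Real.exp_pos s]), ramp_eq_one (by linarith), sub_self]
  · have hs1 := h' (not_lt.1 hs)
    have h3 := Real.add_one_le_exp s
    refine h ?_
    rw [ramp_eq_zero (by linarith), ramp_eq_zero (by linarith), sub_self]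

theorem isBoundedLipschitz_ramp_exp : IsBoundedLipschitz fun s ↦ ramp (Real.exp s) := by
  refine ⟨Real.exp 1, 1, by positivity, zero_le_one, fun x ↦ ?_, fun x y ↦ ?_⟩
  · change |ramp (Real.exp x)| ≤ 1
    rw [ramp, abs_of_nonneg (le_max_left _ _)]
    exact max_le zero_le_one (min_le_left _ _)
  · have key : ∀ s, ramp (Real.exp s) = ramp (Real.exp (min s 1)) := by
      intro s
      rcases le_total s 1 with h | h
      · rw [min_eq_left h]
      · have h2 := Real.add_one_le_exp (1 : ℝ)
        have h3 : Real.exp 1 ≤ Real.exp s := Real.exp_le_exp.2 h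
        rw [min_eq_right h, ramp_eq_zero (by linarith), ramp_eq_zero (by linarith)]
    have hexp : ∀ a b : ℝ, b ≤ a → a ≤ 1 → Real.exp a - Real.exp b ≤ Real.exp 1 * (a - b) := by
      intro a b hab ha
      have h1 := Real.add_one_le_exp (b - a)
      have h2 : Real.exp b = Real.exp a * Real.exp (b - a) := by rw [← Real.exp_add]; ring_nf
      have h3 : Real.exp a ≤ Real.exp 1 := Real.exp_le_exp.2 ha
      rw [h2]
      nlinarith [Real.exp_pos a]
    have hexp' : ∀ a b : ℝ, a ≤ 1 → b ≤ 1 →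
        |Real.exp a - Real.exp b| ≤ Real.exp 1 * |a - b| := by
      intro a b ha hb
      rcases le_total b a with h | h
      · rw [abs_of_nonneg (sub_nonneg.2 (Real.exp_le_exp.2 h)), abs_of_nonneg (sub_nonneg.2 h)]
        exact hexp a b h ha
      · rw [abs_sub_comm, abs_sub_comm a,
          abs_of_nonneg (sub_nonneg.2 (Real.exp_le_exp.2 h)), abs_of_nonneg (sub_nonneg.2 h)]
        exact hexp b a h hb
    simp only
    rw [key x, key y, Real.dist_eq]
    have h1 : |ramp (Real.exp (min x 1)) - ramp (Real.exp (min y 1))| ≤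
        |Real.exp (min x 1) - Real.exp (min y 1)| := by
      rw [ramp, ramp]
      refine (abs_max_sub_max_le_max _ _ _ _).trans (max_le (by simp) ?_)
      refine (abs_min_sub_min_le_max _ _ _ _).trans (max_le (by simp) ?_)
      rw [sub_sub_sub_cancel_left, abs_sub_comm]
    refine h1.trans ((hexp' _ _ (min_le_right _ _) (min_le_right _ _)).trans ?_)
    refine mul_le_mul_of_nonneg_left ?_ (Real.exp_pos 1).le
    refine (abs_min_sub_min_le_max x 1 y 1).trans (max_le le_rfl ?_)
    rw [sub_self, abs_zero]
    exact abs_nonneg _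

theorem isBoundedLipschitz_ramp_sub :
    IsBoundedLipschitz fun s ↦ ramp (Real.exp s) - ramp (2 * Real.exp s) := by
  have h2 : IsBoundedLipschitz fun s ↦ ramp (2 * Real.exp s) := by
    have := isBoundedLipschitz_ramp_exp.comp (φ := fun s ↦ Real.log 2 + s) (K := 1) zero_le_one
      (fun x y ↦ by rw [dist_add_left, one_mul])
    simpa only [Real.exp_add, Real.exp_log two_pos] using this
  obtain ⟨C, B, hC, hB, h1, h2⟩ := h2
  obtain ⟨C', B', hC', hB', h1', h2'⟩ := isBoundedLipschitz_ramp_exp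
  refine ⟨C' + C, B' + B, by positivity, by positivity, fun x ↦ ?_, fun x y ↦ ?_⟩
  · exact (abs_sub _ _).trans (add_le_add (h1' x) (h1 x))
  · rw [sub_sub_sub_comm, add_mul]
    exact (abs_sub _ _).trans (add_le_add (h2' x y) (h2 x y))

section TestFunction

open NumberField NumberField.InfinitePlace NumberField.mixedEmbedding Module
open NumberField.mixedEmbedding.fundamentalCone NumberField.Units
open NumberField.Units.dirichletUnitTheorem

open scoped Classical

variable (K : Type*) [Field K] [NumberField K]

/-- The product of hat functions of the coordinates along the unit lattice. -/
noncomputable def unitWeight (v : realSpace K) : ℝ :=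
  ∏ i : Fin (rank K), hat ((completeBasis K).repr v (equivFinRank i))

variable {K}

theorem sum_eq_repr_mul (v : realSpace K) :
    ∑ w, v w = (completeBasis K).repr v w₀ * finrank ℚ K := by
  have h0 : ∀ i, i ≠ w₀ → ∑ w, completeBasis K i w = 0 := by
    intro i hi
    rw [completeBasis_apply_of_ne K ⟨i, hi⟩, sum_expMap_symm_apply (coe_ne_zero _)]
    simp [Units.norm]
  have h1 : ∑ w, completeBasis K w₀ w = finrank ℚ K := by
    rw [completeBasis_apply_of_eq, ← Nat.cast_sum, sum_mult_eq]
  calc ∑ w, v w = ∑ w, (∑ i, (completeBasis K).repr v i • completeBasis K i) w := by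
        rw [(completeBasis K).sum_repr]
    _ = ∑ i, (completeBasis K).repr v i * ∑ w, completeBasis K i w := by
        simp_rw [Finset.sum_apply, Pi.smul_apply, smul_eq_mul, Finset.mul_sum]
        exact Finset.sum_comm
    _ = _ := by
        classical
        rw [Finset.sum_eq_single w₀ (fun i _ hi ↦ by rw [h0 i hi, mul_zero]) (by simp), h1]

theorem abs_apply_le_of_unitWeight_mul_ne_zero {v : realSpace K}
    (h : unitWeight K v * (ramp (Real.exp (∑ w, v w)) - ramp (2 * Real.exp (∑ w, v w))) ≠ 0)
    (w : InfinitePlace K) : |v w| ≤ ∑ i, ∑ w, |completeBasis K i w| := by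
  have h1 := left_ne_zero_of_mul h
  have h2 := abs_le_one_of_ramp_sub_ne_zero (right_ne_zero_of_mul h)
  rw [unitWeight, Finset.prod_ne_zero_iff] at h1
  have hr : ∀ i, |(completeBasis K).repr v i| ≤ 1 := by
    intro i
    by_cases hi : i = w₀
    · rw [sum_eq_repr_mul, abs_mul, Nat.abs_cast] at h2
      have : (1 : ℝ) ≤ finrank ℚ K := by exact_mod_cast finrank_pos
      rw [hi]
      nlinarith [abs_nonneg ((completeBasis K).repr v w₀)]
    · have := abs_le_one_of_hat_ne_zero (h1 (equivFinRank.symm ⟨i, hi⟩) (Finset.mem_univ _))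
      rwa [Equiv.apply_symm_apply] at this
  calc |v w| = |(∑ i, (completeBasis K).repr v i • completeBasis K i) w| := by
        rw [(completeBasis K).sum_repr]
    _ = |∑ i, (completeBasis K).repr v i * completeBasis K i w| := by
        simp_rw [Finset.sum_apply, Pi.smul_apply, smul_eq_mul]
    _ ≤ ∑ i, |(completeBasis K).repr v i * completeBasis K i w| :=
        Finset.abs_sum_le_sum_abs _ _
    _ ≤ ∑ i, |completeBasis K i w| := by
        refine Finset.sum_le_sum fun i _ ↦ ?_
        rw [abs_mul]
        exact mul_le_of_le_one_left (abs_nonneg _) (hr i)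
    _ ≤ _ := Finset.sum_le_sum fun i _ ↦
        Finset.single_le_sum (f := fun w ↦ |completeBasis K i w|) (fun _ _ ↦ abs_nonneg _)
          (Finset.mem_univ w)

theorem isBoundedLipschitz_unitWeight_mul : IsBoundedLipschitz fun v : realSpace K ↦
    unitWeight K v * (ramp (Real.exp (∑ w, v w)) - ramp (2 * Real.exp (∑ w, v w))) := by
  have hlin : ∀ φ : realSpace K →ₗ[ℝ] ℝ, ∃ C : ℝ, 0 ≤ C ∧
      ∀ x y, dist (φ x) (φ y) ≤ C * dist x y := by
    intro φ
    refine ⟨‖LinearMap.toContinuousLinearMap φ‖, norm_nonneg _, fun x y ↦ ?_⟩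
    exact (LinearMap.toContinuousLinearMap φ).lipschitz.dist_le_mul x y
  refine IsBoundedLipschitz.mul (IsBoundedLipschitz.prod fun i _ ↦ ?_) ?_
  · obtain ⟨C, hC, h⟩ := hlin ((completeBasis K).coord (equivFinRank i))
    exact isBoundedLipschitz_hat.comp hC h
  · obtain ⟨C, hC, h⟩ := hlin (∑ w, LinearMap.proj w)
    refine isBoundedLipschitz_ramp_sub.comp (φ := fun v : realSpace K ↦ ∑ w, v w) hC fun x y ↦ ?_
    simpa using h x y

theorem dist_normAtPlace_le (w : InfinitePlace K) (x y : mixedSpace K) :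
    dist (normAtPlace w x) (normAtPlace w y) ≤ dist x y := by
  have hle : ∀ z : mixedSpace K, normAtPlace w z ≤ ‖z‖ := fun z ↦ by
    rw [norm_eq_sup'_normAtPlace]
    exact Finset.le_sup' (fun w ↦ normAtPlace w z) (Finset.mem_univ w)
  have h1 : ∀ x y : mixedSpace K, normAtPlace w x - normAtPlace w y ≤ ‖x - y‖ := fun x y ↦ by
    have := normAtPlace_add_le w (x - y) y
    rw [sub_add_cancel] at this
    linarith [hle (x - y)]
  rw [Real.dist_eq, dist_eq_norm, abs_le]
  refine ⟨?_, h1 x y⟩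
  have := h1 y x
  rw [norm_sub_rev] at this
  linarith

theorem dist_log_max_le {m : ℝ} (hm : 0 < m) (x y : ℝ) :
    dist (Real.log (max m x)) (Real.log (max m y)) ≤ m⁻¹ * dist x y := by
  have key : ∀ a b : ℝ, m ≤ a → a ≤ b → Real.log b - Real.log a ≤ m⁻¹ * (b - a) := by
    intro a b ha hab
    have ha0 : 0 < a := hm.trans_le ha
    rw [← Real.log_div (ha0.trans_le hab).ne' ha0.ne']
    refine (Real.log_le_sub_one_of_pos (div_pos (ha0.trans_le hab) ha0)).trans ?_
    rw [div_sub_one ha0.ne', div_eq_inv_mul]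
    gcongr
  have key2 : ∀ a b : ℝ, m ≤ a → m ≤ b → |Real.log a - Real.log b| ≤ m⁻¹ * |a - b| := by
    intro a b ha hb
    rcases le_total a b with h | h
    · rw [abs_sub_comm, abs_sub_comm a, abs_of_nonneg (sub_nonneg.2 h), abs_of_nonneg
        (sub_nonneg.2 (Real.log_le_log (hm.trans_le ha) h))]
      exact key a b ha h
    · rw [abs_of_nonneg (sub_nonneg.2 h), abs_of_nonneg
        (sub_nonneg.2 (Real.log_le_log (hm.trans_le hb) h))]
      exact key b a hb h
  rw [Real.dist_eq, Real.dist_eq]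
  refine (key2 _ _ (le_max_left _ _) (le_max_left _ _)).trans ?_
  refine mul_le_mul_of_nonneg_left ?_ (inv_nonneg.2 hm.le)
  refine (abs_max_sub_max_le_max m x m y).trans (max_le ?_ le_rfl)
  rw [sub_self, abs_zero]
  exact abs_nonneg _

variable (K) in
/-- A compactly supported Lipschitz function on the mixed space whose value is the product of a
weight on the unit lattice and a cut-off of the norm. -/
theorem exists_lipschitz_unitWeight_mul : ∃ (F : mixedSpace K → ℝ) (C : NNReal) (R : ℝ),
    LipschitzWith C F ∧ (∀ y, R < ‖y‖ → F y = 0) ∧ F 0 = 0 ∧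
    ∀ y, (∀ w, 0 < normAtPlace w y) → F y = unitWeight K (expMap.symm (normAtAllPlaces y)) *
      (ramp (mixedEmbedding.norm y) - ramp (2 * mixedEmbedding.norm y)) := by
  set M := ∑ i, ∑ w, |completeBasis K i w| with hM
  have hM0 : 0 ≤ M := by positivity
  set m := Real.exp (-(M + 1)) with hm
  have hm0 : 0 < m := Real.exp_pos _
  set f : realSpace K → ℝ := fun v ↦
    unitWeight K v * (ramp (Real.exp (∑ w, v w)) - ramp (2 * Real.exp (∑ w, v w))) with hf
  set V : mixedSpace K → realSpace K := fun y w ↦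
    w.mult * Real.log (max m (normAtPlace w y)) with hV
  have hmult : ∀ w : InfinitePlace K, (1 : ℝ) ≤ w.mult := fun w ↦ by
    exact_mod_cast mult_pos
  have hmult2 : ∀ w : InfinitePlace K, (w.mult : ℝ) ≤ 2 := fun w ↦ by
    rw [mult]; split_ifs <;> norm_num
  have hVlip : ∀ x y, dist (V x) (V y) ≤ (2 * m⁻¹) * dist x y := by
    intro x y
    rw [dist_pi_le_iff (by positivity)]
    intro w
    have h1 := dist_log_max_le hm0 (normAtPlace w x) (normAtPlace w y)
    have h2 := dist_normAtPlace_le w x y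
    rw [Real.dist_eq] at h1 ⊢
    simp only [hV]
    rw [← mul_sub, abs_mul, Nat.abs_cast, mul_assoc]
    have := hmult w
    refine mul_le_mul (hmult2 w) (h1.trans ?_) (abs_nonneg _) zero_le_two
    gcongr
  obtain ⟨C, hC⟩ := ((isBoundedLipschitz_unitWeight_mul (K := K)).comp (by positivity)
    hVlip).lipschitzWith
  have hsupp : ∀ y, f (V y) ≠ 0 → ∀ w, m < normAtPlace w y ∧
      Real.log (normAtPlace w y) ≤ M := by
    intro y hy w
    have h1 := abs_apply_le_of_unitWeight_mul_ne_zero hy w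
    have h2 : |Real.log (max m (normAtPlace w y))| ≤ M := by
      refine le_trans ?_ h1
      simp only [hV]
      rw [abs_mul, Nat.abs_cast]
      exact le_mul_of_one_le_left (abs_nonneg _) (hmult w)
    have h3 : m < normAtPlace w y := by
      by_contra! hle
      rw [max_eq_left hle, hm, Real.log_exp, abs_neg, abs_of_nonneg (by linarith)] at h2
      linarith
    rw [max_eq_right h3.le] at h2
    exact ⟨h3, (abs_le.1 h2).2⟩
  refine ⟨fun y ↦ f (V y), C, Real.exp M, hC, fun y hy ↦ ?_, ?_, fun y hy ↦ ?_⟩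
  · by_contra hne
    have h := hsupp y hne
    have : ‖y‖ ≤ Real.exp M := by
      rw [norm_eq_sup'_normAtPlace]
      refine Finset.sup'_le _ _ fun w _ ↦ ?_
      exact (Real.log_le_iff_le_exp (hm0.trans (h w).1)).1 (h w).2
    linarith
  · by_contra hne
    have h := (hsupp 0 hne w₀).1
    rw [map_zero] at h
    linarith
  · set v := expMap.symm (normAtAllPlaces y) with hv
    have hvw : ∀ w, v w = w.mult * Real.log (normAtPlace w y) := fun w ↦ rfl
    have hnorm : Real.exp (∑ w, v w) = mixedEmbedding.norm y := by
      rw [Real.exp_sum, mixedEmbedding.norm_apply]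
      refine Finset.prod_congr rfl fun w _ ↦ ?_
      rw [hvw, ← Real.log_pow, Real.exp_log (pow_pos (hy w) _)]
    have hfv : f v = unitWeight K v *
        (ramp (mixedEmbedding.norm y) - ramp (2 * mixedEmbedding.norm y)) := by
      rw [← hnorm]
    change f (V y) = _
    rw [← hfv]
    have hVv : (∀ w, m ≤ normAtPlace w y) → V y = v := by
      intro h
      funext w
      simp only [hV, hvw]
      rw [max_eq_right (h w)]
    by_cases h1 : f (V y) = 0
    · by_cases h2 : f v = 0
      · rw [h1, h2]
      · rw [hVv]
        intro w
        have h3 := abs_apply_le_of_unitWeight_mul_ne_zero h2 w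
        rw [hvw, abs_mul, Nat.abs_cast] at h3
        have h4 := (le_mul_of_one_le_left (abs_nonneg _) (hmult w)).trans h3
        rw [hm, ← Real.le_log_iff_exp_le (hy w)]
        linarith [(abs_le.1 h4).1]
    · rw [hVv fun w ↦ (hsupp y h1 w).1.le]

end TestFunction

section UnitSum

open NumberField NumberField.InfinitePlace NumberField.mixedEmbedding Module
open NumberField.mixedEmbedding.fundamentalCone NumberField.Units
open NumberField.Units.dirichletUnitTheorem
open scoped Classical nonZeroDivisors

variable (K : Type*) [Field K] [NumberField K]

theorem hasSum_prod_hat {n : ℕ} (T : Type*) [Finite T] (c : Fin n → ℝ) :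
    HasSum (fun p : T × (Fin n → ℤ) ↦ ∏ i, hat (c i + p.2 i)) (Nat.card T) := by
  have := Fintype.ofFinite T
  obtain ⟨N, hN⟩ : ∃ N : ℤ, ∀ i, |c i| + 1 ≤ N := by
    obtain ⟨N, hN⟩ := exists_nat_ge (∑ i, |c i| + 1)
    refine ⟨N, fun i ↦ le_trans ?_ (by exact_mod_cast hN)⟩
    gcongr
    exact Finset.single_le_sum (f := fun i ↦ |c i|) (fun _ _ ↦ abs_nonneg _) (Finset.mem_univ i)
  have key : HasSum (fun p : T × (Fin n → ℤ) ↦ ∏ i, hat (c i + p.2 i))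
      (∑ p ∈ (Finset.univ : Finset T) ×ˢ Fintype.piFinset fun _ : Fin n ↦ Finset.Icc (-N) N,
        ∏ i, hat (c i + p.2 i)) := by
    refine hasSum_sum_of_ne_finset_zero ?_
    rintro ⟨a, k⟩ hk
    simp only [Finset.mem_product, Finset.mem_univ, true_and, Fintype.mem_piFinset,
      not_forall] at hk
    obtain ⟨i, hi⟩ := hk
    refine Finset.prod_eq_zero (Finset.mem_univ i) (hat_eq_zero ?_)
    rw [Finset.mem_Icc, not_and_or, not_le, not_le] at hi
    have h1 := neg_abs_le (c i)
    have h2 := le_abs_self (c i)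
    have h3 := hN i
    rcases hi with hi | hi
    · have hi' : (k i : ℝ) + 1 ≤ -N := by exact_mod_cast hi
      rw [abs_of_nonpos (by simp only; linarith)]
      simp only
      linarith
    · have hi' : (N : ℝ) + 1 ≤ k i := by exact_mod_cast hi
      rw [abs_of_nonneg (by simp only; linarith)]
      simp only
      linarith
  rw [Finset.sum_product] at key
  simp only [← Finset.prod_univ_sum (fun _ ↦ Finset.Icc (-N) N) (fun i k ↦ hat (c i + k)),
    sum_hat _ (hN _)] at key
  simpa using key

variable {K}

/-- The logarithms of the absolute values of an element at all infinite places. -/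
noncomputable def placeLog (x : K) : realSpace K :=
  expMap.symm (normAtAllPlaces (mixedEmbedding K x))

theorem placeLog_apply (x : K) (w : InfinitePlace K) :
    placeLog x w = w.mult * Real.log (w x) := by
  rw [placeLog, expMap_symm_apply, normAtAllPlaces_mixedEmbedding]

theorem placeLog_mul {x y : K} (hx : x ≠ 0) (hy : y ≠ 0) :
    placeLog (x * y) = placeLog x + placeLog y := by
  funext w
  rw [Pi.add_apply, placeLog_apply, placeLog_apply, placeLog_apply, map_mul,
    Real.log_mul ((map_ne_zero w).2 hx) ((map_ne_zero w).2 hy), mul_add]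

theorem placeLog_unit (ζ : torsion K) (e : Fin (rank K) → ℤ) :
    placeLog (((ζ : (𝓞 K)ˣ) * ∏ i, fundSystem K i ^ e i : (𝓞 K)ˣ) : K) =
      ∑ i, (e i : ℝ) • completeBasis K (equivFinRank i) := by
  funext w
  have h1 : w ((ζ : (𝓞 K)ˣ) : K) = 1 := (mem_torsion K).1 ζ.2 w
  have hprod : ((∏ i, fundSystem K i ^ e i : (𝓞 K)ˣ) : K) =
      ∏ i, ((fundSystem K i ^ e i : (𝓞 K)ˣ) : K) :=
    map_prod ((algebraMap (𝓞 K) K : 𝓞 K →* K).comp (Units.coeHom (𝓞 K))) _ _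
  rw [placeLog_apply, Units.coe_mul, map_mul, h1, one_mul, hprod, map_prod,
    Real.log_prod fun i _ ↦ by simp, Finset.mul_sum, Finset.sum_apply]
  refine Finset.sum_congr rfl fun i _ ↦ ?_
  rw [completeBasis_apply_of_ne, Equiv.symm_apply_apply, Pi.smul_apply, expMap_symm_apply,
    normAtAllPlaces_mixedEmbedding, coe_zpow, map_zpow₀, Real.log_zpow, smul_eq_mul]
  ring

theorem hasSum_unitWeight {x : K} (hx : x ≠ 0) :
    HasSum (fun u : (𝓞 K)ˣ ↦ unitWeight K (placeLog ((u : K) * x))) (torsionOrder K) := by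
  set φ : torsion K × (Fin (rank K) → ℤ) → (𝓞 K)ˣ :=
    fun p ↦ (p.1 : (𝓞 K)ˣ) * ∏ i, fundSystem K i ^ p.2 i with hφ
  have hbij : Function.Bijective φ := by
    rw [Function.bijective_iff_existsUnique]
    intro u
    obtain ⟨p, hp, hu⟩ := exist_unique_eq_mul_prod K u
    exact ⟨p, hp.symm, fun q hq ↦ hu q hq.symm⟩
  rw [← (Equiv.ofBijective φ hbij).hasSum_iff]
  have key := hasSum_prod_hat (torsion K)
    (fun i ↦ (completeBasis K).repr (placeLog x) (equivFinRank i).1)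
  convert! key using 2 with p
  simp only [Function.comp_apply, Equiv.ofBijective_apply, hφ, unitWeight]
  rw [placeLog_mul (coe_ne_zero _) hx, placeLog_unit]
  refine Finset.prod_congr rfl fun i _ ↦ ?_
  congr 1
  rw [map_add, Finsupp.add_apply, map_sum, Finset.sum_apply', add_comm,
    Finset.sum_eq_single i]
  · simp
  · intro j _ hj
    rw [map_smul, Finsupp.smul_apply, Basis.repr_self, Finsupp.single_apply, if_neg, smul_zero]
    exact fun h ↦ hj (equivFinRank.injective (Subtype.ext h))
  · simp

theorem unitWeight_add_smul (v : realSpace K) (c : ℝ) :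
    unitWeight K (v + c • completeBasis K w₀) = unitWeight K v := by
  refine Finset.prod_congr rfl fun i _ ↦ ?_
  rw [map_add, map_smul, Finsupp.add_apply, Finsupp.smul_apply, Basis.repr_self,
    Finsupp.single_apply, if_neg (Ne.symm (equivFinRank i).2), smul_zero, add_zero]

theorem symm_expMap_smul {t : ℝ} (ht : 0 < t) {x : K} (hx : x ≠ 0) :
    expMap.symm (normAtAllPlaces (t • mixedEmbedding K x)) =
      placeLog x + Real.log t • completeBasis K w₀ := by
  funext w
  rw [completeBasis_apply_of_eq, Pi.add_apply, Pi.smul_apply, placeLog_apply, expMap_symm_apply,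
    normAtAllPlaces_apply, normAtPlace_smul, normAtPlace_apply, abs_of_pos ht,
    Real.log_mul ht.ne' ((map_ne_zero w).2 hx), smul_eq_mul]
  ring

end UnitSum

section PrincipalSum

open NumberField NumberField.InfinitePlace NumberField.mixedEmbedding Module
open NumberField.mixedEmbedding.fundamentalCone NumberField.Units
open NumberField.Units.dirichletUnitTheorem
open scoped Classical nonZeroDivisors

variable {K : Type*} [Field K] [NumberField K]

/-- A Lipschitz cutoff function supported on the interval from `1 / 2` to `2`. -/
noncomputable def shell (u : ℝ) : ℝ := ramp u - ramp (2 * u)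

theorem eq_unitWeight_mul_shell {F : mixedSpace K → ℝ}
    (hF : ∀ y, (∀ w, 0 < normAtPlace w y) → F y = unitWeight K (expMap.symm (normAtAllPlaces y)) *
      (ramp (mixedEmbedding.norm y) - ramp (2 * mixedEmbedding.norm y)))
    {t : ℝ} (ht : 0 < t) {x : 𝓞 K} (hx : x ≠ 0) :
    F (t⁻¹ • mixedEmbedding K (x : K)) = unitWeight K (placeLog (x : K)) *
      shell (Ideal.absNorm (Ideal.span {x}) / t ^ finrank ℚ K) := by
  have hx' : (x : K) ≠ 0 := RingOfIntegers.coe_ne_zero_iff.2 hx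
  have hnorm : mixedEmbedding.norm (t⁻¹ • mixedEmbedding K (x : K)) =
      Ideal.absNorm (Ideal.span {x}) / t ^ finrank ℚ K := by
    rw [mixedEmbedding.norm_smul, norm_eq_norm, abs_of_pos (inv_pos.2 ht),
      Ideal.absNorm_span_singleton, inv_pow, div_eq_inv_mul, Nat.cast_natAbs,
      ← Algebra.coe_norm_int]
    push_cast
    rfl
  rw [hF _ fun w ↦ ?_, hnorm, symm_expMap_smul (inv_pos.2 ht) hx', unitWeight_add_smul, shell]
  rw [normAtPlace_smul, normAtPlace_apply]
  have := (pos_iff (w := w)).2 hx'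
  positivity

theorem hasSum_principal (J : (Ideal (𝓞 K))⁰) {F : mixedSpace K → ℝ} (hF0 : F 0 = 0)
    (hF : ∀ y, (∀ w, 0 < normAtPlace w y) → F y = unitWeight K (expMap.symm (normAtAllPlaces y)) *
      (ramp (mixedEmbedding.norm y) - ramp (2 * mixedEmbedding.norm y)))
    {t : ℝ} (ht : 0 < t)
    (hs : Summable fun v : idealLattice K (FractionalIdeal.mk0 K J) ↦
      F (t⁻¹ • (v : mixedSpace K))) :
    HasSum (fun I : {I : (Ideal (𝓞 K))⁰ // J ∣ I ∧ (I : Ideal (𝓞 K)).IsPrincipal} ↦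
        torsionOrder K * shell (Ideal.absNorm (I.1 : Ideal (𝓞 K)) / t ^ finrank ℚ K))
      (∑' v : idealLattice K (FractionalIdeal.mk0 K J), F (t⁻¹ • (v : mixedSpace K))) := by
  set B := {I : (Ideal (𝓞 K))⁰ // J ∣ I ∧ (I : Ideal (𝓞 K)).IsPrincipal}
  have hgen : ∀ I : B, ∃ g : 𝓞 K, (I.1 : Ideal (𝓞 K)) = Ideal.span {g} := fun I ↦ I.2.2.principal
  choose g hg using hgen
  have hg0 : ∀ I, g I ≠ 0 := fun I h ↦ by
    have := hg I
    rw [h, Ideal.span_singleton_eq_bot.2 rfl] at this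
    exact nonZeroDivisors.ne_zero I.1.2 this
  have hgJ : ∀ (I : B) (u : (𝓞 K)ˣ), (u : 𝓞 K) * g I ∈ (J : Ideal (𝓞 K)) := fun I u ↦ by
    have h1 : (I.1 : Ideal (𝓞 K)) ≤ J :=
      Ideal.le_of_dvd (nonZeroDivisors_dvd_iff_dvd_coe.1 I.2.1)
    refine Ideal.mul_mem_left _ _ (h1 ?_)
    rw [hg]
    exact Ideal.mem_span_singleton_self _
  have hspan : ∀ (I : B) (u : (𝓞 K)ˣ), Ideal.span {(u : 𝓞 K) * g I} = (I.1 : Ideal (𝓞 K)) :=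
    fun I u ↦ by rw [hg, Ideal.span_singleton_mul_left_unit u.isUnit]
  set ψ : B × (𝓞 K)ˣ → idealLattice K (FractionalIdeal.mk0 K J) := fun p ↦
    ⟨mixedEmbedding K ((((p.2 : 𝓞 K) * g p.1 : 𝓞 K)) : K), (mem_idealLattice K _).2
      ⟨_, by
        rw [FractionalIdeal.coe_mk0]
        exact (FractionalIdeal.mem_coeIdeal _).2 ⟨_, hgJ p.1 p.2, rfl⟩, rfl⟩⟩ with hψ
  have hinj : Function.Injective ψ := by
    rintro ⟨I, u⟩ ⟨I', u'⟩ h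
    have h1 : (u : 𝓞 K) * g I = (u' : 𝓞 K) * g I' :=
      RingOfIntegers.coe_injective (mixedEmbedding_injective K (congrArg Subtype.val h))
    have h2 : I = I' := by
      apply Subtype.ext
      apply Subtype.ext
      rw [← hspan I u, h1, hspan]
    subst h2
    exact Prod.ext rfl (Units.ext (mul_right_cancel₀ (hg0 I) h1))
  have hoff : ∀ v, v ∉ Set.range ψ → F (t⁻¹ • (v : mixedSpace K)) = 0 := by
    rintro ⟨v, hv⟩ hv'
    obtain ⟨y, hy, rfl⟩ := (mem_idealLattice K _).1 hv
    rw [FractionalIdeal.coe_mk0] at hy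
    obtain ⟨x, hx, rfl⟩ := (FractionalIdeal.mem_coeIdeal _).1 hy
    by_cases hx0 : x = 0
    · simp only [hx0, map_zero, smul_zero, hF0]
    · exfalso
      apply hv'
      have hJx : J ∣ ⟨Ideal.span {x}, mem_nonZeroDivisors_of_ne_zero
          (by simpa using hx0)⟩ := by
        rw [nonZeroDivisors_dvd_iff_dvd_coe, Ideal.dvd_iff_le]
        exact (Ideal.span_singleton_le_iff_mem _).2 hx
      set I : B := ⟨⟨Ideal.span {x}, mem_nonZeroDivisors_of_ne_zero (by simpa using hx0)⟩, hJx,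
        ⟨x, rfl⟩⟩
      obtain ⟨u, hu⟩ := Ideal.span_singleton_eq_span_singleton.1 (hg I).symm
      refine ⟨(I, u), Subtype.ext ?_⟩
      simp only [hψ]
      rw [mul_comm, hu]
  have h1 : HasSum (fun p : B × (𝓞 K)ˣ ↦ F (t⁻¹ • (ψ p : mixedSpace K)))
      (∑' v : idealLattice K (FractionalIdeal.mk0 K J), F (t⁻¹ • (v : mixedSpace K))) :=
    (hinj.hasSum_iff hoff).2 hs.hasSum
  refine h1.prod_fiberwise fun I ↦ ?_
  have h2 := (hasSum_unitWeight (K := K) (RingOfIntegers.coe_ne_zero_iff.2 (hg0 I))).mul_right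
    (shell (Ideal.absNorm (I.1 : Ideal (𝓞 K)) / t ^ finrank ℚ K))
  refine h2.congr_fun ?_
  intro u
  simp only [hψ]
  rw [eq_unitWeight_mul_shell hF ht (mul_ne_zero u.ne_zero (hg0 I)), hspan]
  rfl

/-- The nonzero ideals in a given class correspond to the principal multiples of an ideal in
the inverse class. -/
noncomputable def classEquiv {C : ClassGroup (𝓞 K)} {J : (Ideal (𝓞 K))⁰}
    (hJ : ClassGroup.mk0 J = C⁻¹) :
    {I : (Ideal (𝓞 K))⁰ // ClassGroup.mk0 I = C} ≃
      {I : (Ideal (𝓞 K))⁰ // J ∣ I ∧ (I : Ideal (𝓞 K)).IsPrincipal} := by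
  refine ((Equiv.dvd J).subtypeEquiv (q := fun I ↦ (I.1 : Ideal (𝓞 K)).IsPrincipal)
    fun I ↦ ?_).trans (Equiv.subtypeSubtypeEquivSubtypeInter (fun I : (Ideal (𝓞 K))⁰ ↦ J ∣ I)
      fun I ↦ (I : Ideal (𝓞 K)).IsPrincipal)
  rw [← ClassGroup.mk0_eq_one_iff (SetLike.coe_mem _)]
  simp_rw [Equiv.dvd_apply, Submonoid.coe_mul, ← Submonoid.mul_def, map_mul, hJ,
    inv_mul_eq_one, eq_comm]

theorem classEquiv_apply {C : ClassGroup (𝓞 K)} {J : (Ideal (𝓞 K))⁰}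
    (hJ : ClassGroup.mk0 J = C⁻¹) (I : {I : (Ideal (𝓞 K))⁰ // ClassGroup.mk0 I = C}) :
    (classEquiv hJ I).1 = J * I.1 := rfl

theorem exists_abs_tsum_class_sub_le (C : ClassGroup (𝓞 K)) : ∃ κ M : ℝ, 0 ≤ M ∧
    ∀ X : ℝ, 1 ≤ X →
      |∑' I : {I : (Ideal (𝓞 K))⁰ // ClassGroup.mk0 I = C},
        shell (Ideal.absNorm (I.1 : Ideal (𝓞 K)) / X) - κ * X| ≤
          M * X ^ (1 - (finrank ℚ K : ℝ)⁻¹) := by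
  obtain ⟨J, hJ⟩ := ClassGroup.mk0_surjective C⁻¹
  obtain ⟨F, c, R, hF, hR, hF0, hFy⟩ := exists_lipschitz_unitWeight_mul K
  obtain ⟨I₀, M, hM, hmain⟩ := exists_abs_tsum_inv_smul_sub_le MeasureTheory.volume
    (idealLattice K (FractionalIdeal.mk0 K J)) (fundamentalDomain_idealLattice K _)
    (ZSpan.fundamentalDomain_isBounded _) hF hR
  rw [mixedEmbedding.finrank] at hmain
  set n := finrank ℚ K with hn
  have hn0 : n ≠ 0 := finrank_pos.ne'
  have hT : (0 : ℝ) < torsionOrder K := by exact_mod_cast torsionOrder_pos K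
  set N : ℝ := (Ideal.absNorm (J : Ideal (𝓞 K)) : ℝ) with hN
  have hN1 : 1 ≤ N := by
    have := Ideal.absNorm_pos_of_nonZeroDivisors J
    rw [hN]
    exact_mod_cast this
  have hN0 : 0 < N := by linarith
  refine ⟨I₀ * N / torsionOrder K, M * N ^ (1 - (n : ℝ)⁻¹) / torsionOrder K, by positivity,
    fun X hX ↦ ?_⟩
  have hX0 : 0 < X := by linarith
  set t : ℝ := (N * X) ^ (n : ℝ)⁻¹ with ht
  have hNX : 1 ≤ N * X := one_le_mul_of_one_le_of_one_le hN1 hX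
  have ht1 : 1 ≤ t := Real.one_le_rpow hNX (by positivity)
  have htn : t ^ n = N * X := Real.rpow_inv_natCast_pow (by linarith) hn0
  obtain ⟨hs, hb⟩ := hmain t ht1
  have h1 := hasSum_principal J hF0 hFy (by linarith : 0 < t) hs
  rw [← (classEquiv hJ).hasSum_iff] at h1
  have h2 : HasSum (fun I : {I : (Ideal (𝓞 K))⁰ // ClassGroup.mk0 I = C} ↦
      torsionOrder K * shell (Ideal.absNorm (I.1 : Ideal (𝓞 K)) / X))
      (∑' v : idealLattice K (FractionalIdeal.mk0 K J), F (t⁻¹ • (v : mixedSpace K))) := by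
    convert! h1 using 2 with I
    rw [Function.comp_apply, classEquiv_apply, ← hn, htn, Submonoid.coe_mul, map_mul,
      Nat.cast_mul, mul_div_mul_left _ _ hN0.ne']
  have h3 := h2.tsum_eq
  rw [tsum_mul_left] at h3
  rw [← h3, htn] at hb
  have h4 : t ^ n / t = N ^ (1 - (n : ℝ)⁻¹) * X ^ (1 - (n : ℝ)⁻¹) := by
    rw [htn, ht, ← Real.mul_rpow hN0.le hX0.le, Real.rpow_sub (by positivity), Real.rpow_one]
  rw [← htn, h4, htn] at hb
  set S := ∑' I : {I : (Ideal (𝓞 K))⁰ // ClassGroup.mk0 I = C},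
        shell (Ideal.absNorm (I.1 : Ideal (𝓞 K)) / X)
  have h5 : S - I₀ * N / torsionOrder K * X =
      (torsionOrder K * S - I₀ * (N * X)) / torsionOrder K := by
    field_simp
  rw [h5, abs_div, abs_of_pos hT, div_le_iff₀ hT]
  refine hb.trans (le_of_eq ?_)
  field_simp

end PrincipalSum

section Desmoothing

open Finset

theorem abs_le_of_halving {D : ℝ → ℝ} {B C s : ℝ} (hs : 0 < s) (hC : 0 ≤ C)
    (h0 : ∀ X, 0 ≤ X → X < 1 → |D X| ≤ B) (h1 : ∀ X, 1 ≤ X → |D X| ≤ |D (X / 2)| + C * X ^ s) :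
    ∃ A, 0 ≤ A ∧ ∀ X, 0 ≤ X → |D X| ≤ B + A * X ^ s := by
  have hlt : (2 : ℝ)⁻¹ ^ s < 1 := Real.rpow_lt_one (by norm_num) (by norm_num) hs
  set A := C / (1 - (2 : ℝ)⁻¹ ^ s) with hA
  have hA0 : 0 ≤ A := div_nonneg hC (by linarith)
  have hAC : A * (2 : ℝ)⁻¹ ^ s + C = A := by
    rw [hA]
    field_simp [(by linarith : (1 - (2 : ℝ)⁻¹ ^ s) ≠ 0)]
    ring
  refine ⟨A, hA0, ?_⟩
  have key : ∀ k : ℕ, ∀ X, 0 ≤ X → X < 2 ^ k → |D X| ≤ B + A * X ^ s := by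
    intro k
    induction k with
    | zero =>
      intro X hX0 hX
      have := h0 X hX0 (by simpa using hX)
      have : 0 ≤ A * X ^ s := by positivity
      linarith
    | succ k ih =>
      intro X hX0 hX
      rcases lt_or_ge X 1 with h | h
      · have := h0 X hX0 h
        have : 0 ≤ A * X ^ s := by positivity
        linarith
      · have h2 := ih (X / 2) (by linarith) (by rw [pow_succ] at hX; linarith)
        have h3 := h1 X h
        rw [div_eq_mul_inv, Real.mul_rpow hX0 (by norm_num)] at h2
        rw [div_eq_mul_inv] at h3
        have h4 : A * (X ^ s * (2 : ℝ)⁻¹ ^ s) + C * X ^ s = A * X ^ s := by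
          rw [← hAC]
          nth_rewrite 1 [hAC]
          ring
        linarith
  intro X hX
  obtain ⟨k, hk⟩ := pow_unbounded_of_one_lt X (one_lt_two : (1 : ℝ) < 2)
  exact key k X hX hk

theorem summable_mul_of_eq_zero {a φ : ℕ → ℝ} {N : ℝ} (h : ∀ n : ℕ, N ≤ n → φ n = 0) :
    Summable fun n ↦ a n * φ n := by
  refine summable_of_hasFiniteSupport ?_
  refine (Set.finite_le_nat ⌈N⌉₊).subset fun n hn ↦ ?_
  by_contra! h'
  refine hn ?_
  have : N ≤ n := (Nat.le_ceil N).trans (by exact_mod_cast (not_le.1 h').le)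
  simp only [h n this, mul_zero]

variable {a : ℕ → ℝ}

theorem summable_mul_ramp (a : ℕ → ℝ) {X : ℝ} (hX : 0 < X) :
    Summable fun n : ℕ ↦ a n * ramp (n / X) :=
  summable_mul_of_eq_zero (N := 2 * X) fun n hn ↦ ramp_eq_zero (by rwa [le_div_iff₀ hX])

theorem summable_mul_max (a : ℕ → ℝ) (X : ℝ) :
    Summable fun n : ℕ ↦ a n * max 0 (X - n) :=
  summable_mul_of_eq_zero (N := X) fun n hn ↦ max_eq_left (by linarith)

theorem exists_abs_tsum_ramp_sub_le (h0 : a 0 = 0) {κ M s : ℝ} (hM : 0 ≤ M) (hs : 0 < s)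
    (h : ∀ X : ℝ, 1 ≤ X → |∑' n : ℕ, a n * shell (n / X) - κ * X| ≤ M * X ^ s) :
    ∃ B A : ℝ, 0 ≤ A ∧ 0 ≤ B ∧ ∀ X : ℝ, 0 ≤ X →
      |∑' n : ℕ, a n * ramp (n / X) - 2 * κ * X| ≤ B + A * X ^ s := by
  refine (abs_le_of_halving
    (D := fun X ↦ ∑' n : ℕ, a n * ramp (n / X) - 2 * κ * X)
    (B := |a 1| + |∑' n : ℕ, a n| + 2 * |κ|) hs hM ?_ ?_).elim fun A hA ↦
      ⟨_, A, hA.1, by positivity, hA.2⟩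
  · intro X hX0 hX1
    refine (abs_sub _ _).trans ?_
    have hκ : |2 * κ * X| ≤ 2 * |κ| := by
      rw [abs_mul, abs_mul, abs_two, abs_of_nonneg hX0]
      have := abs_nonneg κ
      nlinarith
    rcases hX0.eq_or_lt with rfl | hX0
    · simp only [div_zero, ramp_eq_one zero_le_one, mul_one]
      linarith [abs_nonneg (a 1)]
    · rw [tsum_eq_sum (s := range 2) fun n hn ↦ ?_]
      · rw [sum_range_succ, sum_range_one, h0, zero_mul, zero_add, abs_mul]
        have h1 : |ramp ((1 : ℕ) / X)| ≤ 1 := by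
          rw [ramp, abs_of_nonneg (le_max_left _ _)]
          exact max_le zero_le_one (min_le_left _ _)
        have := mul_le_of_le_one_right (abs_nonneg (a 1)) h1
        linarith [abs_nonneg (∑' n : ℕ, a n)]
      · rw [mem_range, not_lt] at hn
        have : (2 : ℝ) ≤ n := by exact_mod_cast hn
        rw [ramp_eq_zero, mul_zero]
        rw [le_div_iff₀ hX0]
        linarith
  · intro X hX
    have hX0 : 0 < X := by linarith
    have h1 : ∑' n : ℕ, a n * ramp (n / X) =
        ∑' n : ℕ, a n * shell (n / X) + ∑' n : ℕ, a n * ramp (n / (X / 2)) := by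
      rw [← sub_eq_iff_eq_add,
        ← (summable_mul_ramp a hX0).tsum_sub (summable_mul_ramp a (half_pos hX0))]
      refine tsum_congr fun n ↦ ?_
      rw [shell, mul_sub]
      congr 3
      field_simp
    rw [h1]
    have h2 := h X hX
    have h3 := abs_add_le (∑' n : ℕ, a n * shell (n / X) - κ * X)
      (∑' n : ℕ, a n * ramp (n / (X / 2)) - 2 * κ * (X / 2))
    have h4 : (∑' n : ℕ, a n * shell (n / X) - κ * X) +
        (∑' n : ℕ, a n * ramp (n / (X / 2)) - 2 * κ * (X / 2)) =
      ∑' n : ℕ, a n * shell (n / X) + ∑' n : ℕ, a n * ramp (n / (X / 2)) - 2 * κ * X := by ring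
    rw [h4] at h3
    linarith

theorem mul_ramp_div {X : ℝ} (hX : 0 < X) (u : ℝ) :
    X * ramp (u / X) = max 0 (2 * X - u) - max 0 (X - u) := by
  have h1 : X * ramp (u / X) = max 0 (min X (2 * X - u)) := by
    rw [ramp, mul_max_of_nonneg _ _ hX.le, mul_min_of_nonneg _ _ hX.le]
    congr 2
    · ring
    · ring
    · field_simp
  rw [h1]
  rcases le_total u X with h | h
  · rw [min_eq_left (by linarith), max_eq_right hX.le, max_eq_right (by linarith),
      max_eq_right (by linarith)]
    ring
  · rw [min_eq_right (by linarith), max_eq_left (a := 0) (b := X - u) (by linarith), sub_zero]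

theorem exists_abs_tsum_max_sub_le (h0 : a 0 = 0) {κ M s : ℝ} (hM : 0 ≤ M) (hs : 0 < s)
    (h : ∀ X : ℝ, 1 ≤ X → |∑' n : ℕ, a n * shell (n / X) - κ * X| ≤ M * X ^ s) :
    ∃ B : ℝ, 0 ≤ B ∧ ∀ X : ℝ, 0 ≤ X →
      |∑' n : ℕ, a n * max 0 (X - n) - 2 * κ / 3 * X ^ 2| ≤ B + B * X ^ (1 + s) := by
  obtain ⟨B, A, hA, hB, hAB⟩ := exists_abs_tsum_ramp_sub_le h0 hM hs h
  refine (abs_le_of_halving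
    (D := fun X ↦ ∑' n : ℕ, a n * max 0 (X - n) - 2 * κ / 3 * X ^ 2)
    (B := |2 * κ / 3|) (s := 1 + s) (C := B + A) (by linarith) (by linarith) ?_ ?_).elim
    fun A' ⟨hA', hAX⟩ ↦ ?_
  rotate_left 2
  · refine ⟨|2 * κ / 3| + A', by positivity, fun X hX ↦ (hAX X hX).trans ?_⟩
    have : 0 ≤ |2 * κ / 3| * X ^ (1 + s) := by positivity
    linarith
  · intro X hX0 hX1
    have : ∑' n : ℕ, a n * max 0 (X - n) = 0 := by
      refine (tsum_congr fun n ↦ ?_).trans (tsum_zero (α := ℝ) (β := ℕ))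
      rcases n with _ | n
      · rw [h0, zero_mul]
      · rw [max_eq_left, mul_zero]
        push_cast
        have : (0 : ℝ) ≤ n := by positivity
        linarith
    simp only [this, zero_sub, abs_neg, abs_mul, abs_pow, abs_of_nonneg hX0]
    exact mul_le_of_le_one_right (abs_nonneg _) (pow_le_one₀ hX0 hX1.le)
  · intro X hX
    have hX0 : 0 < X / 2 := by linarith
    have h1 : ∑' n : ℕ, a n * max 0 (X - n) = X / 2 * ∑' n : ℕ, a n * ramp (n / (X / 2)) +
        ∑' n : ℕ, a n * max 0 (X / 2 - n) := by
      rw [← sub_eq_iff_eq_add, ← (summable_mul_max a X).tsum_sub (summable_mul_max a (X / 2)),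
        ← tsum_mul_left]
      refine tsum_congr fun n ↦ ?_
      rw [mul_left_comm, mul_ramp_div hX0, mul_sub]
      congr 4
      ring
    have h2 := hAB (X / 2) hX0.le
    have h3 := mul_le_mul_of_nonneg_left h2 hX0.le
    rw [← abs_of_pos hX0, ← abs_mul, abs_of_pos hX0] at h3
    have h4 := abs_add_le (X / 2 * (∑' n : ℕ, a n * ramp (n / (X / 2)) - 2 * κ * (X / 2)))
      (∑' n : ℕ, a n * max 0 (X / 2 - n) - 2 * κ / 3 * (X / 2) ^ 2)
    have h5 : X / 2 * (∑' n : ℕ, a n * ramp (n / (X / 2)) - 2 * κ * (X / 2)) +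
      (∑' n : ℕ, a n * max 0 (X / 2 - n) - 2 * κ / 3 * (X / 2) ^ 2) =
      ∑' n : ℕ, a n * max 0 (X - n) - 2 * κ / 3 * X ^ 2 := by
      rw [h1]
      ring
    rw [h5] at h4
    have h6 : X / 2 * (B + A * (X / 2) ^ s) ≤ (B + A) * X ^ (1 + s) := by
      have h7 : (X / 2) ^ s ≤ X ^ s := Real.rpow_le_rpow hX0.le (by linarith) hs.le
      have h8 : 1 ≤ X ^ s := Real.one_le_rpow hX hs.le
      rw [Real.rpow_add (by linarith), Real.rpow_one]
      have h9 : B + A * (X / 2) ^ s ≤ (B + A) * X ^ s := by nlinarith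
      have h10 : 0 ≤ (B + A) * X ^ s := by positivity
      calc X / 2 * (B + A * (X / 2) ^ s) ≤ X / 2 * ((B + A) * X ^ s) := by gcongr
        _ ≤ (B + A) * (X * X ^ s) := by nlinarith
    linarith

theorem tsum_max_eq_sum (h0 : a 0 = 0) {X : ℝ} (hX : 0 ≤ X) :
    ∑' n : ℕ, a n * max 0 (X - n) = ∑ n ∈ Icc 1 ⌊X⌋₊, a n * (X - n) := by
  rw [tsum_eq_sum (s := Icc 1 ⌊X⌋₊) fun n hn ↦ ?_]
  · refine sum_congr rfl fun n hn ↦ ?_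
    have := (Nat.le_floor_iff hX).1 (mem_Icc.1 hn).2
    rw [max_eq_right (by linarith)]
  · rcases n.eq_zero_or_pos with rfl | hn0
    · rw [h0, zero_mul]
    · rw [mem_Icc, not_and, not_le] at hn
      have := (Nat.floor_lt hX).1 (hn hn0)
      rw [max_eq_left (by linarith), mul_zero]

/-- A smoothed count with a power saving gives a sharp count with a power saving. -/
theorem exists_abs_sum_sub_le_of_shell (h0 : a 0 = 0) (ha : ∀ n, 0 ≤ a n) {κ M s : ℝ}
    (hM : 0 ≤ M) (hs : 0 < s) (hs1 : s < 1)
    (h : ∀ X : ℝ, 1 ≤ X → |∑' n : ℕ, a n * shell (n / X) - κ * X| ≤ M * X ^ s) :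
    ∃ κ' C : ℝ, 0 ≤ C ∧ ∀ n : ℕ, |∑ k ∈ Icc 1 n, a k - κ' * n| ≤ C * (n : ℝ) ^ ((1 + s) / 2) := by
  obtain ⟨B, hB, hBX⟩ := exists_abs_tsum_max_sub_le h0 hM hs h
  set c := 2 * κ / 3 with hc
  refine ⟨2 * c, |c| + 10 * B, by positivity, fun n ↦ ?_⟩
  rcases n.eq_zero_or_pos with rfl | hn
  · simp only [Order.one_le_iff_pos, lt_self_iff_false, not_false_eq_true, Icc_eq_empty, sum_empty,
      CharP.cast_eq_zero, mul_zero, sub_zero, abs_zero]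
    positivity
  have hx1 : (1 : ℝ) ≤ n := by exact_mod_cast hn
  set x : ℝ := (n : ℝ) with hx
  have hx0 : 0 < x := by linarith
  set q := x ^ ((1 + s) / 2) with hq
  have hq1 : 1 ≤ q := Real.one_le_rpow hx1 (by linarith)
  have hqx : q ≤ x := by
    simpa using Real.rpow_le_rpow_of_exponent_le hx1 (by linarith : (1 + s) / 2 ≤ 1)
  have hqq : x ^ (1 + s) = q ^ 2 := by
    rw [hq, ← Real.rpow_natCast, ← Real.rpow_mul hx0.le]
    congr 1
    push_cast
    ring
  have hS : ∀ X, 0 ≤ X → X ≤ 2 * x →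
      |∑ n ∈ Icc 1 ⌊X⌋₊, a n * (X - n) - c * X ^ 2| ≤ 5 * B * q ^ 2 := by
    intro X hX hX2
    rw [← tsum_max_eq_sum h0 hX]
    refine (hBX X hX).trans ?_
    have h1 : X ^ (1 + s) ≤ 4 * q ^ 2 := by
      calc X ^ (1 + s) ≤ (2 * x) ^ (1 + s) := Real.rpow_le_rpow hX hX2 (by linarith)
        _ = 2 ^ (1 + s) * q ^ 2 := by rw [Real.mul_rpow (by norm_num) hx0.le, hqq]
        _ ≤ 2 ^ (2 : ℝ) * q ^ 2 := by
          gcongr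
          · norm_num
          · linarith
        _ = 4 * q ^ 2 := by norm_num
    have h2 : 1 ≤ q ^ 2 := one_le_pow₀ hq1
    nlinarith
  have hfl : ⌊x⌋₊ = n := Nat.floor_natCast n
  have hq0 : 0 < q := by linarith
  have hup := (sum_mul_sub_mono ha hx0.le hq0.le).1
  have hlo := (sum_mul_sub_mono ha (x := x - q) (h := q) (by linarith) hq0.le).2
  rw [sub_add_cancel] at hlo
  have e1 := abs_le.1 (hS x hx0.le (by linarith))
  have e2 := abs_le.1 (hS (x + q) (by linarith) (by linarith))
  have e3 := abs_le.1 (hS (x - q) (by linarith) (by linarith))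
  rw [hfl] at hup hlo e1
  set ψ := ∑ k ∈ Icc 1 n, a k
  have c1 := neg_abs_le c
  have c2 := le_abs_self c
  have hup' : ψ * q ≤ (2 * c * x + (|c| + 10 * B) * q) * q := by nlinarith
  have hlo' : (2 * c * x - (|c| + 10 * B) * q) * q ≤ ψ * q := by nlinarith
  have g1 := le_of_mul_le_mul_right hup' hq0
  have g2 := le_of_mul_le_mul_right hlo' hq0
  rw [abs_le]
  constructor <;> linarith

end Desmoothing

section IdealCount

open NumberField Module
open scoped nonZeroDivisors

variable (K : Type*) [Field K] [NumberField K]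

/-- The number of nonzero ideals of given norm. -/
noncomputable def idealCount (n : ℕ) : ℕ :=
  Nat.card {I : (Ideal (𝓞 K))⁰ // Ideal.absNorm (I : Ideal (𝓞 K)) = n}

/-- The ideals of given norm. -/
noncomputable def idealsOfNorm (n : ℕ) : Finset (Ideal (𝓞 K)) :=
  (Ideal.finite_setOfPred_absNorm_eq n).toFinset

variable {K} in
theorem mem_idealsOfNorm {n : ℕ} {I : Ideal (𝓞 K)} :
    I ∈ idealsOfNorm K n ↔ Ideal.absNorm I = n := by
  simp [idealsOfNorm]

theorem idealCount_zero : idealCount K 0 = 0 := by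
  have : IsEmpty {I : (Ideal (𝓞 K))⁰ // Ideal.absNorm (I : Ideal (𝓞 K)) = 0} :=
    ⟨fun I ↦ Ideal.absNorm_ne_zero_of_nonZeroDivisors I.1 I.2⟩
  exact Nat.card_of_isEmpty

theorem idealCount_eq_card {n : ℕ} (hn : n ≠ 0) : idealCount K n = (idealsOfNorm K n).card := by
  rw [idealCount, ← Nat.card_eq_finsetCard]
  refine Nat.card_congr ⟨fun I ↦ ⟨I.1, mem_idealsOfNorm.2 I.2⟩, fun I ↦ ⟨⟨I.1,
    mem_nonZeroDivisors_of_ne_zero fun h ↦ hn ?_⟩, mem_idealsOfNorm.1 I.2⟩,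
    fun _ ↦ rfl, fun _ ↦ rfl⟩
  rw [← mem_idealsOfNorm.1 I.2, h, map_zero]

theorem tsum_ideal_eq {φ : ℕ → ℝ} {N : ℕ} (hφ : ∀ n, N < n → φ n = 0) :
    Summable (fun I : (Ideal (𝓞 K))⁰ ↦ φ (Ideal.absNorm (I : Ideal (𝓞 K)))) ∧
    ∑' I : (Ideal (𝓞 K))⁰, φ (Ideal.absNorm (I : Ideal (𝓞 K))) = ∑' n, idealCount K n * φ n := by
  have hs : Summable (fun I : (Ideal (𝓞 K))⁰ ↦ φ (Ideal.absNorm (I : Ideal (𝓞 K)))) := by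
    refine summable_of_hasFiniteSupport ?_
    refine (Ideal.finite_setOfPred_absNorm_le₀ N).subset fun I hI ↦ ?_
    by_contra h
    exact hI (hφ _ (not_le.1 h))
  refine ⟨hs, ?_⟩
  set e := Equiv.sigmaFiberEquiv fun I : (Ideal (𝓞 K))⁰ ↦ Ideal.absNorm (I : Ideal (𝓞 K))
  rw [← e.tsum_eq]
  refine (Summable.tsum_sigma (e.summable_iff.2 hs)).trans (tsum_congr fun n ↦ ?_)
  rw [idealCount, ← nsmul_eq_mul, ← tsum_const]
  refine tsum_congr fun I ↦ ?_
  exact congrArg φ I.2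

theorem exists_abs_tsum_idealCount_sub_le : ∃ κ M : ℝ, 0 ≤ M ∧ ∀ X : ℝ, 1 ≤ X →
    |∑' n : ℕ, (idealCount K n : ℝ) * shell (n / X) - κ * X| ≤
      M * X ^ (1 - (finrank ℚ K : ℝ)⁻¹) := by
  choose κ M hM h using exists_abs_tsum_class_sub_le (K := K)
  refine ⟨∑ C, κ C, ∑ C, M C, Finset.sum_nonneg fun C _ ↦ hM C, fun X hX ↦ ?_⟩
  have hX0 : 0 < X := by linarith
  obtain ⟨hs, he⟩ := tsum_ideal_eq K (φ := fun n ↦ shell (n / X)) (N := ⌈2 * X⌉₊) fun n hn ↦ by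
    have h1 : 2 * X ≤ n := (Nat.le_ceil _).trans (by exact_mod_cast hn.le)
    have h2 : 2 ≤ n / X := by rwa [le_div_iff₀ hX0]
    rw [shell, ramp_eq_zero h2, ramp_eq_zero (by linarith), sub_zero]
  set e := Equiv.sigmaFiberEquiv fun I : (Ideal (𝓞 K))⁰ ↦ ClassGroup.mk0 I
  have hsigma := Summable.tsum_sigma (e.summable_iff.2 hs)
  simp only [Function.comp_def] at hsigma
  rw [← he, ← e.tsum_eq, hsigma, tsum_fintype, Finset.sum_mul,
    Finset.sum_mul, ← Finset.sum_sub_distrib]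
  exact (Finset.abs_sum_le_sum_abs _ _).trans (Finset.sum_le_sum fun C _ ↦ h C X hX)

theorem sum_idealCount (n : ℕ) : ∑ k ∈ Finset.Icc 1 n, idealCount K k =
    Nat.card {I : (Ideal (𝓞 K))⁰ // Ideal.absNorm (I : Ideal (𝓞 K)) ≤ n} := by
  have hfin := Ideal.finite_setOfPred_absNorm_le₀ (S := 𝓞 K) n
  have h1 : Nat.card {I : (Ideal (𝓞 K))⁰ // Ideal.absNorm (I : Ideal (𝓞 K)) ≤ n} =
      hfin.toFinset.card := Nat.card_eq_card_finite_toFinset hfin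
  rw [h1, eq_comm, Finset.card_eq_sum_card_fiberwise (s := hfin.toFinset)
    (f := fun I : (Ideal (𝓞 K))⁰ ↦ Ideal.absNorm (I : Ideal (𝓞 K))) (t := Finset.Icc 1 n)]
  · refine Finset.sum_congr rfl fun k hk ↦ ?_
    rw [idealCount, Nat.subtype_card]
    intro I
    simp only [Finset.mem_filter, Set.Finite.mem_toFinset, Set.mem_ofPred_eq, and_iff_right_iff_imp]
    intro h
    rw [h]
    exact (Finset.mem_Icc.1 hk).2
  · intro I hI
    have h2 : Ideal.absNorm (I : Ideal (𝓞 K)) ≤ n := by simpa using hI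
    exact Finset.mem_coe.2 (Finset.mem_Icc.2
      ⟨Nat.one_le_iff_ne_zero.2 (Ideal.absNorm_ne_zero_of_nonZeroDivisors I), h2⟩)

/-- The number of ideals of norm at most `n` is linear in `n` up to a power saving. -/
theorem exists_abs_sum_idealCount_sub_le : ∃ κ θ C : ℝ, 0 < κ ∧ 0 ≤ θ ∧ θ < 1 ∧ 0 ≤ C ∧
    ∀ n : ℕ, |∑ k ∈ Finset.Icc 1 n, (idealCount K k : ℝ) - κ * n| ≤ C * (n : ℝ) ^ θ := by
  obtain ⟨κ₀, M, hM, h⟩ := exists_abs_tsum_idealCount_sub_le K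
  set s := max (1 / 2) (1 - (finrank ℚ K : ℝ)⁻¹)
  have hs0 : 0 < s := lt_max_of_lt_left (by norm_num)
  have hs1 : s < 1 := by
    have : (0 : ℝ) < finrank ℚ K := by exact_mod_cast finrank_pos
    refine max_lt (by norm_num) ?_
    have := inv_pos.2 this
    linarith
  obtain ⟨κ, C, hC, hκ⟩ := exists_abs_sum_sub_le_of_shell (a := fun n ↦ (idealCount K n : ℝ))
    (by simp only [idealCount_zero, Nat.cast_zero]) (fun n ↦ Nat.cast_nonneg _) hM hs0 hs1
    (fun X hX ↦ (h X hX).trans (mul_le_mul_of_nonneg_left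
      (Real.rpow_le_rpow_of_exponent_le hX (le_max_right _ _)) hM))
  refine ⟨κ, (1 + s) / 2, C, ?_, by linarith, by linarith, hC, hκ⟩
  have h1 := (NumberField.Ideal.tendsto_norm_le_div_atTop₀ K).comp
    (tendsto_natCast_atTop_atTop (R := ℝ))
  have h2 : Filter.Tendsto (fun n : ℕ ↦ (∑ k ∈ Finset.Icc 1 n, (idealCount K k : ℝ)) / n)
      Filter.atTop (nhds κ) := by
    rw [tendsto_iff_norm_sub_tendsto_zero]
    have h3 : Filter.Tendsto (fun n : ℕ ↦ C * (n : ℝ) ^ (-(1 - (1 + s) / 2))) Filter.atTop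
        (nhds 0) := by
      simpa using ((tendsto_rpow_neg_atTop (by linarith : 0 < 1 - (1 + s) / 2)).comp
        (tendsto_natCast_atTop_atTop (R := ℝ))).const_mul C
    refine squeeze_zero' (Filter.Eventually.of_forall fun n ↦ norm_nonneg _) ?_ h3
    filter_upwards [Filter.eventually_gt_atTop 0] with n hn
    have hn' : (0 : ℝ) < n := by exact_mod_cast hn
    rw [Real.norm_eq_abs, div_sub' hn'.ne', abs_div, abs_of_pos hn', div_le_iff₀ hn', mul_assoc,
      mul_comm (n : ℝ) κ]
    refine (hκ n).trans (le_of_eq ?_)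
    rw [← Real.rpow_add_one hn'.ne']
    congr 2
    ring
  have h4 := tendsto_nhds_unique h2 (h1.congr fun n ↦ by
    simp only [Function.comp_apply]
    rw [← Nat.cast_sum, sum_idealCount]
    simp only [Nat.cast_le])
  rw [h4]
  have := Units.regulator_pos K
  have := Units.torsionOrder_pos K
  have hd : (0 : ℝ) < |(discr K : ℝ)| := abs_pos.2 (by exact_mod_cast discr_ne_zero K)
  have hc : 0 < classNumber K := Fintype.card_pos
  have := Real.pi_pos
  positivity

end IdealCount

section IdealMangoldt

open NumberField Module UniqueFactorizationMonoid
open scoped Classical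

variable (K : Type*) [Field K] [NumberField K]

variable {K} in
theorem two_le_absNorm {P : Ideal (𝓞 K)} (hP : Prime P) : 2 ≤ Ideal.absNorm P := by
  have h0 : Ideal.absNorm P ≠ 0 := fun h ↦ hP.ne_zero (Ideal.absNorm_eq_zero_iff.1 h)
  have h1 : Ideal.absNorm P ≠ 1 := fun h ↦
    hP.not_isUnit (Ideal.isUnit_iff.2 (Ideal.absNorm_eq_one_iff.1 h))
  omega

/-- Pairs `(P, k)` where `P` is a nonzero prime ideal, `k ≥ 1` and `P ^ k` has norm `n`. -/
noncomputable def primePowersOfNorm (n : ℕ) : Finset (Σ _ : Ideal (𝓞 K), ℕ) :=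
  ((Ideal.finite_setOfPred_absNorm_le n).toFinset.sigma fun _ ↦ Finset.Icc 1 n).filter
    fun p ↦ Prime p.1 ∧ Ideal.absNorm p.1 ^ p.2 = n

variable {K} in
theorem mem_primePowersOfNorm {n : ℕ} {p : Σ _ : Ideal (𝓞 K), ℕ} :
    p ∈ primePowersOfNorm K n ↔ Prime p.1 ∧ 1 ≤ p.2 ∧ Ideal.absNorm p.1 ^ p.2 = n := by
  simp only [primePowersOfNorm, Finset.mem_filter, Finset.mem_sigma, Set.Finite.mem_toFinset,
    Set.mem_ofPred_eq, Finset.mem_Icc]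
  constructor
  · tauto
  · rintro ⟨h1, h2, rfl⟩
    have h3 := two_le_absNorm h1
    exact ⟨⟨Nat.le_self_pow (by omega) _, h2, (Nat.lt_pow_self (by omega)).le⟩, h1, rfl⟩

variable {K} in
/-- Pairs `(P, k)` where `P` is a nonzero prime ideal, `k ≥ 1` and `P ^ k` divides `I`. -/
noncomputable def primePowerDivisors (I : Ideal (𝓞 K)) : Finset (Σ _ : Ideal (𝓞 K), ℕ) :=
  (normalizedFactors I).toFinset.sigma fun P ↦ Finset.Icc 1 ((normalizedFactors I).count P)

variable {K} in
theorem mem_primePowerDivisors {I : Ideal (𝓞 K)} (hI : I ≠ 0) {p : Σ _ : Ideal (𝓞 K), ℕ} :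
    p ∈ primePowerDivisors I ↔ Prime p.1 ∧ 1 ≤ p.2 ∧ p.1 ^ p.2 ∣ I := by
  simp only [primePowerDivisors, Finset.mem_sigma, Multiset.mem_toFinset, Finset.mem_Icc]
  have key : Prime p.1 → (p.1 ^ p.2 ∣ I ↔ p.2 ≤ (normalizedFactors I).count p.1) := fun hp ↦ by
    rw [pow_dvd_iff_le_emultiplicity, emultiplicity_eq_count_normalizedFactors hp.irreducible hI,
      normalize_eq, Nat.cast_le]
  constructor
  · rintro ⟨h1, h2, h3⟩
    have hp := prime_of_normalized_factor _ h1
    exact ⟨hp, h2, (key hp).2 h3⟩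
  · rintro ⟨hp, h2, h3⟩
    have h4 := (key hp).1 h3
    exact ⟨Multiset.count_pos.1 (by omega), h2, h4⟩

variable {K} in
theorem sum_primePowerDivisors {I : Ideal (𝓞 K)} (hI : I ≠ 0) :
    ∑ p ∈ primePowerDivisors I, Real.log (Ideal.absNorm p.1) = Real.log (Ideal.absNorm I) := by
  rw [primePowerDivisors, Finset.sum_sigma]
  simp only [Finset.sum_const, Nat.card_Icc, Nat.add_sub_cancel]
  rw [← Finset.sum_multiset_map_count]
  conv_rhs => rw [← Ideal.prod_normalizedFactors_eq_self hI]
  have key : ∀ s : Multiset (Ideal (𝓞 K)), (∀ P ∈ s, Prime P) →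
      (s.map fun P ↦ Real.log (Ideal.absNorm P)).sum = Real.log (Ideal.absNorm s.prod) := by
    intro s
    induction s using Multiset.induction_on with
    | empty => simp
    | cons P s ih =>
      intro h
      have h1 := two_le_absNorm (h P (Multiset.mem_cons_self _ _))
      have h2 : Ideal.absNorm s.prod ≠ 0 := by
        rw [Ne, Ideal.absNorm_eq_zero_iff]
        exact Multiset.prod_ne_zero fun h0 ↦ (h _ (Multiset.mem_cons_of_mem h0)).ne_zero rfl
      rw [Multiset.map_cons, Multiset.sum_cons, Multiset.prod_cons, map_mul, Nat.cast_mul,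
        Real.log_mul (by positivity) (by exact_mod_cast h2),
        ih fun Q hQ ↦ h Q (Multiset.mem_cons_of_mem hQ)]
  exact key _ fun P hP ↦ prime_of_normalized_factor P hP

/-- The coefficients of the negative logarithmic derivative of the Dedekind zeta function. -/
noncomputable def idealMangoldt (n : ℕ) : ℝ :=
  ∑ p ∈ primePowersOfNorm K n, Real.log (Ideal.absNorm p.1)

theorem idealMangoldt_nonneg (n : ℕ) : 0 ≤ idealMangoldt K n :=
  Finset.sum_nonneg fun _ _ ↦ Real.log_natCast_nonneg _

theorem idealCount_mul_log {n : ℕ} (hn : n ≠ 0) : (idealCount K n : ℝ) * Real.log n =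
    ∑ p ∈ n.divisorsAntidiagonal, idealMangoldt K p.1 * idealCount K p.2 := by
  have h1 : (idealCount K n : ℝ) * Real.log n = ∑ x ∈ (idealsOfNorm K n).sigma
      fun I ↦ primePowerDivisors I, Real.log (Ideal.absNorm x.2.1) := by
    rw [idealCount_eq_card K hn, ← nsmul_eq_mul, ← Finset.sum_const, Finset.sum_sigma]
    refine Finset.sum_congr rfl fun I hI ↦ ?_
    have hI := mem_idealsOfNorm.1 hI
    rw [sum_primePowerDivisors, hI]
    rintro rfl
    exact hn (by rw [← hI]; exact Ideal.absNorm_bot)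
  have h2 : ∑ p ∈ n.divisorsAntidiagonal, idealMangoldt K p.1 * idealCount K p.2 =
      ∑ x ∈ n.divisorsAntidiagonal.sigma fun p ↦ primePowersOfNorm K p.1 ×ˢ idealsOfNorm K p.2,
        Real.log (Ideal.absNorm x.2.1.1) := by
    rw [Finset.sum_sigma]
    refine Finset.sum_congr rfl fun p hp ↦ ?_
    have hp2 : p.2 ≠ 0 := fun h ↦ by simp_all
    rw [Finset.sum_product, idealMangoldt, Finset.sum_mul]
    refine Finset.sum_congr rfl fun q hq ↦ ?_
    simp only [Finset.sum_const, nsmul_eq_mul, idealCount_eq_card K hp2]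
    ring
  rw [h1, h2]
  symm
  refine Finset.sum_bij (fun x _ ↦ ⟨x.2.1.1 ^ x.2.1.2 * x.2.2, x.2.1⟩) ?_ ?_ ?_ ?_
  · rintro ⟨⟨d, e⟩, q, J⟩ hx
    simp only [Finset.mem_sigma, Nat.mem_divisorsAntidiagonal, Finset.mem_product,
      mem_primePowersOfNorm, mem_idealsOfNorm] at hx ⊢
    obtain ⟨⟨hde, -⟩, ⟨hq, hk, hd⟩, he⟩ := hx
    have hJ : J ≠ 0 := by
      rintro rfl
      have : e = 0 := by rw [← he]; exact Ideal.absNorm_bot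
      exact hn (by rw [← hde, this, mul_zero])
    refine ⟨by rw [map_mul, map_pow, hd, he, hde], ?_⟩
    rw [mem_primePowerDivisors (mul_ne_zero (pow_ne_zero _ hq.ne_zero) hJ)]
    exact ⟨hq, hk, dvd_mul_right _ _⟩
  · rintro ⟨⟨d, e⟩, q, J⟩ hx ⟨⟨d', e'⟩, q', J'⟩ hx' h
    simp only [Finset.mem_sigma, Nat.mem_divisorsAntidiagonal, Finset.mem_product,
      mem_primePowersOfNorm, mem_idealsOfNorm] at hx hx'
    simp only [Sigma.mk.injEq, heq_eq_eq] at h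
    obtain ⟨⟨hde, -⟩, ⟨hq, hk, rfl⟩, rfl⟩ := hx
    obtain ⟨⟨hde', -⟩, ⟨hq', hk', rfl⟩, rfl⟩ := hx'
    obtain ⟨h3, rfl⟩ := h
    have h4 := mul_left_cancel₀ (pow_ne_zero _ hq.ne_zero) h3
    subst h4
    rfl
  · rintro ⟨I, q⟩ hx
    simp only [Finset.mem_sigma, mem_idealsOfNorm] at hx
    obtain ⟨hI, hq⟩ := hx
    have hI0 : I ≠ 0 := by
      rintro rfl
      exact hn (by rw [← hI]; exact Ideal.absNorm_bot)
    obtain ⟨h1, h2, J, rfl⟩ := (mem_primePowerDivisors hI0).1 hq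
    refine ⟨⟨(Ideal.absNorm q.1 ^ q.2, Ideal.absNorm J), q, J⟩, ?_, rfl⟩
    simp only [Finset.mem_sigma, Nat.mem_divisorsAntidiagonal, Finset.mem_product,
      mem_primePowersOfNorm, mem_idealsOfNorm]
    exact ⟨⟨by rw [← hI, map_mul, map_pow], hn⟩, ⟨h1, h2, trivial⟩, trivial⟩
  · intro x _
    rfl

theorem exists_isVonMangoldtPair : ∃ κ θ : ℝ,
    IsVonMangoldtPair (fun n ↦ idealCount K n) (idealMangoldt K) κ θ := by
  obtain ⟨κ, θ, C, hκ, hθ, hθ1, hC, h⟩ := exists_abs_sum_idealCount_sub_le K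
  refine ⟨κ, θ, ?_, ?_, fun n ↦ Nat.cast_nonneg _, ?_, idealMangoldt_nonneg K,
    fun n hn ↦ idealCount_mul_log K hn, hθ, hθ1, hκ, C, hC, h⟩
  · simp only [idealCount_zero, Nat.cast_zero]
  · have : idealsOfNorm K 1 = {⊤} := by
      ext I
      rw [mem_idealsOfNorm, Ideal.absNorm_eq_one_iff, Finset.mem_singleton]
    simp only [idealCount_eq_card K one_ne_zero, this, Finset.card_singleton, Nat.cast_one]
  · refine Finset.sum_eq_zero fun p hp ↦ ?_
    obtain ⟨h1, h2, h3⟩ := mem_primePowersOfNorm.1 hp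
    have := two_le_absNorm h1
    have := pow_pos (by omega : 0 < Ideal.absNorm p.1) p.2
    omega

/-- The number of prime ideals of given norm. -/
noncomputable def primeIdealCount (n : ℕ) : ℕ :=
  ((idealsOfNorm K n).filter Prime).card

theorem idealMangoldt_prime {p : ℕ} (hp : p.Prime) :
    idealMangoldt K p = primeIdealCount K p * Real.log p := by
  rw [primeIdealCount, ← nsmul_eq_mul, ← Finset.sum_const, idealMangoldt]
  refine Finset.sum_bij' (fun q _ ↦ q.1) (fun P _ ↦ ⟨P, 1⟩) ?_ ?_ ?_ ?_ ?_
  · intro q hq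
    obtain ⟨h1, h2, h3⟩ := mem_primePowersOfNorm.1 hq
    have h4 : q.2 = 1 := (Nat.Prime.eq_one_of_pow (by rwa [h3]))
    rw [h4, pow_one] at h3
    exact Finset.mem_filter.2 ⟨mem_idealsOfNorm.2 h3, h1⟩
  · intro P hP
    obtain ⟨h1, h2⟩ := Finset.mem_filter.1 hP
    exact mem_primePowersOfNorm.2 ⟨h2, le_rfl, by rw [pow_one]; exact mem_idealsOfNorm.1 h1⟩
  · intro q hq
    obtain ⟨h1, h2, h3⟩ := mem_primePowersOfNorm.1 hq
    have h4 : q.2 = 1 := (Nat.Prime.eq_one_of_pow (by rwa [h3]))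
    exact Sigma.ext rfl (heq_of_eq h4.symm)
  · intro P _
    rfl
  · intro q hq
    obtain ⟨h1, h2, h3⟩ := mem_primePowersOfNorm.1 hq
    have h4 : q.2 = 1 := (Nat.Prime.eq_one_of_pow (by rwa [h3]))
    rw [h4, pow_one] at h3
    rw [h3]

variable {K} in
theorem isPrimePow_absNorm {P : Ideal (𝓞 K)} (hP : Prime P) : IsPrimePow (Ideal.absNorm P) := by
  have h1 : P.IsPrime := Ideal.isPrime_of_prime hP
  have h2 : P.IsMaximal := h1.isMaximal hP.ne_zero
  let _ := Ideal.Quotient.field P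
  have h3 : Finite (𝓞 K ⧸ P) := Ideal.finiteQuotientOfFreeOfNeBot P hP.ne_zero
  have := Fintype.ofFinite (𝓞 K ⧸ P)
  rw [Ideal.absNorm_apply, Submodule.cardQuot_apply, Nat.card_eq_fintype_card]
  exact Fintype.isPrimePow_card_of_field

theorem idealMangoldt_le (n : ℕ) :
    idealMangoldt K n ≤ finrank ℚ K * ArithmeticFunction.vonMangoldt n := by
  by_cases hn : IsPrimePow n
  · obtain ⟨p, m, hp, hm, rfl⟩ := (isPrimePow_nat_iff n).1 hn
    rw [ArithmeticFunction.vonMangoldt_apply_pow hm.ne',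
      ArithmeticFunction.vonMangoldt_apply_prime hp]
    set I : Ideal (𝓞 K) := Ideal.span {(p : 𝓞 K)}
    have hI : I ≠ 0 := by
      rw [Ne, Ideal.zero_eq_bot, Ideal.span_singleton_eq_bot]
      exact_mod_cast hp.ne_zero
    have h1 : Ideal.absNorm I = p ^ finrank ℚ K := by
      have := Ideal.absNorm_span_natCast (S := 𝓞 K) p
      rw [this, RingOfIntegers.rank]
    have h2 := sum_primePowerDivisors hI
    rw [h1, Nat.cast_pow, Real.log_pow] at h2
    rw [← h2, idealMangoldt]
    calc ∑ q ∈ primePowersOfNorm K (p ^ m), Real.log (Ideal.absNorm q.1)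
        = ∑ q ∈ (primePowersOfNorm K (p ^ m)).image fun q ↦ (⟨q.1, 1⟩ : Σ _ : Ideal (𝓞 K), ℕ),
          Real.log (Ideal.absNorm q.1) := by
          symm
          apply Finset.sum_image
          intro q hq q' hq' h
          have ⟨a1, a2, a3⟩ := mem_primePowersOfNorm.1 hq
          have ⟨b1, b2, b3⟩ := mem_primePowersOfNorm.1 hq'
          have h4 : q.1 = q'.1 := (Sigma.mk.inj_iff.1 h).1
          refine Sigma.ext h4 (heq_of_eq ?_)
          rw [← b3, ← h4] at a3
          exact Nat.pow_right_injective (two_le_absNorm a1) a3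
      _ ≤ _ := by
          refine Finset.sum_le_sum_of_subset_of_nonneg ?_ fun _ _ _ ↦ Real.log_natCast_nonneg _
          intro q hq
          obtain ⟨q', hq', rfl⟩ := Finset.mem_image.1 hq
          obtain ⟨a1, a2, a3⟩ := mem_primePowersOfNorm.1 hq'
          refine (mem_primePowerDivisors hI).2 ⟨a1, le_rfl, ?_⟩
          rw [pow_one, Ideal.dvd_span_singleton]
          have h5 : ((p ^ m : ℕ) : 𝓞 K) ∈ q'.1 := by
            rw [← a3, Nat.cast_pow]
            exact Ideal.pow_mem_of_mem _ (Ideal.absNorm_mem _) _ (by omega)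
          rw [Nat.cast_pow] at h5
          exact (Ideal.isPrime_of_prime a1).mem_of_pow_mem _ h5
  · rw [ArithmeticFunction.vonMangoldt_eq_zero_iff.2 hn, mul_zero, idealMangoldt]
    refine (Finset.sum_eq_zero fun q hq ↦ ?_).le
    obtain ⟨a1, a2, a3⟩ := mem_primePowersOfNorm.1 hq
    exact (hn (a3 ▸ (isPrimePow_absNorm a1).pow (by omega))).elim

/-- The prime ideal theorem for prime ideals of prime norm. -/
theorem isVallePoussinSmall_primeIdealCount : IsVallePoussinSmall fun x ↦
    ∑ p ∈ (Finset.Icc 1 ⌊x⌋₊).filter Nat.Prime, (primeIdealCount K p : ℝ) * Real.log p - x := by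
  obtain ⟨κ, θ, hpair⟩ := exists_isVonMangoldtPair K
  have h1 := hpair.isVallePoussinSmall
  have h2 : IsVallePoussinSmall fun x ↦
      ∑ n ∈ (Finset.Icc 1 ⌊x⌋₊).filter fun n ↦ ¬ n.Prime, idealMangoldt K n := by
    refine IsVallePoussinSmall.of_le_rpow (M := 8 * finrank ℚ K) fun x hx ↦ ?_
    have hx0 : 0 < x := by linarith
    rw [abs_of_nonneg (Finset.sum_nonneg fun n _ ↦ idealMangoldt_nonneg K n)]
    have h3 : ∑ n ∈ (Finset.Icc 1 ⌊x⌋₊).filter (fun n ↦ ¬ n.Prime), idealMangoldt K n ≤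
        finrank ℚ K * (Chebyshev.psi x - Chebyshev.theta x) := by
      rw [Chebyshev.psi_sub_theta_eq_sum_not_prime, Finset.mul_sum]
      exact Finset.sum_le_sum fun n _ ↦ idealMangoldt_le K n
    have h4 := Chebyshev.psi_sub_theta_le (x := x) (by linarith)
    have h5 : Real.log x ≤ 4 * x ^ (1 / 4 : ℝ) := by
      have := Real.log_le_rpow_div hx0.le (by norm_num : (0 : ℝ) < 1 / 4)
      linarith
    have h6 : x ^ (3 / 4 : ℝ) = √x * x ^ (1 / 4 : ℝ) := by
      rw [Real.sqrt_eq_rpow, ← Real.rpow_add hx0]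
      norm_num
    calc _ ≤ finrank ℚ K * (2 * √x * Real.log x) := h3.trans (by gcongr)
      _ ≤ finrank ℚ K * (2 * √x * (4 * x ^ (1 / 4 : ℝ))) := by gcongr
      _ = _ := by rw [h6]; ring
  refine (h1.sub h2).congr fun x _ ↦ ?_
  have h3 := Finset.sum_filter_add_sum_filter_not (Finset.Icc 1 ⌊x⌋₊) Nat.Prime
    (idealMangoldt K)
  rw [← h3]
  have h4 : ∑ p ∈ (Finset.Icc 1 ⌊x⌋₊).filter Nat.Prime, idealMangoldt K p =
      ∑ p ∈ (Finset.Icc 1 ⌊x⌋₊).filter Nat.Prime, (primeIdealCount K p : ℝ) * Real.log p :=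
    Finset.sum_congr rfl fun p hp ↦ idealMangoldt_prime K (Finset.mem_filter.1 hp).2
  rw [h4]
  ring

end IdealMangoldt

section FrobeniusCount

open NumberField Module

theorem Ideal.under_int_eq_span {R : Type*} [CommRing R] {P : Ideal R} (hP : P ≠ ⊤) {p : ℕ}
    (hp : p.Prime) (hpP : (p : R) ∈ P) : P.under ℤ = Ideal.span {(p : ℤ)} := by
  have hmax : (Ideal.span {(p : ℤ)}).IsMaximal :=
    PrincipalIdealRing.isMaximal_of_irreducible (Nat.prime_iff_prime_int.1 hp).irreducible
  refine (hmax.eq_of_le (Ideal.comap_ne_top _ hP) ?_).symm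
  rw [Ideal.span_singleton_le_iff_mem, Ideal.mem_comap]
  simpa using hpP

theorem Ideal.charP_quotient_of_mem {R : Type*} [CommRing R] {P : Ideal R} (hP : P ≠ ⊤) {p : ℕ}
    (hp : p.Prime) (hpP : (p : R) ∈ P) : CharP (R ⧸ P) p := by
  have : Nontrivial (R ⧸ P) := Ideal.Quotient.nontrivial_iff.2 hP
  refine (CharP.charP_iff_prime_eq_zero hp).2 ?_
  rw [← map_natCast (Ideal.Quotient.mk P), Ideal.Quotient.eq_zero_iff_mem]
  exact hpP

theorem Ideal.pow_sub_self_mem_iff {R : Type*} [CommRing R] {P : Ideal R} [P.IsMaximal] {p : ℕ}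
    (hp : p.Prime) (hpP : (p : R) ∈ P) (x : R) : x ^ p - x ∈ P ↔ ∃ n : ℤ, x - n ∈ P := by
  have := Ideal.charP_quotient_of_mem (Ideal.IsPrime.ne_top inferInstance) hp hpP
  have : Fact p.Prime := ⟨hp⟩
  let _ : Field (R ⧸ P) := Ideal.Quotient.field P
  have h1 := Subfield.mem_bot_iff_pow_eq_self (R ⧸ P) p (x := Ideal.Quotient.mk P x)
  rw [mem_bot_iff_intCast p] at h1
  rw [← Ideal.Quotient.eq, map_pow, ← h1]
  refine exists_congr fun n ↦ ?_
  rw [← Ideal.Quotient.eq, map_intCast, eq_comm]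

theorem absNorm_eq_prime_iff {L : Type*} [Field L] [NumberField L] {Q : Ideal (𝓞 L)} (hQ : Q ≠ ⊤)
    {p : ℕ} (hp : p.Prime) (hpQ : (p : 𝓞 L) ∈ Q) :
    Ideal.absNorm Q = p ↔ ∀ x : 𝓞 L, ∃ n : ℤ, x - n ∈ Q := by
  have : Fact p.Prime := ⟨hp⟩
  have := Ideal.charP_quotient_of_mem hQ hp hpQ
  have h0 : Q ≠ ⊥ := by
    rintro rfl
    exact hp.ne_zero (by simpa using hpQ)
  have : Finite (𝓞 L ⧸ Q) := Ideal.finiteQuotientOfFreeOfNeBot Q h0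
  have : Nontrivial (𝓞 L ⧸ Q) := Ideal.Quotient.nontrivial_iff.2 hQ
  rw [Ideal.absNorm_apply, Submodule.cardQuot_apply]
  have hinj := (ZMod.castHom (dvd_refl p) (𝓞 L ⧸ Q)).injective
  have hsurj : (∀ x : 𝓞 L, ∃ n : ℤ, x - n ∈ Q) ↔
      Function.Surjective (ZMod.castHom (dvd_refl p) (𝓞 L ⧸ Q)) := by
    constructor
    · intro h y
      obtain ⟨x, rfl⟩ := Ideal.Quotient.mk_surjective y
      obtain ⟨n, hn⟩ := h x
      exact ⟨n, by rw [map_intCast, ← map_intCast (Ideal.Quotient.mk Q), eq_comm,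
        Ideal.Quotient.eq]; exact hn⟩
    · intro h x
      obtain ⟨z, hz⟩ := h (Ideal.Quotient.mk Q x)
      obtain ⟨n, rfl⟩ := ZMod.intCast_surjective z
      refine ⟨n, ?_⟩
      rw [← Ideal.Quotient.eq, ← hz, map_intCast, map_intCast]
  rw [hsurj]
  constructor
  · intro h
    exact ((Nat.bijective_iff_injective_and_card _).2 ⟨hinj, by rw [Nat.card_zmod, h]⟩).2
  · intro h
    rw [← Nat.card_eq_of_bijective _ ⟨hinj, h⟩, Nat.card_zmod]

variable {K : Type*} [Field K] [NumberField K]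

/-- `σ` acts on `𝓞 K` modulo the maximal ideal `P` above `p` as the `p`-th power map. -/
structure IsFrobeniusAbove (p : ℕ) (P : Ideal (𝓞 K)) (σ : K ≃ₐ[ℚ] K) : Prop where
  prime : p.Prime
  isMaximal : P.IsMaximal
  mem : (p : 𝓞 K) ∈ P
  smul_sub_pow_mem : ∀ x : 𝓞 K, σ • x - x ^ p ∈ P

theorem exists_isFrobeniusAbove [IsGalois ℚ K] {p : ℕ} (hp : p.Prime) :
    ∃ (P : Ideal (𝓞 K)) (σ : K ≃ₐ[ℚ] K), IsFrobeniusAbove p P σ := by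
  have hmax : (Ideal.span {(p : ℤ)}).IsMaximal :=
    PrincipalIdealRing.isMaximal_of_irreducible (Nat.prime_iff_prime_int.1 hp).irreducible
  obtain ⟨P, hP, hPl⟩ :=
    Ideal.exists_maximal_ideal_liesOver_of_isIntegral (S := 𝓞 K) (Ideal.span {(p : ℤ)})
  have hmem : (p : 𝓞 K) ∈ P := by
    have h1 : (p : ℤ) ∈ P.under ℤ := hPl.over ▸ Ideal.mem_span_singleton_self _
    simpa [Ideal.mem_comap] using h1
  have h0 : P ≠ ⊥ := by
    rintro rfl
    exact hp.ne_zero (by simpa using hmem)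
  have : Finite (𝓞 K ⧸ P) := Ideal.finiteQuotientOfFreeOfNeBot P h0
  obtain ⟨σ, hσ⟩ := IsArithFrobAt.exists_of_isInvariant ℤ (K ≃ₐ[ℚ] K) P
  refine ⟨P, σ, hp, hP, hmem, fun x ↦ ?_⟩
  have h2 := hσ x
  rw [← hPl.over] at h2
  rwa [show Nat.card (ℤ ⧸ Ideal.span {(p : ℤ)}) = p by
    rw [Nat.card_congr (Int.quotientSpanNatEquivZMod p).toEquiv, Nat.card_zmod]] at h2

theorem exists_separating_nat (T : Finset (𝓞 K)) : ∃ N : ℕ, N ≠ 0 ∧ ∀ (p : ℕ) (P : Ideal (𝓞 K)),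
    p.Prime → P ≠ ⊤ → (p : 𝓞 K) ∈ P → ¬ p ∣ N → ∀ x ∈ T, ∀ y ∈ T, x - y ∈ P → x = y := by
  classical
  refine ⟨∏ z ∈ (T ×ˢ T).filter (fun z ↦ z.1 ≠ z.2), Ideal.absNorm (Ideal.span {z.1 - z.2}),
    ?_, ?_⟩
  · refine Finset.prod_ne_zero_iff.2 fun z hz ↦ ?_
    rw [Ne, Ideal.absNorm_eq_zero_iff, Ideal.span_singleton_eq_bot, sub_eq_zero]
    exact (Finset.mem_filter.1 hz).2
  · intro p P hp hP hpP hN x hx y hy hxy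
    by_contra hne
    refine hN (dvd_trans ?_ (Finset.dvd_prod_of_mem _
      (Finset.mem_filter.2 ⟨Finset.mk_mem_product hx hy, hne⟩)))
    have h1 : ((Ideal.absNorm (Ideal.span {x - y}) : ℕ) : 𝓞 K) ∈ P :=
      (Ideal.span_singleton_le_iff_mem P).2 hxy (Ideal.absNorm_mem _)
    have h2 : ((Ideal.absNorm (Ideal.span {x - y}) : ℕ) : ℤ) ∈ P.under ℤ := by
      rw [Ideal.mem_comap]
      simpa using h1
    rw [Ideal.under_int_eq_span hP hp hpP, Ideal.mem_span_singleton] at h2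
    exact Int.natCast_dvd_natCast.1 h2

namespace IsFrobeniusAbove

variable {p : ℕ} {P : Ideal (𝓞 K)} {σ : K ≃ₐ[ℚ] K}

theorem smul_sub_mem_iff (h : IsFrobeniusAbove p P σ) (x : 𝓞 K) :
    σ • x - x ∈ P ↔ ∃ n : ℤ, x - n ∈ P := by
  have := h.isMaximal
  rw [← Ideal.pow_sub_self_mem_iff h.prime h.mem, ← Ideal.add_mem_iff_right P (h.smul_sub_pow_mem x)
    (b := x ^ p - x)]
  ring_nf

end IsFrobeniusAbove

/-- The prime of an intermediate field `L` below the conjugate of `P` by `τ⁻¹`. -/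
noncomputable def conjugateUnder (L : IntermediateField ℚ K) (P : Ideal (𝓞 K)) (τ : K ≃ₐ[ℚ] K) :
    Ideal (𝓞 L) :=
  P.comap ((MulSemiringAction.toRingHom (K ≃ₐ[ℚ] K) (𝓞 K) τ).comp (algebraMap (𝓞 L) (𝓞 K)))

theorem mem_conjugateUnder {L : IntermediateField ℚ K} {P : Ideal (𝓞 K)} {τ : K ≃ₐ[ℚ] K}
    {x : 𝓞 L} : x ∈ conjugateUnder L P τ ↔ τ • algebraMap (𝓞 L) (𝓞 K) x ∈ P := Iff.rfl

theorem smul_algebraMap_sub_intCast (L : IntermediateField ℚ K) (τ : K ≃ₐ[ℚ] K) (x : 𝓞 L) (n : ℤ) :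
    τ • algebraMap (𝓞 L) (𝓞 K) (x - n) = τ • algebraMap (𝓞 L) (𝓞 K) x - n := by
  have := map_sub ((MulSemiringAction.toRingHom (K ≃ₐ[ℚ] K) (𝓞 K) τ).comp
    (algebraMap (𝓞 L) (𝓞 K))) x n
  rw [map_intCast] at this
  exact this

theorem smul_algebraMap_eq_iff (H : Subgroup (K ≃ₐ[ℚ] K)) {τ τ' : K ≃ₐ[ℚ] K} :
    (∀ x : 𝓞 (IntermediateField.fixedField H),
      τ • algebraMap (𝓞 (IntermediateField.fixedField H)) (𝓞 K) x =
        τ' • algebraMap (𝓞 (IntermediateField.fixedField H)) (𝓞 K) x) ↔ τ⁻¹ * τ' ∈ H := by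
  set L := IntermediateField.fixedField H with hL
  have h1 : (∀ x : 𝓞 L, τ • algebraMap (𝓞 L) (𝓞 K) x = τ' • algebraMap (𝓞 L) (𝓞 K) x) ↔
      ∀ x : L, τ x = τ' x := by
    constructor
    · intro h x
      obtain ⟨a, b, hb, rfl⟩ := IsFractionRing.div_surjective (A := 𝓞 L) x
      have ha' := congrArg (algebraMap (𝓞 K) K) (h a)
      have hb' := congrArg (algebraMap (𝓞 K) K) (h b)
      change τ ((a : L) : K) = τ' ((a : L) : K) at ha'
      change τ ((b : L) : K) = τ' ((b : L) : K) at hb'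
      change τ (((a : L) / (b : L) : L) : K) = τ' (((a : L) / (b : L) : L) : K)
      push_cast
      rw [map_div₀, map_div₀, ha', hb']
    · intro h x
      exact RingOfIntegers.ext (h (x : L))
  rw [h1, ← IntermediateField.fixingSubgroup_fixedField H, IntermediateField.mem_fixingSubgroup_iff]
  constructor
  · intro h x hx
    have := h ⟨x, hx⟩
    rw [AlgEquiv.mul_apply, ← this, ← AlgEquiv.mul_apply, inv_mul_cancel, AlgEquiv.one_apply]
  · intro h x
    have := h x x.2
    rw [AlgEquiv.mul_apply] at this
    have h2 := congrArg τ this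
    rw [← AlgEquiv.mul_apply, mul_inv_cancel, AlgEquiv.one_apply] at h2
    exact h2.symm

theorem exists_separating_nat_fixedField (H : Subgroup (K ≃ₐ[ℚ] K)) : ∃ N : ℕ, N ≠ 0 ∧
    ∀ (p : ℕ) (P : Ideal (𝓞 K)), p.Prime → P ≠ ⊤ → (p : 𝓞 K) ∈ P → ¬ p ∣ N →
      ∀ τ τ' : K ≃ₐ[ℚ] K, (∀ x : 𝓞 (IntermediateField.fixedField H),
        τ • algebraMap (𝓞 (IntermediateField.fixedField H)) (𝓞 K) x -
          τ' • algebraMap (𝓞 (IntermediateField.fixedField H)) (𝓞 K) x ∈ P) → τ⁻¹ * τ' ∈ H := by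
  classical
  set L := IntermediateField.fixedField H with hL
  have : Fintype (K ≃ₐ[ℚ] K) := Fintype.ofFinite _
  let b := RingOfIntegers.basis L
  obtain ⟨N, hN, h⟩ := exists_separating_nat
    ((Finset.univ : Finset ((K ≃ₐ[ℚ] K) × _)).image
      fun z ↦ z.1 • algebraMap (𝓞 L) (𝓞 K) (b z.2))
  refine ⟨N, hN, fun p P hp hP hpP hpN τ τ' hτ ↦ (smul_algebraMap_eq_iff H).1 fun x ↦ ?_⟩
  have h1 : ((MulSemiringAction.toRingHom (K ≃ₐ[ℚ] K) (𝓞 K) τ).comp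
      (algebraMap (𝓞 L) (𝓞 K))).toIntAlgHom.toLinearMap =
      ((MulSemiringAction.toRingHom (K ≃ₐ[ℚ] K) (𝓞 K) τ').comp
      (algebraMap (𝓞 L) (𝓞 K))).toIntAlgHom.toLinearMap := by
    refine b.ext fun i ↦ ?_
    exact h p P hp hP hpP hpN _ (Finset.mem_image.2 ⟨(τ, i), Finset.mem_univ _, rfl⟩) _
      (Finset.mem_image.2 ⟨(τ', i), Finset.mem_univ _, rfl⟩) (hτ (b i))
  exact LinearMap.congr_fun h1 x

theorem IsFrobeniusAbove.absNorm_conjugateUnder_iff {p : ℕ} {P : Ideal (𝓞 K)} {σ : K ≃ₐ[ℚ] K}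
    (h : IsFrobeniusAbove p P σ) (L : IntermediateField ℚ K) (τ : K ≃ₐ[ℚ] K) :
    Ideal.absNorm (conjugateUnder L P τ) = p ↔
      ∀ x : 𝓞 L, τ • algebraMap (𝓞 L) (𝓞 K) x - (σ * τ) • algebraMap (𝓞 L) (𝓞 K) x ∈ P := by
  have := h.isMaximal
  have htop : conjugateUnder L P τ ≠ ⊤ := Ideal.comap_ne_top _ (Ideal.IsPrime.ne_top inferInstance)
  have hmem : (p : 𝓞 L) ∈ conjugateUnder L P τ := by
    rw [mem_conjugateUnder, map_natCast]
    have h1 : τ • (p : 𝓞 K) = p :=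
      map_natCast (MulSemiringAction.toRingHom (K ≃ₐ[ℚ] K) (𝓞 K) τ) p
    rw [h1]
    exact h.mem
  rw [absNorm_eq_prime_iff htop h.prime hmem]
  refine forall_congr' fun x ↦ ?_
  rw [mul_smul, ← neg_mem_iff, neg_sub, h.smul_sub_mem_iff]
  refine exists_congr fun n ↦ ?_
  rw [mem_conjugateUnder, smul_algebraMap_sub_intCast]

theorem exists_conjugateUnder_eq [IsGalois ℚ K] (L : IntermediateField ℚ K) {p : ℕ} (hp : p.Prime)
    {P : Ideal (𝓞 K)} [P.IsMaximal] (hpP : (p : 𝓞 K) ∈ P) {Q : Ideal (𝓞 L)} [Q.IsPrime]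
    (hpQ : (p : 𝓞 L) ∈ Q) : ∃ τ, conjugateUnder L P τ = Q := by
  have h0 : Q ≠ ⊥ := by
    rintro rfl
    exact hp.ne_zero (by simpa using hpQ)
  have : Q.IsMaximal := Ideal.IsPrime.isMaximal inferInstance h0
  obtain ⟨Q', hQ', hl⟩ := Ideal.exists_maximal_ideal_liesOver_of_isIntegral (S := 𝓞 K) Q
  have hpQ' : (p : 𝓞 K) ∈ Q' := by
    have : (p : 𝓞 L) ∈ Q'.under (𝓞 L) := hl.over ▸ hpQ
    simpa [Ideal.mem_comap] using this
  obtain ⟨τ, hτ⟩ := Algebra.IsInvariant.exists_smul_of_under_eq ℤ (𝓞 K) (K ≃ₐ[ℚ] K) Q' P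
    ((Ideal.under_int_eq_span (Ideal.IsPrime.ne_top inferInstance) hp hpQ').trans
      (Ideal.under_int_eq_span (Ideal.IsPrime.ne_top inferInstance) hp hpP).symm)
  refine ⟨τ, ?_⟩
  ext x
  rw [mem_conjugateUnder, hτ, Ideal.smul_mem_pointwise_smul_iff, hl.over]
  rfl

open scoped Classical in
/-- The number of `τ` with `τ⁻¹ * σ * τ ∈ H` is `#H` times the number of primes of norm `p` in the
fixed field of `H`, when `σ` is a Frobenius at `p` and `p` avoids finitely many primes. -/
theorem exists_card_conj_mem_eq [IsGalois ℚ K] (H : Subgroup (K ≃ₐ[ℚ] K)) [Fintype (K ≃ₐ[ℚ] K)] :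
    ∃ N : ℕ, N ≠ 0 ∧ ∀ (p : ℕ) (P : Ideal (𝓞 K)) (σ : K ≃ₐ[ℚ] K), IsFrobeniusAbove p P σ →
      ¬ p ∣ N → (Finset.univ.filter fun τ : K ≃ₐ[ℚ] K ↦ τ⁻¹ * σ * τ ∈ H).card =
        Nat.card H * primeIdealCount (IntermediateField.fixedField H) p := by
  set L := IntermediateField.fixedField H with hL
  obtain ⟨N, hN, hsep⟩ := exists_separating_nat_fixedField H
  refine ⟨N, hN, fun p P σ h hpN ↦ ?_⟩
  have hmax := h.isMaximal
  have hsep' := hsep p P h.prime (Ideal.IsPrime.ne_top inferInstance) h.mem hpN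
  have hnorm : ∀ τ, Ideal.absNorm (conjugateUnder L P τ) = p ↔ τ⁻¹ * σ * τ ∈ H := by
    intro τ
    rw [h.absNorm_conjugateUnder_iff, mul_assoc]
    refine ⟨fun h1 ↦ hsep' _ _ h1, fun h1 x ↦ ?_⟩
    rw [(smul_algebraMap_eq_iff H).2 h1 x, sub_self]
    exact zero_mem _
  have hprime : ∀ τ, (conjugateUnder L P τ).IsPrime := fun τ ↦ Ideal.comap_isPrime _ _
  rw [primeIdealCount]
  have hmaps : ∀ τ ∈ Finset.univ.filter (fun τ : K ≃ₐ[ℚ] K ↦ τ⁻¹ * σ * τ ∈ H),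
      conjugateUnder L P τ ∈ (idealsOfNorm L p).filter Prime := by
    intro τ hτ
    have h1 := (hnorm τ).2 (Finset.mem_filter.1 hτ).2
    refine Finset.mem_filter.2 ⟨mem_idealsOfNorm.2 h1, ?_⟩
    refine Ideal.prime_of_isPrime ?_ (hprime τ)
    intro h0
    rw [h0, Ideal.absNorm_bot] at h1
    exact h.prime.ne_zero h1.symm
  rw [Finset.card_eq_sum_card_fiberwise hmaps, mul_comm]
  refine Finset.sum_const_nat fun Q hQ ↦ ?_
  obtain ⟨hQ1, hQ2⟩ := Finset.mem_filter.1 hQ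
  have hQn := mem_idealsOfNorm.1 hQ1
  have := Ideal.isPrime_of_prime hQ2
  have hpQ : (p : 𝓞 L) ∈ Q := hQn ▸ Ideal.absNorm_mem Q
  obtain ⟨τ₀, rfl⟩ := exists_conjugateUnder_eq L h.prime h.mem hpQ
  have hτ₀ := (hnorm τ₀).1 hQn
  rw [Nat.card_eq_fintype_card, ← Finset.card_univ,
    ← Finset.card_map ⟨fun x : H ↦ τ₀ * x, fun x y hxy ↦ Subtype.ext (mul_left_cancel hxy)⟩]
  congr 1
  ext τ
  simp only [Finset.mem_filter, Finset.mem_univ, true_and, Finset.mem_map,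
    Subtype.exists]
  constructor
  · rintro ⟨h1, h2⟩
    refine ⟨τ₀⁻¹ * τ, hsep' _ _ fun x ↦ ?_, mul_inv_cancel_left _ _⟩
    have hlow := (absNorm_eq_prime_iff (hprime τ₀).ne_top h.prime hpQ).1 hQn
    obtain ⟨n, hn⟩ := hlow x
    have hn' := hn
    rw [← h2] at hn'
    rw [mem_conjugateUnder, smul_algebraMap_sub_intCast] at hn hn'
    have := sub_mem hn hn'
    rwa [sub_sub_sub_cancel_right] at this
  · rintro ⟨g, hg, rfl⟩
    have h3 : conjugateUnder L P (τ₀ * g) = conjugateUnder L P τ₀ := by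
      ext x
      rw [mem_conjugateUnder, mem_conjugateUnder,
        (smul_algebraMap_eq_iff H (τ := τ₀) (τ' := τ₀ * g)).2 (by simpa using hg) x]
    exact ⟨(hnorm _).1 (h3 ▸ hQn), h3⟩

end FrobeniusCount

section RootsModP

open NumberField Polynomial

theorem exists_multiset_map_algebraMap_eq {K : Type*} [Field K] (s : Multiset K)
    (hs : ∀ x ∈ s, IsIntegral ℤ x) :
    ∃ B : Multiset (𝓞 K), B.map (algebraMap (𝓞 K) K) = s := by
  induction s using Multiset.induction with
  | empty => exact ⟨0, rfl⟩
  | cons a s ih =>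
    obtain ⟨B, hB⟩ := ih fun x hx ↦ hs x (Multiset.mem_cons_of_mem hx)
    obtain ⟨b, rfl⟩ := IsIntegralClosure.isIntegral_iff (A := 𝓞 K) |>.1
      (hs a (Multiset.mem_cons_self _ _))
    exact ⟨b ::ₘ B, by rw [Multiset.map_cons, hB]⟩

variable {K : Type*} [Field K] [NumberField K]

/-- The integral elements `c * α`, with `c` the leading coefficient and `α` a root of `f`. -/
theorem exists_scaled_roots {f : ℤ[X]} (hf : f ≠ 0) (hs : (f.map (algebraMap ℤ K)).Splits) :
    ∃ B : Multiset (𝓞 K),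
      (∀ σ : K ≃ₐ[ℚ] K, (∃ β ∈ B, σ • β = β) ↔
        ∃ α ∈ (f.map (Int.castRingHom ℚ)).rootSet K, σ α = α) ∧
      ∃ d : ℕ, ∀ m : ℤ, ((f.leadingCoeff ^ d * f.eval m : ℤ) : 𝓞 K) =
        f.leadingCoeff * (B.map fun β ↦ ((f.leadingCoeff * m : ℤ) : 𝓞 K) - β).prod := by
  set c := f.leadingCoeff with hc
  have hc0 : (c : K) ≠ 0 := by
    exact_mod_cast leadingCoeff_ne_zero.2 hf
  set F := f.map (algebraMap ℤ K) with hF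
  have hF0 : F ≠ 0 := (Polynomial.map_ne_zero_iff (algebraMap ℤ K).injective_int).2 hf
  have hinteg : ∀ x ∈ F.roots.map (fun α ↦ (c : K) * α), IsIntegral ℤ x := by
    intro x hx
    obtain ⟨α, hα, rfl⟩ := Multiset.mem_map.1 hx
    have h1 : aeval α f = 0 := by
      rw [aeval_def, ← eval_map]
      exact (mem_roots hF0).1 hα
    simpa using isIntegral_leadingCoeff_smul f α h1
  obtain ⟨B, hB⟩ := exists_multiset_map_algebraMap_eq _ hinteg
  have hmem : ∀ α : K, α ∈ (f.map (Int.castRingHom ℚ)).rootSet K ↔ α ∈ F.roots := by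
    intro α
    have h2 : f.map (Int.castRingHom ℚ) ≠ 0 :=
      (Polynomial.map_ne_zero_iff (Int.castRingHom ℚ).injective_int).2 hf
    rw [mem_rootSet, mem_roots hF0, IsRoot, hF, eval_map_algebraMap, aeval_def, eval₂_map,
      aeval_def, Subsingleton.elim ((algebraMap ℚ K).comp (Int.castRingHom ℚ)) (algebraMap ℤ K)]
    exact and_iff_right h2
  refine ⟨B, fun σ ↦ ⟨?_, ?_⟩, Multiset.card F.roots, fun m ↦ ?_⟩
  · rintro ⟨β, hβ, hσ⟩
    obtain ⟨α, hα, hαβ⟩ := Multiset.mem_map.1 (hB ▸ Multiset.mem_map_of_mem _ hβ)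
    refine ⟨α, (hmem α).2 hα, ?_⟩
    have h1 : σ (algebraMap (𝓞 K) K β) = algebraMap (𝓞 K) K β := congrArg (algebraMap (𝓞 K) K) hσ
    rw [← hαβ, map_mul, map_intCast] at h1
    exact mul_left_cancel₀ hc0 h1
  · rintro ⟨α, hα, hσ⟩
    have h1 : (c : K) * α ∈ B.map (algebraMap (𝓞 K) K) :=
      hB ▸ Multiset.mem_map_of_mem _ ((hmem α).1 hα)
    obtain ⟨β, hβ, hαβ⟩ := Multiset.mem_map.1 h1
    refine ⟨β, hβ, RingOfIntegers.ext ?_⟩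
    change σ (algebraMap (𝓞 K) K β) = algebraMap (𝓞 K) K β
    rw [hαβ, map_mul, map_intCast, hσ]
  · apply RingOfIntegers.ext
    change algebraMap (𝓞 K) K _ = algebraMap (𝓞 K) K _
    rw [map_mul, map_intCast, map_multiset_prod, Multiset.map_map]
    have h1 : (B.map (algebraMap (𝓞 K) K ∘ fun β ↦ ((c * m : ℤ) : 𝓞 K) - β)) =
        (B.map (algebraMap (𝓞 K) K)).map (fun y ↦ (c : K) * m - y) := by
      rw [Multiset.map_map]
      refine Multiset.map_congr rfl fun β _ ↦ ?_
      simp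
    have h2 : ((f.eval m : ℤ) : K) = F.eval (m : K) := by
      rw [hF, eval_intCast_map]
      simp
    have h3 : F.leadingCoeff = c := by
      rw [hF, leadingCoeff_map_of_injective (algebraMap ℤ K).injective_int]
      simp [hc]
    rw [h1, hB, Multiset.map_map, map_intCast]
    push_cast
    rw [h2, hs.eval_eq_prod_roots, h3]
    have h4 : ((fun y ↦ (c : K) * m - y) ∘ fun α ↦ (c : K) * α) = fun α ↦ (c : K) * (m - α) := by
      funext α
      simp only [Function.comp]
      ring
    rw [h4, Multiset.prod_map_mul, Multiset.map_const', Multiset.prod_replicate]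
    ring

/-- For all but finitely many primes `p`, `f` has a root modulo `p` exactly when a Frobenius at `p`
fixes a root of `f`. -/
theorem exists_dvd_eval_iff_frobenius_fixes {f : ℤ[X]} (hf : f ≠ 0)
    (hs : (f.map (algebraMap ℤ K)).Splits) :
    ∃ N : ℕ, N ≠ 0 ∧ ∀ (p : ℕ) (P : Ideal (𝓞 K)) (σ : K ≃ₐ[ℚ] K), IsFrobeniusAbove p P σ →
      ¬ p ∣ N → ((∃ n : ℕ, 0 < n ∧ (p : ℤ) ∣ f.eval (n : ℤ)) ↔
        ∃ α ∈ (f.map (Int.castRingHom ℚ)).rootSet K, σ α = α) := by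
  classical
  have : Fintype (K ≃ₐ[ℚ] K) := Fintype.ofFinite _
  obtain ⟨B, hB, d, hd⟩ := exists_scaled_roots hf hs
  set c := f.leadingCoeff with hc
  have hc0 : c ≠ 0 := leadingCoeff_ne_zero.2 hf
  obtain ⟨N, hN, hsep⟩ := exists_separating_nat
    (((Finset.univ : Finset (K ≃ₐ[ℚ] K)) ×ˢ B.toFinset).image fun z ↦ z.1 • z.2)
  refine ⟨c.natAbs * N, mul_ne_zero (Int.natAbs_ne_zero.2 hc0) hN, fun p P σ h hpN ↦ ?_⟩
  have hmax := h.isMaximal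
  have htop : P ≠ ⊤ := Ideal.IsPrime.ne_top inferInstance
  have hpc : ¬ (p : ℤ) ∣ c := fun h1 ↦ hpN (dvd_mul_of_dvd_left (Int.natCast_dvd.1 h1) _)
  have hpN' : ¬ p ∣ N := fun h1 ↦ hpN (dvd_mul_of_dvd_right h1 _)
  have hpp : Prime (p : ℤ) := Nat.prime_iff_prime_int.1 h.prime
  have hcast : ∀ a : ℤ, (a : 𝓞 K) ∈ P ↔ (p : ℤ) ∣ a := by
    intro a
    rw [← Ideal.mem_span_singleton, ← Ideal.under_int_eq_span htop h.prime h.mem, Ideal.mem_comap]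
    simp
  have hfix : ∀ β ∈ B, (σ • β = β ↔ ∃ n : ℤ, β - n ∈ P) := by
    intro β hβ
    rw [← h.smul_sub_mem_iff]
    refine ⟨fun h1 ↦ by rw [h1, sub_self]; exact zero_mem _, fun h1 ↦ ?_⟩
    refine hsep p P h.prime htop h.mem hpN' _ ?_ _ ?_ h1
    · exact Finset.mem_image.2 ⟨(σ, β), Finset.mk_mem_product (Finset.mem_univ _)
        (Multiset.mem_toFinset.2 hβ), rfl⟩
    · exact Finset.mem_image.2 ⟨(1, β), Finset.mk_mem_product (Finset.mem_univ _)
        (Multiset.mem_toFinset.2 hβ), one_smul _ _⟩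
  have hdvd : ∀ m : ℤ, (p : ℤ) ∣ f.eval m ↔ ∃ β ∈ B, ((c * m : ℤ) : 𝓞 K) - β ∈ P := by
    intro m
    have h1 : (p : ℤ) ∣ f.eval m ↔ (p : ℤ) ∣ c ^ d * f.eval m := by
      rw [hpp.dvd_mul, or_iff_right fun h2 ↦ hpc (hpp.dvd_of_dvd_pow h2)]
    rw [h1, ← hcast, hd, Ideal.IsPrime.mul_mem_iff_mem_or_mem inferInstance, hcast,
      or_iff_right hpc, Ideal.IsPrime.multiset_prod_mem_iff_exists_mem inferInstance]
    simp only [Multiset.mem_map, exists_exists_and_eq_and]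
  rw [← hB]
  constructor
  · rintro ⟨n, -, hn⟩
    obtain ⟨β, hβ, h1⟩ := (hdvd n).1 hn
    refine ⟨β, hβ, (hfix β hβ).2 ⟨c * n, ?_⟩⟩
    rw [← neg_mem_iff, neg_sub]
    exact h1
  · rintro ⟨β, hβ, h1⟩
    obtain ⟨n, hn⟩ := (hfix β hβ).1 h1
    obtain ⟨u, v, huv⟩ := (Prime.coprime_iff_not_dvd hpp).2 hpc
    set m : ℤ := (v * n) % p + p with hm
    have hp0 : (0 : ℤ) < p := by exact_mod_cast h.prime.pos
    have hm0 : 0 < m := add_pos_of_nonneg_of_pos (Int.emod_nonneg _ hp0.ne') hp0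
    have hcm : (p : ℤ) ∣ c * m - n := by
      refine ⟨c * (1 - (v * n) / p) - u * n, ?_⟩
      have h3 := Int.emod_def (v * n) p
      rw [hm, h3]
      linear_combination n * huv
    refine ⟨m.toNat, by omega, ?_⟩
    rw [Int.toNat_of_nonneg hm0.le]
    refine (hdvd m).2 ⟨β, hβ, ?_⟩
    have h4 := sub_mem ((hcast _).2 hcm) hn
    push_cast at h4 ⊢
    rwa [sub_sub_sub_cancel_right] at h4

end RootsModP

section SubgroupIndicator

open scoped Classical

variable {G : Type*} [Group G] [Fintype G]

/-- The number of `τ` such that `τ⁻¹ * g * τ` lies in `H`. -/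
noncomputable def conjMemCount (H : Subgroup G) (g : G) : ℝ :=
  ((Finset.univ.filter fun τ : G ↦ τ⁻¹ * g * τ ∈ H).card : ℝ)

/-- The number of `τ` such that `τ⁻¹ * g * τ` generates `H`. -/
noncomputable def conjGeneratesCount (H : Subgroup G) (g : G) : ℝ :=
  ((Finset.univ.filter fun τ : G ↦ Subgroup.zpowers (τ⁻¹ * g * τ) = H).card : ℝ)

theorem sum_conjMemCount (H : Subgroup G) :
    ∑ g, conjMemCount H g = Nat.card H * Nat.card G := by
  simp only [conjMemCount, Finset.card_filter]
  push_cast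
  rw [Finset.sum_comm]
  have h : ∀ τ : G, ∑ g : G, (if τ⁻¹ * g * τ ∈ H then (1 : ℝ) else 0) = Nat.card H := by
    intro τ
    rw [← Equiv.sum_comp (MulAut.conj τ).toEquiv, Finset.sum_boole,
      Nat.card_eq_fintype_card, Fintype.card_subtype]
    congr 3
    ext g
    simp [mul_assoc]
  rw [Finset.sum_congr rfl fun τ _ ↦ h τ, Finset.sum_const, Finset.card_univ,
    Nat.card_eq_fintype_card (α := G), nsmul_eq_mul, mul_comm]

theorem sum_conjGeneratesCount (s : Finset (Subgroup G)) (g : G) :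
    ∑ C ∈ s, conjGeneratesCount C g =
      ((Finset.univ.filter fun τ : G ↦ Subgroup.zpowers (τ⁻¹ * g * τ) ∈ s).card : ℝ) := by
  simp only [conjGeneratesCount, Finset.card_filter]
  push_cast
  rw [Finset.sum_comm]
  refine Finset.sum_congr rfl fun τ _ ↦ ?_
  rw [Finset.sum_ite_eq]

theorem conjGeneratesCount_mem (M : Submodule ℝ (G → ℝ)) (hM : ∀ H, conjMemCount H ∈ M)
    (H : Subgroup G) : conjGeneratesCount H ∈ M := by
  have : Fintype (Subgroup G) := Fintype.ofFinite _
  induction H using WellFoundedLT.induction with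
  | ind H ih =>
    have h1 : conjGeneratesCount H = conjMemCount H -
        ∑ C ∈ Finset.univ.filter (fun C : Subgroup G ↦ C < H), conjGeneratesCount C := by
      rw [eq_sub_iff_add_eq, ← Finset.sum_insert (by simp)]
      funext g
      rw [Finset.sum_apply, sum_conjGeneratesCount, conjMemCount]
      congr 2
      refine Finset.filter_congr fun τ _ ↦ ?_
      simp [← le_iff_eq_or_lt, Subgroup.zpowers_le]
    rw [h1]
    exact sub_mem (hM H) (sum_mem fun C hC ↦ ih C (Finset.mem_filter.1 hC).2)

/-- The indicator function of a set closed under conjugation, and under passing to another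
generator of the same cyclic group, is a combination of the functions `conjMemCount H`. -/
theorem indicator_mem_of_conjMemCount_mem (M : Submodule ℝ (G → ℝ))
    (hM : ∀ H, conjMemCount H ∈ M) (S : Set G) (hconj : ∀ g τ : G, g ∈ S → τ⁻¹ * g * τ ∈ S)
    (hgen : ∀ g g' : G, Subgroup.zpowers g = Subgroup.zpowers g' → g ∈ S → g' ∈ S) :
    S.indicator 1 ∈ M := by
  have : Fintype (Subgroup G) := Fintype.ofFinite _
  have h0 : (Nat.card G : ℝ) ≠ 0 := by exact_mod_cast Nat.card_pos.ne'
  have h1 : S.indicator (1 : G → ℝ) = (Nat.card G : ℝ)⁻¹ •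
      ∑ C ∈ Finset.univ.filter (fun C : Subgroup G ↦ ∃ s ∈ S, Subgroup.zpowers s = C),
        conjGeneratesCount C := by
    rw [eq_inv_smul_iff₀ h0]
    funext g
    rw [Finset.sum_apply, sum_conjGeneratesCount, Pi.smul_apply]
    have h2 : ∀ τ : G, Subgroup.zpowers (τ⁻¹ * g * τ) ∈
        Finset.univ.filter (fun C : Subgroup G ↦ ∃ s ∈ S, Subgroup.zpowers s = C) ↔ g ∈ S := by
      intro τ
      rw [Finset.mem_filter, and_iff_right (Finset.mem_univ _)]
      constructor
      · rintro ⟨s, hs, h3⟩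
        have := hconj _ τ⁻¹ (hgen _ _ h3 hs)
        simpa [mul_assoc] using this
      · exact fun h ↦ ⟨_, hconj g τ h, rfl⟩
    simp only [h2]
    by_cases hg : g ∈ S
    · simp [hg, Nat.card_eq_fintype_card]
    · simp [hg]
  rw [h1]
  exact M.smul_mem _ (sum_mem fun C _ ↦ conjGeneratesCount_mem M hM C)

end SubgroupIndicator

section FrobeniusDensity

open NumberField Polynomial

open scoped Classical

/-- The sum of `w p * log p` over the primes `p ≤ x`. -/
noncomputable def weightedTheta (w : ℕ → ℝ) (x : ℝ) : ℝ :=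
  ∑ p ∈ (Finset.Icc 1 ⌊x⌋₊).filter Nat.Prime, w p * Real.log p

theorem isVallePoussinSmall_weightedTheta_congr {w w' : ℕ → ℝ} {m : ℝ} {N : ℕ} (hN : N ≠ 0)
    (h : IsVallePoussinSmall fun x ↦ weightedTheta w x - m * x)
    (hw : ∀ p : ℕ, p.Prime → ¬ p ∣ N → w' p = w p) :
    IsVallePoussinSmall fun x ↦ weightedTheta w' x - m * x := by
  have h1 : IsVallePoussinSmall fun x ↦ weightedTheta w' x - weightedTheta w x := by
    refine IsVallePoussinSmall.of_bounded
      (M := ∑ p ∈ N.divisors, |(w' p - w p) * Real.log p|) fun x _ ↦ ?_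
    rw [weightedTheta, weightedTheta, ← Finset.sum_sub_distrib]
    simp only [← sub_mul]
    refine (Finset.abs_sum_le_sum_abs _ _).trans ?_
    rw [← Finset.sum_filter_add_sum_filter_not _ (fun p ↦ p ∣ N)]
    have h2 : ∑ p ∈ ((Finset.Icc 1 ⌊x⌋₊).filter Nat.Prime).filter (fun p ↦ ¬ p ∣ N),
        |(w' p - w p) * Real.log p| = 0 := by
      refine Finset.sum_eq_zero fun p hp ↦ ?_
      obtain ⟨hp1, hp2⟩ := Finset.mem_filter.1 hp
      rw [hw p (Finset.mem_filter.1 hp1).2 hp2]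
      simp
    rw [h2, add_zero]
    refine Finset.sum_le_sum_of_subset_of_nonneg (fun p hp ↦ ?_) fun _ _ _ ↦ abs_nonneg _
    exact Nat.mem_divisors.2 ⟨(Finset.mem_filter.1 hp).2, hN⟩
  exact (h.add h1).congr fun x _ ↦ by ring

/-- The functions on a finite group `G` whose values at `σ p` have, on average over the primes,
the same mean as over `G`. -/
noncomputable def equidistributed {G : Type*} [Fintype G] (σ : ℕ → G) : Submodule ℝ (G → ℝ) where
  carrier := {φ | IsVallePoussinSmall fun x ↦
    weightedTheta (fun p ↦ φ (σ p)) x - (∑ g, φ g) / Nat.card G * x}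
  add_mem' {φ ψ} hφ hψ := by
    refine (IsVallePoussinSmall.add hφ hψ).congr fun x _ ↦ ?_
    simp only [weightedTheta, Pi.add_apply, add_mul, Finset.sum_add_distrib]
    ring
  zero_mem' := by
    refine IsVallePoussinSmall.zero.congr fun x _ ↦ ?_
    simp [weightedTheta]
  smul_mem' c φ hφ := by
    refine (IsVallePoussinSmall.const_mul hφ c).congr fun x _ ↦ ?_
    simp only [weightedTheta, Pi.smul_apply, smul_eq_mul, mul_assoc, ← Finset.mul_sum]
    ring

variable {K : Type*} [Field K] [NumberField K] [IsGalois ℚ K] [Fintype (K ≃ₐ[ℚ] K)]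

theorem conjMemCount_mem_equidistributed {σ : ℕ → K ≃ₐ[ℚ] K}
    (hσ : ∀ p : ℕ, p.Prime → ∃ P : Ideal (𝓞 K), IsFrobeniusAbove p P (σ p))
    (H : Subgroup (K ≃ₐ[ℚ] K)) : conjMemCount H ∈ equidistributed σ := by
  obtain ⟨N, hN, h⟩ := exists_card_conj_mem_eq H
  have h0 : (Nat.card (K ≃ₐ[ℚ] K) : ℝ) ≠ 0 := by exact_mod_cast Nat.card_pos.ne'
  change IsVallePoussinSmall fun x ↦ weightedTheta (fun p ↦ conjMemCount H (σ p)) x -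
    (∑ g, conjMemCount H g) / Nat.card (K ≃ₐ[ℚ] K) * x
  rw [sum_conjMemCount, mul_div_cancel_right₀ _ h0]
  refine isVallePoussinSmall_weightedTheta_congr
    (w := fun p ↦ Nat.card H * (primeIdealCount (IntermediateField.fixedField H) p : ℝ)) hN ?_ ?_
  · refine ((isVallePoussinSmall_primeIdealCount (IntermediateField.fixedField H)).const_mul
      (Nat.card H)).congr fun x _ ↦ ?_
    simp only [weightedTheta, mul_assoc, ← Finset.mul_sum]
    ring
  · intro p hp hpN
    obtain ⟨P, hP⟩ := hσ p hp
    simp only [conjMemCount]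
    rw [← Nat.cast_mul, ← h p P (σ p) hP hpN]

theorem isVallePoussinSmall_weightedTheta_dvd_eval {f : ℤ[X]} (hf : f ≠ 0)
    (hs : (f.map (algebraMap ℤ K)).Splits) :
    IsVallePoussinSmall fun x ↦
      weightedTheta (fun p ↦ if ∃ n : ℕ, 0 < n ∧ (p : ℤ) ∣ f.eval (n : ℤ) then 1 else 0) x -
        (Nat.card {σ : K ≃ₐ[ℚ] K | ∃ α ∈ (f.map (Int.castRingHom ℚ)).rootSet K, σ α = α} : ℝ) /
          (Nat.card (K ≃ₐ[ℚ] K) : ℝ) * x := by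
  have hex : ∀ p : ℕ, ∃ τ : K ≃ₐ[ℚ] K, p.Prime → ∃ P : Ideal (𝓞 K), IsFrobeniusAbove p P τ := by
    intro p
    by_cases hp : p.Prime
    · obtain ⟨P, τ, h⟩ := exists_isFrobeniusAbove (K := K) hp
      exact ⟨τ, fun _ ↦ ⟨P, h⟩⟩
    · exact ⟨1, fun h ↦ absurd h hp⟩
  choose σ hσ using hex
  set S : Set (K ≃ₐ[ℚ] K) := {σ | ∃ α ∈ (f.map (Int.castRingHom ℚ)).rootSet K, σ α = α} with hS
  have hmem : S.indicator 1 ∈ equidistributed σ := by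
    refine indicator_mem_of_conjMemCount_mem _ (conjMemCount_mem_equidistributed hσ) S ?_ ?_
    · rintro g τ ⟨α, hα, h⟩
      refine ⟨τ⁻¹ α, ?_, ?_⟩
      · rw [mem_rootSet] at hα ⊢
        refine ⟨hα.1, ?_⟩
        have := aeval_algHom_apply (τ⁻¹ : K ≃ₐ[ℚ] K).toAlgHom α (f.map (Int.castRingHom ℚ))
        rw [hα.2, map_zero] at this
        exact this
      · rw [← AlgEquiv.mul_apply, mul_assoc, mul_inv_cancel, mul_one, AlgEquiv.mul_apply, h]
    · rintro g g' hg ⟨α, hα, h⟩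
      refine ⟨α, hα, ?_⟩
      have h1 : Subgroup.zpowers g ≤ MulAction.stabilizer (K ≃ₐ[ℚ] K) α :=
        (Subgroup.zpowers_le).2 (MulAction.mem_stabilizer_iff.2 h)
      exact h1 (hg ▸ Subgroup.mem_zpowers g')
  have hsum : ∑ g, S.indicator (1 : (K ≃ₐ[ℚ] K) → ℝ) g = Nat.card S := by
    rw [Finset.sum_indicator_eq_sum_filter, Nat.card_eq_fintype_card, Fintype.card_subtype]
    simp
  obtain ⟨N, hN, h⟩ := exists_dvd_eval_iff_frobenius_fixes hf hs
  rw [← hsum]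
  refine isVallePoussinSmall_weightedTheta_congr (w := fun p ↦ S.indicator 1 (σ p)) hN hmem ?_
  intro p hp hpN
  obtain ⟨P, hP⟩ := hσ p hp
  have h2 := h p P (σ p) hP hpN
  simp only [Set.indicator_apply, Pi.one_apply]
  exact if_congr h2 rfl rfl

end FrobeniusDensity

section PartialSummation

open Real MeasureTheory

open scoped Classical in
theorem weightedTheta_eq_sum_indicator (w : ℕ → ℝ) (x : ℝ) :
    weightedTheta w x =
      ∑ n ∈ Finset.Icc 0 ⌊x⌋₊, {p | p.Prime}.indicator (fun p ↦ w p * log p) n := by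
  rw [weightedTheta, Finset.sum_indicator_eq_sum_filter]
  refine Finset.sum_congr ?_ fun _ _ ↦ rfl
  ext p
  simp only [Finset.mem_filter, Finset.mem_Icc, Set.mem_ofPred_eq]
  exact ⟨fun h ↦ ⟨⟨by omega, h.1.2⟩, h.2⟩, fun h ↦ ⟨⟨h.2.one_le, h.1.2⟩, h.2⟩⟩

theorem continuousOn_inv_mul_log_sq (x : ℝ) :
    ContinuousOn (fun t : ℝ ↦ (t * log t ^ 2)⁻¹) (Set.Icc 2 x) := by
  intro t ht
  have h0 : t ≠ 0 := by linarith [ht.1]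
  have h1 : log t ≠ 0 := (log_pos (by linarith [ht.1])).ne'
  have : t * log t ^ 2 ≠ 0 := mul_ne_zero h0 (pow_ne_zero 2 h1)
  exact ContinuousAt.continuousWithinAt (by fun_prop)

theorem intervalIntegrable_weightedTheta (w : ℕ → ℝ) {x : ℝ} (hx : 2 ≤ x) :
    IntervalIntegrable (fun t ↦ weightedTheta w t * (t * log t ^ 2)⁻¹) volume 2 x := by
  rw [intervalIntegrable_iff_integrableOn_Icc_of_le hx]
  simp_rw [weightedTheta_eq_sum_indicator, mul_comm _ ((_ : ℝ)⁻¹)]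
  exact integrableOn_mul_sum_Icc _ (by norm_num)
    (continuousOn_inv_mul_log_sq x).integrableOn_Icc

open scoped Classical in
theorem sum_primes_eq_weightedTheta (w : ℕ → ℝ) {x : ℝ} (hx : 2 ≤ x) :
    ∑ p ∈ (Finset.Icc 1 ⌊x⌋₊).filter Nat.Prime, w p =
      weightedTheta w x / log x + ∫ t in (2 : ℝ)..x, weightedTheta w t * (t * log t ^ 2)⁻¹ := by
  let a : ℕ → ℝ := {p | p.Prime}.indicator (fun p ↦ w p * log p)
  trans ∑ n ∈ Finset.Icc 0 ⌊x⌋₊, (log n)⁻¹ * a n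
  · have : ∀ n : ℕ, (log n)⁻¹ * a n = {p | p.Prime}.indicator w n := by
      intro n
      by_cases h : n.Prime
      · have : log n ≠ 0 := log_ne_zero_of_pos_of_ne_one (mod_cast h.pos) (mod_cast h.ne_one)
        simp [a, h]
        field_simp
      · simp [a, h]
    simp_rw [this]
    rw [Finset.sum_indicator_eq_sum_filter]
    refine Finset.sum_congr ?_ fun _ _ ↦ rfl
    ext p
    simp only [Finset.mem_filter, Finset.mem_Icc, Set.mem_ofPred_eq]
    exact ⟨fun h ↦ ⟨⟨by omega, h.1.2⟩, h.2⟩, fun h ↦ ⟨⟨h.2.one_le, h.1.2⟩, h.2⟩⟩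
  have ha0 : a 0 = 0 := by simp [a]
  have ha1 : a 1 = 0 := by simp [a]
  have hsum : ∀ t : ℝ, ∑ n ∈ Finset.Icc 0 ⌊t⌋₊, a n = weightedTheta w t := fun t ↦
    (weightedTheta_eq_sum_indicator w t).symm
  have hd : ∀ u : ℝ, deriv (fun x ↦ (log x)⁻¹) u = -(u * log u ^ 2)⁻¹ := by
    intro u
    rw [deriv_inv_log_apply]
    simp [div_eq_mul_inv, mul_comm]
  rw [sum_mul_eq_sub_integral_mul₁ a (f := fun n ↦ (log n)⁻¹) ha0 ha1,
    ← intervalIntegral.integral_of_le hx]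
  · simp_rw [hd, hsum]
    rw [div_eq_inv_mul, sub_eq_add_neg, ← intervalIntegral.integral_neg]
    congr 2
    ext t
    ring
  · intro z hz
    have h0 : z ≠ 0 := by linarith [hz.1]
    have h1 : log z ≠ 0 := (log_pos (by linarith [hz.1])).ne'
    fun_prop
  · simp_rw [funext hd]
    exact (continuousOn_inv_mul_log_sq x).neg.integrableOn_Icc

theorem intervalIntegrable_mul_inv_mul_log_sq {x : ℝ} (hx : 2 ≤ x) :
    IntervalIntegrable (fun t : ℝ ↦ t * (t * log t ^ 2)⁻¹) volume 2 x := by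
  refine ContinuousOn.intervalIntegrable ?_
  rw [Set.uIcc_of_le hx]
  exact continuousOn_id.mul (continuousOn_inv_mul_log_sq x)

theorem integral_inv_log {x : ℝ} (hx : 2 ≤ x) :
    ∫ t in (2 : ℝ)..x, 1 / log t =
      x / log x - 2 / log 2 + ∫ t in (2 : ℝ)..x, t * (t * log t ^ 2)⁻¹ := by
  have hI := intervalIntegrable_mul_inv_mul_log_sq hx
  have hc : ContinuousOn (fun t : ℝ ↦ 1 / log t) (Set.uIcc 2 x) := by
    rw [Set.uIcc_of_le hx]
    intro t ht
    have h0 : t ≠ 0 := by linarith [ht.1]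
    have h1 : log t ≠ 0 := (log_pos (by linarith [ht.1])).ne'
    exact ContinuousAt.continuousWithinAt (by fun_prop (disch := assumption))
  have hJ := hc.intervalIntegrable (μ := volume)
  have := intervalIntegral.integral_eq_sub_of_hasDerivAt (a := 2) (b := x)
    (f := fun t ↦ t / log t) (f' := fun t ↦ 1 / log t - t * (t * log t ^ 2)⁻¹) ?_ (hJ.sub hI)
  · rw [intervalIntegral.integral_sub hJ hI] at this
    linarith
  · intro t ht
    rw [Set.uIcc_of_le hx] at ht
    have h0 : t ≠ 0 := by linarith [ht.1]
    have h1 : log t ≠ 0 := (log_pos (by linarith [ht.1])).ne'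
    refine ((hasDerivAt_id t).div (hasDerivAt_log h0) h1).congr_deriv ?_
    simp only [id]
    field_simp

theorem exp_neg_mul_sqrt_log_le {c t x : ℝ} (hc0 : 0 < c) (hc : c ≤ 1 / 2) (ht : 2 ≤ t)
    (htx : t ≤ x) :
    exp (-c * √(log t)) ≤ t ^ (-(1 / 2) : ℝ) * (x ^ (1 / 2 : ℝ) * exp (-c * √(log x))) := by
  have ht0 : 0 < t := by linarith
  have hx0 : 0 < x := by linarith
  rw [rpow_def_of_pos ht0, rpow_def_of_pos hx0, ← exp_add, ← exp_add, exp_le_exp]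
  have h2 : (1 / 2) ^ 2 ≤ log t := by
    have := log_two_gt_d9
    have := log_le_log (by norm_num) ht
    norm_num
    linarith
  have h3 : 1 / 2 ≤ √(log t) := le_sqrt_of_sq_le h2
  have h4 : √(log t) ≤ √(log x) := sqrt_le_sqrt (log_le_log ht0 htx)
  have h5 : log t = √(log t) ^ 2 := (sq_sqrt (by linarith)).symm
  have h6 : log x = √(log x) ^ 2 := (sq_sqrt (by linarith [log_le_log ht0 htx])).symm
  generalize √(log t) = u at *
  generalize √(log x) = v at *
  rw [h5, h6]
  nlinarith only [mul_nonneg (sub_nonneg.2 h4) (show 0 ≤ u + v - 2 * c by linarith)]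

/-- Dividing by `t log² t` and integrating preserves the error term. -/
theorem IsVallePoussinSmall.integral {E : ℝ → ℝ} (h : IsVallePoussinSmall E) :
    IsVallePoussinSmall fun x ↦ ∫ t in (2 : ℝ)..x, E t * (t * log t ^ 2)⁻¹ := by
  obtain ⟨C, c', hC, hc', h⟩ := h
  set c := min c' (1 / 2) with hcdef
  have hc0 : 0 < c := lt_min hc' (by norm_num)
  have hc : c ≤ 1 / 2 := min_le_right _ _
  have hlog2 : 0 < log 2 := log_pos (by norm_num)
  refine ⟨C * 2 / log 2 ^ 2, c, by positivity, hc0, fun x hx ↦ ?_⟩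
  have hx0 : 0 < x := by linarith
  set A := x ^ (1 / 2 : ℝ) * exp (-c * √(log x)) with hA
  have hA0 : 0 ≤ A := by positivity
  have hbound : ∀ t ∈ Set.Ioc 2 x, ‖E t * (t * log t ^ 2)⁻¹‖ ≤
      C * A / log 2 ^ 2 * t ^ (-(1 / 2) : ℝ) := by
    intro t ht
    have ht0 : 0 < t := by linarith [ht.1]
    have hl : log 2 ≤ log t := log_le_log (by norm_num) ht.1.le
    rw [norm_mul, norm_inv, norm_eq_abs, norm_eq_abs,
      abs_of_nonneg (by positivity : 0 ≤ t * log t ^ 2)]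
    have h1 : |E t| ≤ C * (t * (t ^ (-(1 / 2) : ℝ) * A)) := by
      refine (h t ht.1.le).trans ?_
      gcongr
      refine le_trans ?_ (exp_neg_mul_sqrt_log_le hc0 hc ht.1.le ht.2)
      gcongr
      exact min_le_left _ _
    calc |E t| * (t * log t ^ 2)⁻¹
        ≤ C * (t * (t ^ (-(1 / 2) : ℝ) * A)) * (t * log 2 ^ 2)⁻¹ := by gcongr
      _ = _ := by field_simp
  have hinteg : ∫ t in (2 : ℝ)..x, t ^ (-(1 / 2) : ℝ) ≤ 2 * x ^ (1 / 2 : ℝ) := by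
    rw [integral_rpow (Or.inl (by norm_num))]
    norm_num
    have : (0 : ℝ) ≤ 2 ^ (1 / 2 : ℝ) := by positivity
    norm_num at this
    linarith
  have := intervalIntegral.norm_integral_le_of_norm_le hx
    (ae_of_all _ hbound) ((intervalIntegral.intervalIntegrable_rpow' (by norm_num)).const_mul _)
  rw [intervalIntegral.integral_const_mul] at this
  refine this.trans ((mul_le_mul_of_nonneg_left hinteg (by positivity)).trans_eq ?_)
  have hxx : x ^ (1 / 2 : ℝ) * x ^ (1 / 2 : ℝ) = x := by
    rw [← rpow_add hx0]; norm_num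
  rw [hA]
  calc _ = C * 2 / log 2 ^ 2 * ((x ^ (1 / 2 : ℝ) * x ^ (1 / 2 : ℝ)) * exp (-c * √(log x))) := by
        ring
    _ = _ := by rw [hxx]

open scoped Classical in
/-- Passage from a weighted Chebyshev function to the corresponding prime counting function. -/
theorem IsVallePoussinSmall.sum_primes {w : ℕ → ℝ} {δ : ℝ}
    (h : IsVallePoussinSmall fun x ↦ weightedTheta w x - δ * x) :
    IsVallePoussinSmall fun x ↦ ∑ p ∈ (Finset.Icc 1 ⌊x⌋₊).filter Nat.Prime, w p -
      δ * ∫ t in (2 : ℝ)..x, 1 / log t := by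
  have hlog2 : 0 < log 2 := log_pos (by norm_num)
  have h1 : IsVallePoussinSmall fun x ↦ (weightedTheta w x - δ * x) / log x := by
    refine (h.const_mul (log 2)⁻¹).mono fun x hx ↦ ?_
    have hl : log 2 ≤ log x := log_le_log (by norm_num) hx
    rw [abs_div, abs_mul, abs_of_pos (by linarith : 0 < log x), abs_of_pos (inv_pos.2 hlog2),
      div_eq_inv_mul]
    gcongr
  have h2 : IsVallePoussinSmall fun _ ↦ δ * (2 / log 2) :=
    .of_bounded (M := |δ * (2 / log 2)|) fun _ _ ↦ le_rfl
  refine ((h1.add h.integral).add h2).congr fun x hx ↦ ?_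
  have hI := intervalIntegrable_weightedTheta w hx
  have hJ := (intervalIntegrable_mul_inv_mul_log_sq hx).const_mul δ
  rw [sum_primes_eq_weightedTheta w hx, integral_inv_log hx]
  simp_rw [sub_mul, mul_assoc]
  rw [intervalIntegral.integral_sub hI hJ, intervalIntegral.integral_const_mul]
  ring

end PartialSummation

open Polynomial in
theorem isVallePoussinSmall_card_dvd_eval {K : Type*} [Field K] [NumberField K] [IsGalois ℚ K]
    {f : ℤ[X]} (hf : f ≠ 0) (hs : (f.map (algebraMap ℤ K)).Splits) :
    IsVallePoussinSmall fun x ↦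
      ({p : ℕ | p.Prime ∧ (∃ n : ℕ, 0 < n ∧ (p : ℤ) ∣ f.eval (n : ℤ)) ∧ (p : ℝ) ≤ x}.ncard : ℝ) -
        (Nat.card {σ : K ≃ₐ[ℚ] K | ∃ α ∈ (f.map (Int.castRingHom ℚ)).rootSet K, σ α = α} : ℝ) /
          (Nat.card (K ≃ₐ[ℚ] K) : ℝ) * ∫ t in (2 : ℝ)..x, 1 / Real.log t := by
  classical
  have : Fintype (K ≃ₐ[ℚ] K) := Fintype.ofFinite _
  refine (isVallePoussinSmall_weightedTheta_dvd_eval hf hs).sum_primes.congr fun x hx ↦ ?_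
  congr 1
  rw [← Finset.sum_filter, Finset.sum_const, nsmul_one, ← Set.ncard_coe_finset]
  congr 2
  ext p
  have h0 : 0 ≤ x := by linarith
  simp only [Finset.coe_filter, Finset.mem_filter, Finset.mem_Icc, Set.mem_ofPred_eq,
    Nat.le_floor_iff h0]
  exact ⟨fun h ↦ ⟨⟨⟨h.1.one_le, h.2.2⟩, h.1⟩, h.2.1⟩, fun h ↦ ⟨h.1.2, h.2, h.1.1.2⟩⟩

/-- Effective Chebotarev-type asymptotic for the counting function of the set `𝒫_f` of
primes dividing some value of a nonconstant `f ∈ ℤ[X]`, with density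
`δ_f = #{σ ∈ Gal(K/ℚ) : σ fixes some root of f}/#Gal(K/ℚ)`, `K` the splitting field. -/
theorem stmt_11 (f : Polynomial ℤ) (hf : 0 < f.natDegree)
    (K : Type) [Field K] [Algebra ℚ K]
    (hK : Polynomial.IsSplittingField ℚ K (f.map (Int.castRingHom ℚ)))
    (δ : ℝ)
    (hδ : δ = (Nat.card {σ : K ≃ₐ[ℚ] K |
        ∃ α ∈ (f.map (Int.castRingHom ℚ)).rootSet K, σ α = α} : ℝ)
      / (Nat.card (K ≃ₐ[ℚ] K) : ℝ)) :
    ∃ C D : ℝ, 0 < C ∧ 0 < D ∧ ∀ x : ℝ, 2 ≤ x →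
      |({p : ℕ | p.Prime ∧ (∃ n : ℕ, 0 < n ∧ (p : ℤ) ∣ f.eval (n : ℤ)) ∧
            (p : ℝ) ≤ x}.ncard : ℝ)
          - δ * ∫ t in (2 : ℝ)..x, 1 / Real.log t|
        ≤ D * x / Real.exp (C * Real.sqrt (Real.log x)) := by
  have : CharZero K := charZero_of_injective_algebraMap (algebraMap ℚ K).injective
  obtain rfl : ‹Algebra ℚ K› = DivisionRing.toRatAlgebra := Subsingleton.elim _ _
  have : FiniteDimensional ℚ K :=
    Polynomial.IsSplittingField.finiteDimensional K (f.map (Int.castRingHom ℚ))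
  have : NumberField K := ⟨⟩
  have : Normal ℚ K := Normal.of_isSplittingField (f.map (Int.castRingHom ℚ))
  have : IsGalois ℚ K := ⟨⟩
  have hs : (f.map (algebraMap ℤ K)).Splits := by
    have := hK.splits
    rwa [Polynomial.map_map, RingHom.ext_int ((algebraMap ℚ K).comp (Int.castRingHom ℚ))
      (algebraMap ℤ K)] at this
  have hf0 : f ≠ 0 := by
    rintro rfl
    simp at hf
  obtain ⟨D, C, hD, hC, h⟩ := isVallePoussinSmall_card_dvd_eval (K := K) hf0 hs
  refine ⟨C, D + 1, hC, by linarith, fun x hx ↦ ?_⟩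
  rw [hδ]
  refine (h x hx).trans ?_
  rw [neg_mul, Real.exp_neg, ← mul_assoc, ← div_eq_mul_inv]
  gcongr
  linarith
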